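/- Let (Ω, ℱ, P) be a probability space with a filtration (ℱ_t)_{t∈[0,1]} and let B : Ω × [0,1] → ℝ^d be an (ℱ_t)-Brownian motion. Let σ : ℝ^d → ℝ^{d×d} be twice continuously differentiable with ‖σ‖_{C^2} < ∞ and satisfy σ(x)σ(x)^T ⪰ λ·I_d for all x with some λ > 0. Fix y ∈ ℝ^d and n ∈ ℕ, and let X̄ : Ω × [0,1] → ℝ^d be the (drift-free) Euler–Maruyama scheme: X̄_0 = y and X̄_t = X̄_{κ_n(t)} + σ(X̄_{κ_n(t)})·(B_t − B_{κ_n(t)}) for t ∈ (0,1], where the values at gridpoints are defined recursively. Let α ∈ (0,1), ε₁ ∈ (0,1/2) and p > 0. Then there exists a constant N = N(α, p, d, ε₁, λ, ‖σ‖_{C^2}) such that for all f : ℝ^d → ℝ with ‖f‖_{C^α} < ∞ and all 0 ≤ s ≤ t ≤ 1, ‖∫_s^t (f(X̄_r) − f(X̄_{κ_n(r)})) dr‖_{L_p(Ω)} ≤ N·‖f‖_{C^α}·n^{−1/2+2ε₁}·|t−s|^{1/2+ε₁}. -/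

import Mathlib

open MeasureTheory ProbabilityTheory Set

/-- The `L_p(Ω)` norm `(E|X|^p)^{1/p}` of a random variable. -/
noncomputable def lpNorm {Ω : Type} [MeasurableSpace Ω] {F : Type*} [NormedAddCommGroup F]
    (P : Measure Ω) (p : ℝ) (X : Ω → F) : ℝ :=
  (∫ ω, ‖X ω‖ ^ p ∂P) ^ (1 / p)

/-- `κ_n(t) = ⌊nt⌋/n`. -/
noncomputable def kappa (n : ℕ) (t : ℝ) : ℝ := (⌊(n : ℝ) * t⌋ : ℝ) / n

/-- A `d`-dimensional `(ℱ_t)`-Brownian motion on `[0,1]`: continuous paths,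
`B_0 = 0`, adapted, and for `0 ≤ s ≤ t ≤ 1` the increment `B_t - B_s` is
independent of `ℱ_s` and is a centered Gaussian vector with covariance
`(t-s)·I_d`. -/
structure IsBrownianMotion {Ω : Type} [MeasurableSpace Ω] (P : Measure Ω)
    (ℱ : ℝ → MeasurableSpace Ω) {d : ℕ}
    (B : ℝ → Ω → EuclideanSpace ℝ (Fin d)) : Prop where
  contPaths : ∀ ω, ContinuousOn (fun t => B t ω) (Icc 0 1)
  init : ∀ ω, B 0 ω = 0
  adapted : ∀ t : ℝ, 0 ≤ t → t ≤ 1 → Measurable[ℱ t] (B t)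
  indep : ∀ s t : ℝ, 0 ≤ s → s ≤ t → t ≤ 1 →
    ProbabilityTheory.Indep
      (MeasurableSpace.comap (fun ω => fun i => B t ω i - B s ω i) inferInstance)
      (ℱ s) P
  law : ∀ s t : ℝ, 0 ≤ s → s ≤ t → t ≤ 1 →
    Measure.map (fun ω => fun i => B t ω i - B s ω i) P
      = Measure.pi (fun _ : Fin d => gaussianReal 0 (Real.toNNReal (t - s)))

namespace EM

/-! ### Part 1: moment bounds from conditional bounds -/

theorem term_bound (r : ℕ) (δ : ℝ) (hδ : 0 < δ) (hδ1 : δ ≤ 1) (a b : ℝ) (ha : 0 ≤ a) (hb : 0 ≤ b)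
    (m : ℕ) (hm1 : 1 ≤ m) (hm2 : m ≤ 2*r+2) :
    a^m * b^(2*r+4-m) ≤ δ * b^(2*r+4) + δ⁻¹ * (a^(2*r+2)*b^2 + a^2*b^(2*r+2)) := by
  have hδi : 1 ≤ δ⁻¹ := (one_le_inv₀ hδ).2 hδ1
  have n1 : 0 ≤ a^(2*r+2)*b^2 := by positivity
  have n2 : 0 ≤ a^2*b^(2*r+2) := by positivity
  have n3 : 0 ≤ δ * b^(2*r+4) := by positivity
  rcases le_total a (δ*b) with h | h
  · have h1 : a^m ≤ δ * b^m := by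
      calc a^m ≤ (δ*b)^m := pow_le_pow_left₀ ha h m
        _ = δ^m * b^m := mul_pow _ _ _
        _ ≤ δ * b^m := by
          apply mul_le_mul_of_nonneg_right _ (by positivity)
          exact pow_le_of_le_one hδ.le hδ1 (by omega)
    have h2 : a^m * b^(2*r+4-m) ≤ δ * b^(2*r+4) := by
      calc a^m * b^(2*r+4-m) ≤ (δ * b^m) * b^(2*r+4-m) := by gcongr
        _ = δ * b^(2*r+4) := by
          rw [mul_assoc, ← pow_add]; congr 2; omega
    have : 0 ≤ δ⁻¹ * (a^(2*r+2)*b^2 + a^2*b^(2*r+2)) := by positivity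
    linarith
  · have key : a^m * b^(2*r+4-m) ≤ δ⁻¹ * (a^(2*r+2)*b^2 + a^2*b^(2*r+2)) := by
      rcases Nat.lt_or_ge m 2 with hm | hm
      · obtain rfl : m = 1 := by omega
        have : b ≤ δ⁻¹ * a := by
          rw [inv_mul_eq_div, le_div_iff₀ hδ]; linarith
        calc a^1 * b^(2*r+4-1) = a * (b * b^(2*r+2)) := by
              rw [pow_one]; congr 1; rw [← pow_succ']; congr 1
          _ ≤ a * ((δ⁻¹ * a) * b^(2*r+2)) := by gcongr
          _ = δ⁻¹ * (a^2*b^(2*r+2)) := by ring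
          _ ≤ _ := by
            apply mul_le_mul_of_nonneg_left _ (by positivity); linarith
      · obtain ⟨k, rfl⟩ := Nat.exists_eq_add_of_le hm
        have hk : k ≤ 2*r := by omega
        have e : a^(2+k) * b^(2*r+4-(2+k)) = (a^k * b^(2*r-k)) * (a^2*b^2) := by
          have : 2*r+4-(2+k) = (2*r-k)+2 := by omega
          rw [this]; ring
        have h3 : a^k * b^(2*r-k) ≤ a^(2*r) + b^(2*r) := by
          rcases le_total a b with hab | hab
          · calc a^k * b^(2*r-k) ≤ b^k * b^(2*r-k) := by gcongr
              _ = b^(2*r) := by rw [← pow_add]; congr 1; omega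
              _ ≤ _ := by have : 0 ≤ a^(2*r) := by positivity
                          linarith
          · calc a^k * b^(2*r-k) ≤ a^k * a^(2*r-k) := by gcongr
              _ = a^(2*r) := by rw [← pow_add]; congr 1; omega
              _ ≤ _ := by have : 0 ≤ b^(2*r) := by positivity
                          linarith
        rw [e]
        calc (a^k * b^(2*r-k)) * (a^2*b^2) ≤ (a^(2*r) + b^(2*r)) * (a^2*b^2) := by gcongr
          _ = 1 * (a^(2*r+2)*b^2 + a^2*b^(2*r+2)) := by ring
          _ ≤ _ := by gcongr
    linarith

theorem pow_ineq (r : ℕ) (η : ℝ) (hη : 0 < η) : ∃ C : ℝ, 0 < C ∧ ∀ a b : ℝ,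
    (a+b)^(2*r+4) ≤ a^(2*r+4) + (1+η) * b^(2*r+4) + (2*r+4) * (a^(2*r+3) * b)
      + C * (a^(2*r+2)*b^2 + a^2*b^(2*r+2)) := by
  set T : ℝ := ∑ m ∈ Finset.range (2*r+2), ((2*r+4).choose (m+1) : ℝ) with hT
  have hTpos : 0 < T := by
    apply Finset.sum_pos
    · intro m hm
      have := Finset.mem_range.1 hm
      exact_mod_cast Nat.choose_pos (by omega)
    · exact ⟨0, by simp⟩
  set δ : ℝ := min 1 (η / T) with hδ
  have hδ0 : 0 < δ := lt_min one_pos (by positivity)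
  have hδ1 : δ ≤ 1 := min_le_left _ _
  have hδT : δ * T ≤ η := by
    calc δ * T ≤ (η/T) * T := by gcongr; exact min_le_right _ _
      _ = η := by field_simp
  refine ⟨T * δ⁻¹, by positivity, fun a b => ?_⟩
  have e4 : ∀ x : ℝ, x^(2*r+4) = |x|^(2*r+4) := fun x => (Even.pow_abs ⟨r+2, by ring⟩ x).symm
  have e2 : ∀ x : ℝ, x^(2*r+2) = |x|^(2*r+2) := fun x => (Even.pow_abs ⟨r+1, by ring⟩ x).symm
  have exp : (a+b)^(2*r+4) = ∑ m ∈ Finset.range (2*r+2), a^(m+1) * b^(2*r+4-(m+1)) * ((2*r+4).choose (m+1) : ℝ)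
      + b^(2*r+4) + (2*r+4) * (a^(2*r+3) * b) + a^(2*r+4) := by
    rw [add_pow, Finset.sum_range_succ, Finset.sum_range_succ, Finset.sum_range_succ']
    have : (2*r+4).choose (2*r+3) = 2*r+4 := by
      rw [show 2*r+4 = (2*r+3)+1 by ring, Nat.choose_succ_self_right]
    have h5 : 2*r+4 - (2*r+3) = 1 := by omega
    simp only [h5, this, Nat.choose_self, Nat.sub_self, Nat.sub_zero, Nat.choose_zero_right]
    push_cast; ring
  have mid : ∑ m ∈ Finset.range (2*r+2), a^(m+1) * b^(2*r+4-(m+1)) * ((2*r+4).choose (m+1) : ℝ)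
      ≤ (δ * b^(2*r+4) + δ⁻¹ * (a^(2*r+2)*b^2 + a^2*b^(2*r+2))) * T := by
    rw [hT, Finset.mul_sum]
    apply Finset.sum_le_sum
    intro m hm
    have hm' := Finset.mem_range.1 hm
    apply mul_le_mul_of_nonneg_right _ (by positivity)
    have := term_bound r δ hδ0 hδ1 |a| |b| (abs_nonneg _) (abs_nonneg _) (m+1) (by omega) (by omega)
    rw [← e4, ← e2, ← e2, sq_abs, sq_abs] at this
    refine le_trans (le_trans (le_abs_self _) (le_of_eq ?_)) this
    rw [abs_mul, abs_pow, abs_pow]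
  have hb4 : 0 ≤ b^(2*r+4) := by rw [e4]; positivity
  have : δ * b^(2*r+4) * T ≤ η * b^(2*r+4) := by
    calc δ * b^(2*r+4) * T = (δ * T) * b^(2*r+4) := by ring
      _ ≤ _ := by gcongr
  rw [exp]
  nlinarith [mid, this]

/-- A sequence of bounded adapted variables, whose block sums satisfy a square-root conditional bound. -/
structure MSys {Ω : Type} [m0 : MeasurableSpace Ω] (P : Measure Ω) (G : ℕ → MeasurableSpace Ω)
    (Y : ℕ → Ω → ℝ) (A : ℝ) (n : ℕ) : Prop where
  mono : Monotone G
  le : ∀ k, G k ≤ m0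
  meas : ∀ k, k < n → Measurable[G (k+1)] (Y k)
  bd : ∀ k ω, |Y k ω| ≤ 1
  cond : ∀ i l : ℕ, i ≤ l → l ≤ n → ∀ Z : Ω → ℝ, Measurable[G i] Z → (∃ b, ∀ ω, |Z ω| ≤ b) →
    |∫ ω, Z ω * ∑ k ∈ Finset.Ico i l, Y k ω ∂P| ≤ A * √((l - i : ℕ) : ℝ) * ∫ ω, |Z ω| ∂P

def MBound (ρ A : ℝ) (q : ℕ) (D : ℝ) : Prop :=
  ∀ (Ω : Type) [m0 : MeasurableSpace Ω] (P : Measure Ω), IsProbabilityMeasure P →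
  ∀ (G : ℕ → MeasurableSpace Ω) (Y : ℕ → Ω → ℝ) (n : ℕ), MSys P G Y A n →
  ∀ L i l : ℕ, i ≤ l → l ≤ n → l - i ≤ 2^L → ∀ Z : Ω → ℝ, Measurable[G i] Z →
    (∃ b, ∀ ω, |Z ω| ≤ b) → (∀ ω, 0 ≤ Z ω) →
    ∫ ω, Z ω * (∑ k ∈ Finset.Ico i l, Y k ω)^(2*q) ∂P ≤ D * (ρ^L)^q * ∫ ω, Z ω ∂P

theorem int_of_bdd {Ω : Type} [m0 : MeasurableSpace Ω] (P : Measure Ω) [IsProbabilityMeasure P]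
    {Z : Ω → ℝ} (hZ : Measurable Z) (hb : ∃ b, ∀ ω, |Z ω| ≤ b) : Integrable Z P := by
  obtain ⟨b, hb⟩ := hb
  exact Integrable.of_bound hZ.aestronglyMeasurable b (Filter.Eventually.of_forall hb)

theorem bdd_mul {Ω : Type} {Z W : Ω → ℝ} (hZ : ∃ b, ∀ ω, |Z ω| ≤ b) (hW : ∃ b, ∀ ω, |W ω| ≤ b) :
    ∃ b, ∀ ω, |Z ω * W ω| ≤ b := by
  obtain ⟨b, hb⟩ := hZ
  obtain ⟨c, hc⟩ := hW
  refine ⟨b * c, fun ω => ?_⟩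
  rw [abs_mul]
  have := abs_nonneg (Z ω)
  have := abs_nonneg (W ω)
  exact mul_le_mul (hb ω) (hc ω) (abs_nonneg _) ((abs_nonneg _).trans (hb ω))

theorem bdd_pow {Ω : Type} {Z : Ω → ℝ} (hZ : ∃ b, ∀ ω, |Z ω| ≤ b) (k : ℕ) :
    ∃ b, ∀ ω, |(Z ω)^k| ≤ b := by
  obtain ⟨b, hb⟩ := hZ
  refine ⟨b^k, fun ω => ?_⟩
  rw [abs_pow]
  exact pow_le_pow_left₀ (abs_nonneg _) (hb ω) k

section
variable {Ω : Type} [m0 : MeasurableSpace Ω] {P : Measure Ω} {G : ℕ → MeasurableSpace Ω}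
    {Y : ℕ → Ω → ℝ} {A : ℝ} {n : ℕ}

theorem MSys.sum_meas (h : MSys P G Y A n) {i l : ℕ} (hl : l ≤ n) :
    Measurable[G l] (fun ω => ∑ k ∈ Finset.Ico i l, Y k ω) := by
  apply Finset.measurable_sum
  intro k hk
  have := Finset.mem_Ico.1 hk
  exact (h.meas k (by omega)).mono (h.mono (by omega)) le_rfl

theorem MSys.sum_bdd (h : MSys P G Y A n) (i l : ℕ) :
    ∃ b, ∀ ω, |∑ k ∈ Finset.Ico i l, Y k ω| ≤ b := by
  refine ⟨∑ k ∈ Finset.Ico i l, 1, fun ω => (Finset.abs_sum_le_sum_abs _ _).trans ?_⟩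
  exact Finset.sum_le_sum (fun k _ => h.bd k ω)
end

theorem mbound_zero (ρ A : ℝ) : MBound ρ A 0 1 := by
  intro Ω m0 P hP G Y n h L i l hil hl hL Z hZ hb h0
  simp

/-- The dyadic induction step. -/
theorem mbound_step (ρ A η C D D1 : ℝ) (q : ℕ) (hρ : 2 < ρ) (hA : 0 ≤ A) (hη : 0 < η)
    (hηρ : 2 + 2*η < ρ) (hC : 0 ≤ C) (hD : 0 < D) (hD1 : 0 < D1)
    (hineq : ∀ a b : ℝ, (a+b)^(2*(q+1)) ≤ a^(2*(q+1)) + (1+η) * b^(2*(q+1))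
      + (2*(q+1)) * (a^(2*q+1) * b) + C * (a^(2*q)*b^2 + a^2*b^(2*q)))
    (hq : MBound ρ A q D) (h1 : 0 < C → MBound ρ A 1 D1) :
    ∃ D', 0 < D' ∧ MBound ρ A (q+1) D' := by
  set K : ℝ := ((q+1)*A)^2/η * D + 2*C*(D1*D) with hK
  have hK0 : 0 ≤ K := by positivity
  set D' : ℝ := 1 + K/(ρ - (2+2*η)) with hD'
  have hgap : 0 < ρ - (2+2*η) := by linarith
  have hD'1 : 1 ≤ D' := by
    have : 0 ≤ K/(ρ - (2+2*η)) := by positivity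
    linarith
  have hrec : (2+2*η) * D' + K ≤ ρ * D' := by
    have : K ≤ (ρ - (2+2*η)) * D' := by
      rw [hD', mul_add, mul_div_cancel₀ _ hgap.ne']; linarith
    linarith
  refine ⟨D', by linarith, ?_⟩
  intro Ω m0 P hP G Y n h L
  induction L with
  | zero =>
    intro i l hil hl hL Z hZ hb h0
    have hle : ∀ ω, Z ω * (∑ k ∈ Finset.Ico i l, Y k ω)^(2*(q+1)) ≤ Z ω := by
      intro ω
      have : (∑ k ∈ Finset.Ico i l, Y k ω)^(2*(q+1)) ≤ 1 := by
        rw [← Even.pow_abs ⟨q+1, by ring⟩]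
        apply pow_le_one₀ (abs_nonneg _)
        refine (Finset.abs_sum_le_sum_abs _ _).trans ?_
        refine (Finset.sum_le_sum (fun k _ => h.bd k ω)).trans ?_
        simp only [Finset.sum_const, Nat.card_Ico, nsmul_eq_mul, mul_one]
        exact_mod_cast hL
      nlinarith [h0 ω]
    have hZm : Measurable Z := hZ.mono (h.le i) le_rfl
    have hSm : Measurable (fun ω => ∑ k ∈ Finset.Ico i l, Y k ω) := (h.sum_meas hl).mono (h.le l) le_rfl
    calc _ ≤ ∫ ω, Z ω ∂P := by
          apply integral_mono _ (int_of_bdd P hZm hb) hle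
          exact int_of_bdd P (hZm.mul (hSm.pow_const _)) (bdd_mul hb (bdd_pow (h.sum_bdd i l) _))
      _ ≤ _ := by
          have : 0 ≤ ∫ ω, Z ω ∂P := integral_nonneg h0
          simp only [pow_zero, one_pow, mul_one]
          nlinarith
  | succ L ih =>
    intro i l hil hl hL Z hZ hb h0
    set mid := min (i + 2^L) l with hmid
    have him : i ≤ mid := le_min (by omega) hil
    have hml : mid ≤ l := min_le_right _ _
    have hL1 : mid - i ≤ 2^L := by
      have : mid ≤ i + 2^L := min_le_left _ _
      omega
    have hL2 : l - mid ≤ 2^L := by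
      rw [pow_succ] at hL
      rcases min_choice (i + 2^L) l with h' | h' <;> rw [hmid, h'] <;> omega
    set S1 : Ω → ℝ := fun ω => ∑ k ∈ Finset.Ico i mid, Y k ω with hS1
    set S2 : Ω → ℝ := fun ω => ∑ k ∈ Finset.Ico mid l, Y k ω with hS2
    have hsum : ∀ ω, ∑ k ∈ Finset.Ico i l, Y k ω = S1 ω + S2 ω := fun ω =>
      (Finset.sum_Ico_consecutive _ him hml).symm
    have mS1 : Measurable[G mid] S1 := h.sum_meas (hml.trans hl)
    have mS2 : Measurable[G l] S2 := h.sum_meas hl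
    have mZ : Measurable[G mid] Z := hZ.mono (h.mono him) le_rfl
    have bS1 : ∃ b, ∀ ω, |S1 ω| ≤ b := h.sum_bdd i mid
    have bS2 : ∃ b, ∀ ω, |S2 ω| ≤ b := h.sum_bdd mid l
    have MS1 : Measurable S1 := mS1.mono (h.le _) le_rfl
    have MS2 : Measurable S2 := mS2.mono (h.le _) le_rfl
    have MZ : Measurable Z := mZ.mono (h.le _) le_rfl
    have hI : ∀ j k, Integrable (fun ω => Z ω * (S1 ω ^ j * S2 ω ^ k)) P := fun j k =>
      int_of_bdd P (MZ.mul ((MS1.pow_const _).mul (MS2.pow_const _)))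
        (bdd_mul hb (bdd_mul (bdd_pow bS1 _) (bdd_pow bS2 _)))
    set z := ∫ ω, Z ω ∂P with hz
    have hz0 : 0 ≤ z := integral_nonneg h0
    have ev : ∀ k : ℕ, ∀ x : ℝ, 0 ≤ x^(2*k) := fun k x => by rw [pow_mul]; positivity
    set R := ρ^L with hR
    have hRp : 0 < R := by positivity
    have h2R : (2:ℝ)^L ≤ R := by rw [hR]; gcongr
    -- the terms
    have mq : Measurable[G mid] (fun ω => Z ω * S1 ω ^ (2*q)) := mZ.mul (mS1.pow_const _)
    have bq : ∃ b, ∀ ω, |Z ω * S1 ω ^ (2*q)| ≤ b := bdd_mul hb (bdd_pow bS1 _)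
    have t1 : ∫ ω, Z ω * (S1 ω ^ (2*(q+1)) * S2 ω ^ 0) ∂P ≤ D' * R^(q+1) * z := by
      simpa using ih i mid him (hml.trans hl) hL1 Z hZ hb h0
    have t2 : ∫ ω, Z ω * (S1 ω ^ 0 * S2 ω ^ (2*(q+1))) ∂P ≤ D' * R^(q+1) * z := by
      simpa using ih mid l hml hl hL2 Z mZ hb h0
    have tq : ∫ ω, Z ω * (S1 ω ^ (2*q) * S2 ω ^ 0) ∂P ≤ D * R^q * z := by
      simpa using hq Ω P hP G Y n h L i mid him (hml.trans hl) hL1 Z hZ hb h0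
    have tc : C * ∫ ω, Z ω * (S1 ω ^ (2*q) * S2 ω ^ 2) ∂P ≤ C * (D1 * D * R^(q+1) * z) := by
      rcases hC.eq_or_lt with hC0 | hC0
      · rw [← hC0]; simp
      · apply mul_le_mul_of_nonneg_left _ hC
        have := h1 hC0 Ω P hP G Y n h L mid l hml hl hL2 (fun ω => Z ω * S1 ω ^ (2*q)) mq bq
          (fun ω => mul_nonneg (h0 ω) (ev _ _))
        calc _ = ∫ ω, Z ω * S1 ω ^ (2*q) * S2 ω ^ (2*1) ∂P := by
              congr 1; ext ω; ring
          _ ≤ D1 * R^1 * ∫ ω, Z ω * S1 ω ^ (2*q) ∂P := this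
          _ ≤ D1 * R^1 * (D * R^q * z) := by
              gcongr
              simpa using tq
          _ = _ := by ring
    have tc' : C * ∫ ω, Z ω * (S1 ω ^ 2 * S2 ω ^ (2*q)) ∂P ≤ C * (D1 * D * R^(q+1) * z) := by
      rcases hC.eq_or_lt with hC0 | hC0
      · rw [← hC0]; simp
      · apply mul_le_mul_of_nonneg_left _ hC
        have a1 := h1 hC0 Ω P hP G Y n h L i mid him (hml.trans hl) hL1 Z hZ hb h0
        have a2 := hq Ω P hP G Y n h L mid l hml hl hL2 (fun ω => Z ω * S1 ω ^ 2) (mZ.mul (mS1.pow_const _))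
          (bdd_mul hb (bdd_pow bS1 _)) (fun ω => mul_nonneg (h0 ω) (by positivity))
        calc _ = ∫ ω, Z ω * S1 ω ^ 2 * S2 ω ^ (2*q) ∂P := by
              congr 1; ext ω; ring
          _ ≤ D * R^q * ∫ ω, Z ω * S1 ω ^ 2 ∂P := a2
          _ ≤ D * R^q * (D1 * R^1 * z) := by
              gcongr
          _ = _ := by ring
    have tx : (2*(q+1)) * ∫ ω, Z ω * (S1 ω ^ (2*q+1) * S2 ω ^ 1) ∂P
        ≤ η * (D' * R^(q+1) * z) + ((q+1)*A)^2/η * (D * R^(q+1) * z) := by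
      set s := √((l - mid : ℕ) : ℝ) with hs
      have hs0 : 0 ≤ s := Real.sqrt_nonneg _
      have hs2 : s^2 ≤ R := by
        rw [hs, Real.sq_sqrt (by positivity)]
        refine le_trans ?_ h2R
        exact_mod_cast hL2
      have c := h.cond mid l hml hl (fun ω => Z ω * S1 ω ^ (2*q+1)) (mZ.mul (mS1.pow_const _))
        (bdd_mul hb (bdd_pow bS1 _))
      have c1 : ∫ ω, Z ω * (S1 ω ^ (2*q+1) * S2 ω ^ 1) ∂P ≤ A * s * ∫ ω, |Z ω * S1 ω ^ (2*q+1)| ∂P := by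
        refine le_trans (le_abs_self _) (le_trans (le_of_eq ?_) c)
        congr 2; ext ω; rw [pow_one, mul_assoc]
      have habs : Integrable (fun ω => |Z ω * S1 ω ^ (2*q+1)|) P := by
        have := (hI (2*q+1) 0).abs
        simpa using this
      calc (2*((q:ℝ)+1)) * ∫ ω, Z ω * (S1 ω ^ (2*q+1) * S2 ω ^ 1) ∂P
          ≤ (2*((q:ℝ)+1)) * (A * s * ∫ ω, |Z ω * S1 ω ^ (2*q+1)| ∂P) := by gcongr
        _ = ∫ ω, (2*((q:ℝ)+1)) * (A * s) * |Z ω * S1 ω ^ (2*q+1)| ∂P := by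
            rw [integral_const_mul]; ring
        _ ≤ ∫ ω, (η * (Z ω * (S1 ω ^ (2*(q+1)) * S2 ω ^ 0))
              + ((q+1)*A)^2/η * R * (Z ω * (S1 ω ^ (2*q) * S2 ω ^ 0))) ∂P := by
            apply integral_mono (habs.const_mul _) (((hI _ _).const_mul _).add ((hI _ _).const_mul _))
            intro ω
            simp only [pow_zero, mul_one, Pi.add_apply]
            rw [abs_mul, abs_of_nonneg (h0 ω), abs_pow]
            set x := |S1 ω|
            have hx : 0 ≤ x := abs_nonneg _
            have e1 : S1 ω ^ (2*(q+1)) = x^(2*q) * x^2 := by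
              rw [← Even.pow_abs ⟨q+1, by ring⟩]; ring
            have e2 : S1 ω ^ (2*q) = x^(2*q) := by
              rw [← Even.pow_abs ⟨q, by ring⟩]
            rw [e1, e2]
            have young : 2*((q:ℝ)+1) * (A*s) * x ≤ η * x^2 + ((q+1)*A)^2/η * R := by
              have y1 : ((q+1)*A)^2/η * s^2 ≤ ((q+1)*A)^2/η * R := by gcongr
              have y2 : 2*((q:ℝ)+1) * (A*s) * x ≤ η * x^2 + ((q+1)*A)^2/η * s^2 := by
                have := sq_nonneg (η * x - (q+1)*A*s)
                have e : η * x^2 + ((q+1)*A)^2/η * s^2 - 2*((q:ℝ)+1) * (A*s) * x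
                  = (η * x - (q+1)*A*s)^2/η := by field_simp; ring
                have : 0 ≤ (η * x - (q+1)*A*s)^2/η := by positivity
                linarith
              linarith
            have hw : 0 ≤ Z ω * x^(2*q) := mul_nonneg (h0 ω) (by positivity)
            calc _ = (2*((q:ℝ)+1) * (A*s) * x) * (Z ω * x^(2*q)) := by ring
              _ ≤ (η * x^2 + ((q+1)*A)^2/η * R) * (Z ω * x^(2*q)) := by gcongr
              _ = _ := by ring
        _ = η * ∫ ω, (Z ω * (S1 ω ^ (2*(q+1)) * S2 ω ^ 0)) ∂P
              + ((q+1)*A)^2/η * R * ∫ ω, (Z ω * (S1 ω ^ (2*q) * S2 ω ^ 0)) ∂P := by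
            rw [integral_add ((hI _ _).const_mul _) ((hI _ _).const_mul _), integral_const_mul,
              integral_const_mul]
        _ ≤ η * (D' * R^(q+1) * z) + ((q+1)*A)^2/η * R * (D * R^q * z) := by gcongr
        _ = _ := by ring
    calc ∫ ω, Z ω * (∑ k ∈ Finset.Ico i l, Y k ω)^(2*(q+1)) ∂P
        ≤ ∫ ω, (Z ω * (S1 ω ^ (2*(q+1)) * S2 ω ^ 0) + (1+η) * (Z ω * (S1 ω ^ 0 * S2 ω ^ (2*(q+1))))
          + (2*(q+1)) * (Z ω * (S1 ω ^ (2*q+1) * S2 ω ^ 1))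
          + (C * (Z ω * (S1 ω ^ (2*q) * S2 ω ^ 2)) + C * (Z ω * (S1 ω ^ 2 * S2 ω ^ (2*q))))) ∂P := by
          apply integral_mono
          · have hSm : Measurable (fun ω => ∑ k ∈ Finset.Ico i l, Y k ω) :=
              (h.sum_meas hl).mono (h.le l) le_rfl
            exact int_of_bdd P (MZ.mul (hSm.pow_const _)) (bdd_mul hb (bdd_pow (h.sum_bdd i l) _))
          · exact (((hI _ _).add ((hI _ _).const_mul _)).add ((hI _ _).const_mul _)).add
              (((hI _ _).const_mul _).add ((hI _ _).const_mul _))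
          · intro ω
            have := mul_le_mul_of_nonneg_left (hineq (S1 ω) (S2 ω)) (h0 ω)
            simp only [hsum]
            refine this.trans (le_of_eq ?_)
            ring
      _ = (∫ ω, Z ω * (S1 ω ^ (2*(q+1)) * S2 ω ^ 0) ∂P)
          + (1+η) * (∫ ω, Z ω * (S1 ω ^ 0 * S2 ω ^ (2*(q+1))) ∂P)
          + (2*(q+1)) * (∫ ω, Z ω * (S1 ω ^ (2*q+1) * S2 ω ^ 1) ∂P)
          + (C * (∫ ω, Z ω * (S1 ω ^ (2*q) * S2 ω ^ 2) ∂P)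
            + C * (∫ ω, Z ω * (S1 ω ^ 2 * S2 ω ^ (2*q)) ∂P)) := by
          rw [integral_add, integral_add, integral_add, integral_add, integral_const_mul, integral_const_mul,
            integral_const_mul, integral_const_mul]
          · exact (hI _ _).const_mul _
          · exact (hI _ _).const_mul _
          · exact hI _ _
          · exact (hI _ _).const_mul _
          · exact ((hI _ _).add ((hI _ _).const_mul _))
          · exact (hI _ _).const_mul _
          · exact (((hI _ _).add ((hI _ _).const_mul _)).add ((hI _ _).const_mul _))
          · exact (((hI _ _).const_mul _).add ((hI _ _).const_mul _))
      _ ≤ (D' * R^(q+1) * z) + (1+η) * (D' * R^(q+1) * z)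
          + (η * (D' * R^(q+1) * z) + ((q+1)*A)^2/η * (D * R^(q+1) * z))
          + (C * (D1 * D * R^(q+1) * z) + C * (D1 * D * R^(q+1) * z)) := by
          have := mul_le_mul_of_nonneg_left t2 (show 0 ≤ 1+η by linarith)
          linarith
      _ = ((2+2*η) * D' + K) * (R^(q+1) * z) := by rw [hK]; ring
      _ ≤ (ρ * D') * (R^(q+1) * z) := by gcongr
      _ = ρ * (D' * R^(q+1) * z) := by ring
      _ ≤ ρ^(q+1) * (D' * R^(q+1) * z) := by
          have : ρ ≤ ρ^(q+1) := le_self_pow₀ (by linarith) (by omega)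
          have hD0 : 0 ≤ D' := by linarith
          gcongr
      _ = D' * (ρ^(L+1))^(q+1) * z := by rw [hR, pow_succ ρ L, mul_pow]; ring

theorem mbound_exists (ρ A : ℝ) (hρ : 2 < ρ) (hA : 0 ≤ A) (q : ℕ) : ∃ D, 0 < D ∧ MBound ρ A q D := by
  obtain ⟨η, hη, hηρ⟩ : ∃ η : ℝ, 0 < η ∧ 2 + 2*η < ρ := ⟨(ρ-2)/4, by linarith, by linarith⟩
  have h1 : ∃ D, 0 < D ∧ MBound ρ A 1 D := by
    refine mbound_step ρ A η 0 1 1 0 hρ hA hη hηρ le_rfl one_pos one_pos ?_ (mbound_zero ρ A)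
      (fun h => absurd h (lt_irrefl _))
    intro a b
    norm_num
    nlinarith [sq_nonneg b]
  obtain ⟨D1, hD1, h1⟩ := h1
  induction q with
  | zero => exact ⟨1, one_pos, mbound_zero ρ A⟩
  | succ q ih =>
    obtain ⟨D, hD, hq⟩ := ih
    rcases Nat.eq_zero_or_pos q with rfl | hq0
    · exact ⟨D1, hD1, h1⟩
    · obtain ⟨r, rfl⟩ := Nat.exists_eq_add_of_le hq0
      obtain ⟨C, hC, hineq⟩ := pow_ineq r η hη
      refine mbound_step ρ A η C D D1 _ hρ hA hη hηρ hC.le hD hD1 ?_ hq (fun _ => h1)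
      intro a b
      have := hineq a b
      have e1 : 2*(1+r+1) = 2*r+4 := by ring
      have e2 : 2*(1+r)+1 = 2*r+3 := by ring
      have e3 : 2*(1+r) = 2*r+2 := by ring
      rw [e1, e2, e3]
      push_cast
      linarith
end EM

namespace EM

/-! ### Part 2: Gaussian kernels -/

/-- Unnormalized heat kernel profile. -/
noncomputable def HK (a s q : ℝ) : ℝ := s ^ (-a) * Real.exp (-q / (2*s))

theorem HK_nonneg (a s q : ℝ) (hs : 0 < s) : 0 ≤ HK a s q := by unfold HK; positivity

theorem x_exp (x : ℝ) : x * Real.exp (-x) ≤ 1 := by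
  have h := Real.add_one_le_exp x
  rw [Real.exp_neg, ← div_eq_mul_inv, div_le_one (Real.exp_pos _)]
  linarith

theorem HK_diff (a : ℝ) (ha : 0 ≤ a) (τ v q : ℝ) (hτ : 0 < τ) (hv : 0 ≤ v) (hvτ : v ≤ τ) (hq : 0 ≤ q) :
    |HK a (τ+v) q - HK a τ q| ≤ (a+2) * v * τ^(-a-1) * Real.exp (-q/(8*τ)) := by
  have hder : ∀ t ∈ Icc τ (τ+v), HasDerivWithinAt (fun t => HK a t q)
      (-a * t^(-a-1) * Real.exp (-q/(2*t)) + t^(-a) * (Real.exp (-q/(2*t)) * (q/(2*t^2)))) (Icc τ (τ+v)) t := by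
    intro t ht
    have ht0 : 0 < t := lt_of_lt_of_le hτ ht.1
    have h1 : HasDerivAt (fun t : ℝ => t^(-a)) (-a * t^(-a-1)) t := by
      simpa using Real.hasDerivAt_rpow_const (x := t) (p := -a) (Or.inl ht0.ne')
    have h2 : HasDerivAt (fun t : ℝ => -q/(2*t)) (q/(2*t^2)) t := by
      have := ((hasDerivAt_id t).const_mul 2).fun_inv (by simpa using ht0.ne')
      have := this.const_mul (-q)
      simp only [id] at this
      convert! this using 1
      field_simp
    exact (h1.mul h2.exp).hasDerivWithinAt
  have hb : ∀ t ∈ Icc τ (τ+v), ‖-a * t^(-a-1) * Real.exp (-q/(2*t)) + t^(-a) * (Real.exp (-q/(2*t)) * (q/(2*t^2)))‖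
      ≤ (a+2) * τ^(-a-1) * Real.exp (-q/(8*τ)) := by
    intro t ht
    have ht0 : 0 < t := lt_of_lt_of_le hτ ht.1
    set x := q/(2*t) with hx
    have hx0 : 0 ≤ x := by positivity
    have e1 : -q/(2*t) = -x := by rw [hx]; ring
    have e2 : t^(-a) * (Real.exp (-q/(2*t)) * (q/(2*t^2))) = t^(-a-1) * (x * Real.exp (-x)) := by
      rw [e1, Real.rpow_sub_one ht0.ne', hx]; field_simp
    rw [e2, e1, show -a * t^(-a-1) * Real.exp (-x) + t^(-a-1) * (x * Real.exp (-x))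
      = t^(-a-1) * ((x - a) * Real.exp (-x)) by ring, norm_mul, Real.norm_eq_abs, Real.norm_eq_abs,
      abs_of_pos (Real.rpow_pos_of_pos ht0 _)]
    have h1 : t^(-a-1) ≤ τ^(-a-1) :=
      Real.rpow_le_rpow_of_nonpos hτ ht.1 (by linarith)
    have h2 : |(x - a) * Real.exp (-x)| ≤ (a+2) * Real.exp (-x/2) := by
      rw [abs_mul, abs_of_pos (Real.exp_pos _)]
      have h3 : |x - a| ≤ x + a := by rw [abs_le]; constructor <;> linarith
      have h4 : Real.exp (-x) = Real.exp (-x/2) * Real.exp (-(x/2)) := by rw [← Real.exp_add]; congr 1; ring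
      have h5 := x_exp (x/2)
      have h6 : Real.exp (-(x/2)) ≤ 1 := Real.exp_le_one_iff.2 (by linarith)
      have h7 := Real.exp_pos (-x/2)
      have h8 := Real.exp_pos (-(x/2))
      calc |x-a| * Real.exp (-x) ≤ (x+a) * Real.exp (-x) := by gcongr
        _ = ((x+a) * Real.exp (-(x/2))) * Real.exp (-x/2) := by rw [h4]; ring
        _ ≤ (a+2) * Real.exp (-x/2) := by
          gcongr
          nlinarith
    have h3 : Real.exp (-x/2) ≤ Real.exp (-q/(8*τ)) := by
      apply Real.exp_le_exp.2
      have : t ≤ 2*τ := by linarith [ht.2]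
      rw [hx, neg_div, neg_div, neg_le_neg_iff, div_div]
      apply div_le_div_of_nonneg_left hq (by positivity); linarith
    calc _ ≤ τ^(-a-1) * ((a+2) * Real.exp (-q/(8*τ))) := by
          gcongr
          exact h2.trans (by gcongr)
      _ = _ := by ring
  have := (convex_Icc τ (τ+v)).norm_image_sub_le_of_norm_hasDerivWithin_le hder hb
    (left_mem_Icc.2 (by linarith)) (right_mem_Icc.2 (by linarith))
  rw [Real.norm_eq_abs, Real.norm_eq_abs, add_sub_cancel_left, abs_of_nonneg hv] at this
  calc _ ≤ _ := this
    _ = _ := by ring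

abbrev Eu (d : ℕ) := EuclideanSpace ℝ (Fin d)

theorem HK_fderiv {d : ℕ} (a s : ℝ) (hs : 0 < s) (u : Eu d) :
    HasFDerivAt (fun u : Eu d => HK a s (‖u‖^2)) (-(HK (a+1) s (‖u‖^2)) • innerSL ℝ u) u := by
  have h1 : HasFDerivAt (fun u : Eu d => ‖u‖^2) (2 • innerSL ℝ u) u := (hasStrictFDerivAt_norm_sq u).hasFDerivAt
  have h2 : HasDerivAt (fun q : ℝ => HK a s q) (-(1/2) * HK (a+1) s (‖u‖^2)) (‖u‖^2) := by
    unfold HK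
    have := (((hasDerivAt_id (‖u‖^2)).neg.div_const (2*s)).exp).const_mul (s^(-a))
    convert! this using 1
    rw [show -(a+1) = -a - 1 by ring, Real.rpow_sub_one hs.ne']
    simp only [id, Pi.neg_apply]
    field_simp
  have := h2.comp_hasFDerivAt u h1
  convert! this using 1
  ext x
  simp
  ring

/-- difference of heat profiles -/
noncomputable def dl (d : ℕ) (a τ v : ℝ) (u : Eu d) : ℝ := HK a (τ+v) (‖u‖^2) - HK a τ (‖u‖^2)

theorem dl_fderiv {d : ℕ} (a τ v : ℝ) (hτ : 0 < τ) (hv : 0 ≤ v) (u : Eu d) :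
    HasFDerivAt (dl d a τ v) (-(dl d (a+1) τ v u) • innerSL ℝ u) u := by
  have := (HK_fderiv a (τ+v) (by linarith) u).sub (HK_fderiv a τ hτ u)
  convert! this using 1
  unfold dl
  rw [← sub_smul]; congr 1; ring

theorem dl_bound {d : ℕ} (a τ v : ℝ) (ha : 0 ≤ a) (hτ : 0 < τ) (hv : 0 ≤ v) (hvτ : v ≤ τ) (u : Eu d) :
    |dl d a τ v u| ≤ (a+2) * v * τ^(-a-1) * Real.exp (-‖u‖^2/(8*τ)) :=
  HK_diff a ha τ v _ hτ hv hvτ (by positivity)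

theorem dlW_bound {d : ℕ} (a τ v : ℝ) (ha : 0 ≤ a) (hτ : 0 < τ) (hv : 0 ≤ v) (hvτ : v ≤ τ) (u : Eu d) :
    ∃ W' : Eu d →L[ℝ] Eu d, HasFDerivAt (fun u => dl d (a+1) τ v u • u) W' u ∧
      ‖W'‖ ≤ 20*(a+4) * v * τ^(-a-2) * Real.exp (-‖u‖^2/(16*τ)) := by
  refine ⟨_, (dl_fderiv (a+1) τ v hτ hv u).smul (hasFDerivAt_id u), ?_⟩
  have h1 := dl_bound (a+1) τ v (by linarith) hτ hv hvτ u
  have h2 := dl_bound (a+1+1) τ v (by linarith) hτ hv hvτ u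
  set e := Real.exp (-‖u‖^2/(16*τ)) with he
  have hee : Real.exp (-‖u‖^2/(8*τ)) = e * e := by
    rw [he, ← Real.exp_add]; congr 1; field_simp; ring
  have he1 : e ≤ 1 := by
    rw [he]; apply Real.exp_le_one_iff.2
    rw [neg_div]; have : 0 ≤ ‖u‖^2/(16*τ) := by positivity
    linarith
  have he0 : 0 < e := Real.exp_pos _
  have hx : ‖u‖^2 * e ≤ 16 * τ := by
    have := x_exp (‖u‖^2/(16*τ))
    rw [← neg_div, ← he, div_mul_eq_mul_div, div_le_one (by positivity)] at this
    exact this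
  rw [hee] at h1 h2
  have r1 : τ^(-(a+1)-1) = τ^(-a-2) := by congr 1; ring
  have r2 : τ^(-(a+1+1)-1) = τ^(-a-2) * τ⁻¹ := by
    rw [← Real.rpow_neg_one τ, ← Real.rpow_add hτ]; congr 1; ring
  rw [r1] at h1
  rw [r2] at h2
  set T := τ^(-a-2) with hT
  have hT0 : 0 < T := Real.rpow_pos_of_pos hτ _
  refine (norm_add_le _ _).trans ?_
  have b1 : ‖dl d (a+1) τ v u • ContinuousLinearMap.id ℝ (Eu d)‖ ≤ (a+1+2) * v * T * (e*e) := by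
    rw [norm_smul, Real.norm_eq_abs]
    calc _ ≤ |dl d (a+1) τ v u| * 1 := by
          gcongr; exact ContinuousLinearMap.norm_id_le
      _ ≤ _ := by rw [mul_one]; exact h1
  have b2 : ‖(-(dl d (a+1+1) τ v u) • innerSL ℝ u).smulRight (id u)‖ ≤ ((a+1+1+2) * v * (T*τ⁻¹) * (e*e)) * ‖u‖^2 := by
    rw [ContinuousLinearMap.norm_smulRight_apply, norm_smul, norm_neg, Real.norm_eq_abs, innerSL_apply_norm, mul_assoc]
    simp only [id]
    rw [← sq]
    gcongr
  have b3 : ((a+1+1+2) * v * (T*τ⁻¹) * (e*e)) * ‖u‖^2 ≤ 16*(a+4) * v * T * e := by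
    calc _ = (a+4) * v * (T*τ⁻¹) * e * (‖u‖^2 * e) := by ring
      _ ≤ (a+4) * v * (T*τ⁻¹) * e * (16*τ) := by gcongr
      _ = _ := by field_simp
  have b4 : (a+1+2) * v * T * (e*e) ≤ 4*(a+4)*v*T*e := by
    calc _ = (a+3) * (v * T * e) * e := by ring
      _ ≤ (4*(a+4)) * (v*T*e) * 1 := by gcongr; linarith
      _ = _ := by ring
  calc _ ≤ 4*(a+4)*v*T*e + 16*(a+4) * v * T * e := add_le_add (b1.trans b4) (b2.trans b3)
    _ = _ := by ring

theorem exp_shift {d : ℕ} (κ τ Z : ℝ) (hκ : 0 < κ) (hκ1 : κ ≤ 1/16) (hτ : 0 < τ) (w u : Eu d)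
    (hu : ‖u - w‖ ≤ Z) : Real.exp (-‖u‖^2/(16*τ)) ≤ Real.exp (-(κ/2*‖w‖^2/τ) + κ*Z^2/τ) := by
  apply Real.exp_le_exp.2
  have h1 : ‖w‖ ≤ ‖u‖ + Z := by
    calc ‖w‖ = ‖u - (u - w)‖ := by congr 1; abel
      _ ≤ ‖u‖ + ‖u-w‖ := norm_sub_le _ _
      _ ≤ _ := by linarith
  have hZ : 0 ≤ Z := (norm_nonneg _).trans hu
  have h2 : ‖w‖^2 ≤ 2*‖u‖^2 + 2*Z^2 := by
    have : ‖w‖^2 ≤ (‖u‖+Z)^2 := pow_le_pow_left₀ (norm_nonneg _) h1 2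
    nlinarith [sq_nonneg (‖u‖ - Z)]
  have : -(κ/2*‖w‖^2/τ) + κ*Z^2/τ - (-‖u‖^2/(16*τ)) = (‖u‖^2/16 + κ*Z^2 - κ/2*‖w‖^2)/τ := by
    field_simp; ring
  have h3 : 0 ≤ (‖u‖^2/16 + κ*Z^2 - κ/2*‖w‖^2)/τ := by
    apply div_nonneg _ hτ.le
    nlinarith [sq_nonneg ‖u‖]
  linarith

theorem second_diff {d : ℕ} (a κ τ v Z : ℝ) (ha : 0 ≤ a) (hκ : 0 < κ) (hκ1 : κ ≤ 1/16)
    (hτ : 0 < τ) (hv : 0 ≤ v) (hvτ : v ≤ τ) (w y1 y2 : Eu d) (h1 : ‖y1‖ ≤ Z) (h2 : ‖y2‖ ≤ Z) :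
    |(dl d a τ v (w+y1) + dl d a τ v (w-y1)) - (dl d a τ v (w+y2) + dl d a τ v (w-y2))|
      ≤ 40*(a+4) * v * τ^(-a-2) * Real.exp (-(κ/2*‖w‖^2/τ) + κ*Z^2/τ) * Z * ‖y1 - y2‖ := by
  set B := 20*(a+4) * v * τ^(-a-2) * Real.exp (-(κ/2*‖w‖^2/τ) + κ*Z^2/τ) with hB
  have hB0 : 0 ≤ B := by positivity
  have hZ : 0 ≤ Z := (norm_nonneg _).trans h1
  choose W' hW' hWb using fun u => dlW_bound (d := d) a τ v ha hτ hv hvτ u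
  have lip : ∀ u1 ∈ Metric.closedBall w Z, ∀ u2 ∈ Metric.closedBall w Z,
      ‖dl d (a+1) τ v u1 • u1 - dl d (a+1) τ v u2 • u2‖ ≤ B * ‖u1 - u2‖ := by
    intro u1 hu1 u2 hu2
    refine (convex_closedBall w Z).norm_image_sub_le_of_norm_hasFDerivWithin_le
      (f := fun u => dl d (a+1) τ v u • u) (f' := W')
      (fun x _ => (hW' x).hasFDerivWithinAt) ?_ hu2 hu1
    intro x hx
    refine (hWb x).trans ?_
    rw [hB]
    refine mul_le_mul_of_nonneg_left ?_ (by positivity)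
    exact exp_shift κ τ Z hκ hκ1 hτ w x (by simpa [dist_eq_norm] using hx)
  have hk : ∀ y, HasFDerivAt (fun y => dl d a τ v (w+y) + dl d a τ v (w-y))
      ((-(dl d (a+1) τ v (w+y)) • innerSL ℝ (w+y)) + -(-(dl d (a+1) τ v (w-y)) • innerSL ℝ (w-y))) y := by
    intro y
    have p1 : HasFDerivAt (fun y => dl d a τ v (w+y)) (-(dl d (a+1) τ v (w+y)) • innerSL ℝ (w+y)) y := by
      have := (dl_fderiv a τ v hτ hv (w+y)).comp y ((hasFDerivAt_id y).const_add w)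
      convert! this using 1
    have p2 : HasFDerivAt (fun y => dl d a τ v (w-y)) (-(-(dl d (a+1) τ v (w-y)) • innerSL ℝ (w-y))) y := by
      have := (dl_fderiv a τ v hτ hv (w-y)).comp y ((hasFDerivAt_id y).const_sub w)
      convert! this using 1
      ext x; simp
    exact p1.add p2
  have := (convex_closedBall (0 : Eu d) Z).norm_image_sub_le_of_norm_hasFDerivWithin_le
    (f := fun y => dl d a τ v (w+y) + dl d a τ v (w-y)) (C := 2*B*Z)
      (fun x _ => (hk x).hasFDerivWithinAt) ?_ (x := y2) (y := y1) (by simpa using h2) (by simpa using h1)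
  · rw [Real.norm_eq_abs] at this
    refine this.trans (le_of_eq ?_)
    rw [hB]; ring
  · intro y hy
    have hy' : ‖y‖ ≤ Z := by simpa using hy
    have e : ((-(dl d (a+1) τ v (w+y)) • innerSL ℝ (w+y)) + -(-(dl d (a+1) τ v (w-y)) • innerSL ℝ (w-y)))
      = innerSL ℝ (dl d (a+1) τ v (w-y) • (w-y) - dl d (a+1) τ v (w+y) • (w+y)) := by
      ext x
      simp [inner_sub_left, inner_smul_left, inner_add_left]
      ring
    rw [e, innerSL_apply_norm]
    refine (lip (w-y) (by simpa [dist_eq_norm] using hy') (w+y) (by simpa [dist_eq_norm] using hy')).trans ?_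
    have : ‖w - y - (w + y)‖ ≤ 2*Z := by
      have : w - y - (w+y) = (-2:ℝ) • y := by rw [neg_smul, two_smul]; abel
      rw [this, norm_smul]; norm_num; exact hy'
    calc _ ≤ B * (2*Z) := by gcongr
      _ = _ := by ring
end EM

namespace EM

/-! ### Part 3: Gaussian densities -/

noncomputable def hf (d : ℕ) : ℝ := (d : ℝ) / 2

theorem hf_nonneg (d : ℕ) : 0 ≤ hf d := by unfold hf; positivity

theorem gauss_integral (d : ℕ) (b : ℝ) (hb : 0 < b) :
    ∫ u : Eu d, Real.exp (-b * ‖u‖^2) = (Real.pi / b) ^ (hf d) := by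
  rw [GaussianFourier.integral_rexp_neg_mul_sq_norm hb]; simp [hf]

theorem gauss_integrable (d : ℕ) (b : ℝ) (hb : 0 < b) :
    Integrable (fun u : Eu d => Real.exp (-b * ‖u‖^2)) := by
  have := GaussianFourier.integrable_cexp_neg_mul_sq_norm_add (V := Eu d) (b := (b:ℂ)) (by simpa using hb) 0 0
  have h2 := this.re
  refine h2.congr (ae_of_all _ fun u => ?_)
  simp only [zero_mul, add_zero]
  have : (-(b:ℂ) * (‖u‖:ℂ)^2) = ((-b * ‖u‖^2 : ℝ) : ℂ) := by push_cast; ring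
  rw [this, ← Complex.ofReal_exp]
  exact Complex.ofReal_re _

noncomputable def cd (d : ℕ) : ℝ := (2*Real.pi) ^ (-(hf d))

theorem cd_pos (d : ℕ) : 0 < cd d := by unfold cd; positivity

/-- Gaussian density with covariance `s` times the identity. -/
noncomputable def phi (d : ℕ) (s : ℝ) (u : Eu d) : ℝ := cd d * HK (hf d) s (‖u‖^2)

theorem phi_eq (d : ℕ) (s : ℝ) (u : Eu d) :
    phi d s u = (cd d * s^(-(hf d))) * Real.exp (-(1/(2*s)) * ‖u‖^2) := by
  unfold phi HK
  rw [mul_assoc]; congr 3; ring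

theorem phi_nonneg (d : ℕ) (s : ℝ) (hs : 0 < s) (u : Eu d) : 0 ≤ phi d s u :=
  mul_nonneg (cd_pos d).le (HK_nonneg _ _ _ hs)

theorem phi_cont (d : ℕ) (s : ℝ) : Continuous (phi d s) := by
  have : phi d s = fun u => (cd d * s^(-(hf d))) * Real.exp (-(1/(2*s)) * ‖u‖^2) := by
    ext u; exact phi_eq d s u
  rw [this]; fun_prop

theorem phi_neg (d : ℕ) (s : ℝ) (u : Eu d) : phi d s (-u) = phi d s u := by simp [phi]

theorem phi_integrable (d : ℕ) (s : ℝ) (hs : 0 < s) : Integrable (phi d s) := by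
  have : phi d s = fun u => (cd d * s^(-(hf d))) * Real.exp (-(1/(2*s)) * ‖u‖^2) := by
    ext u; exact phi_eq d s u
  rw [this]
  exact (gauss_integrable d _ (by positivity)).const_mul _

theorem phi_integral (d : ℕ) (s : ℝ) (hs : 0 < s) : ∫ u, phi d s u = 1 := by
  simp_rw [phi_eq]
  rw [integral_const_mul, gauss_integral d _ (by positivity)]
  unfold cd
  rw [show Real.pi / (1/(2*s)) = (2*Real.pi)*s by field_simp, Real.mul_rpow (by positivity) hs.le,
    Real.rpow_neg (by positivity), Real.rpow_neg hs.le]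
  have h1 : (2*Real.pi)^(hf d) ≠ 0 := by positivity
  have h2 : s^(hf d) ≠ 0 := by positivity
  field_simp

theorem phi_mul_phi (d : ℕ) (h τ : ℝ) (hh : 0 < h) (hτ : 0 < τ) (w y : Eu d) :
    phi d h y * phi d τ (w - y) = phi d (τ+h) w * phi d (h*τ/(τ+h)) (y - (h/(τ+h)) • w) := by
  simp only [phi_eq]
  have hth : 0 < τ + h := by linarith
  have e1 : h^(-(hf d)) * τ^(-(hf d)) = (τ+h)^(-(hf d)) * (h*τ/(τ+h))^(-(hf d)) := by
    rw [← Real.mul_rpow hh.le hτ.le, ← Real.mul_rpow hth.le (by positivity)]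
    congr 1; field_simp
  have e2 : Real.exp (-(1/(2*h)) * ‖y‖^2) * Real.exp (-(1/(2*τ)) * ‖w-y‖^2)
      = Real.exp (-(1/(2*(τ+h))) * ‖w‖^2) * Real.exp (-(1/(2*(h*τ/(τ+h)))) * ‖y - (h/(τ+h)) • w‖^2) := by
    rw [← Real.exp_add, ← Real.exp_add]
    congr 1
    rw [norm_sub_sq_real, norm_sub_sq_real, norm_smul, real_inner_smul_right, real_inner_comm]
    rw [mul_pow, Real.norm_eq_abs, sq_abs]
    field_simp
    ring
  calc _ = cd d * cd d * (h^(-(hf d)) * τ^(-(hf d))) * (Real.exp (-(1/(2*h)) * ‖y‖^2) * Real.exp (-(1/(2*τ)) * ‖w-y‖^2)) := by ring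
    _ = _ := by rw [e1, e2]; ring

theorem phi_conv (d : ℕ) (h τ : ℝ) (hh : 0 < h) (hτ : 0 < τ) (w : Eu d) :
    ∫ y, phi d h y * phi d τ (w - y) = phi d (τ+h) w := by
  simp_rw [phi_mul_phi d h τ hh hτ w]
  rw [integral_const_mul, integral_sub_right_eq_self (fun y => phi d (h*τ/(τ+h)) y),
    phi_integral d _ (by positivity), mul_one]

theorem phi_mul_integrable (d : ℕ) (s : ℝ) (hs : 0 < s) (g : Eu d → ℝ) (hg : Measurable g) (K : ℝ)
    (hK : ∀ y, |g y| ≤ K) : Integrable (fun y => phi d s y * g y) :=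
  (phi_integrable d s hs).mul_bdd hg.aestronglyMeasurable (ae_of_all _ hK)

theorem phi_mul_abs (d : ℕ) (s : ℝ) (hs : 0 < s) (g : Eu d → ℝ) (K : ℝ)
    (hK : ∀ y, |g y| ≤ K) : |∫ y, phi d s y * g y| ≤ K := by
  have := norm_integral_le_of_norm_le (f := fun y => phi d s y * g y) ((phi_integrable d s hs).mul_const K)
    (ae_of_all _ fun y => by
      rw [norm_mul, Real.norm_eq_abs, abs_of_nonneg (phi_nonneg d s hs y), Real.norm_eq_abs]
      exact mul_le_mul_of_nonneg_left (hK y) (phi_nonneg d s hs y))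
  rwa [integral_mul_const, phi_integral d s hs, one_mul, Real.norm_eq_abs] at this

theorem phi_dl (d : ℕ) (τ v : ℝ) (u : Eu d) : phi d (τ+v) u - phi d τ u = cd d * dl d (hf d) τ v u := by
  unfold phi dl; ring

theorem dl_cont (d : ℕ) (a τ v : ℝ) : Continuous (dl d a τ v) := by unfold dl HK; fun_prop

theorem dl_conv (d : ℕ) (h τ v : ℝ) (hh : 0 < h) (hτ : 0 < τ) (hv : 0 ≤ v) (w : Eu d) :
    ∫ y, phi d h y * dl d (hf d) τ v (w - y) = dl d (hf d) (τ+h) v w := by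
  have hc := (cd_pos d).ne'
  have key : ∀ y, phi d h y * dl d (hf d) τ v (w - y)
      = (cd d)⁻¹ * (phi d h y * phi d (τ+v) (w-y) - phi d h y * phi d τ (w-y)) := by
    intro y
    rw [← mul_sub, phi_dl]; field_simp
  have hi : ∀ t : ℝ, 0 < t → Integrable (fun y => phi d h y * phi d t (w-y)) := by
    intro t ht
    simp_rw [phi_mul_phi d h t hh ht w]
    exact ((phi_integrable d (h*t/(t+h)) (by positivity)).comp_sub_right ((h/(t+h)) • w)).const_mul _
  simp_rw [key]
  rw [integral_const_mul, integral_sub (hi _ (by linarith)) (hi _ hτ), phi_conv d h _ hh (by linarith),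
    phi_conv d h _ hh hτ, show τ + v + h = (τ+h)+v by ring, phi_dl]
  field_simp

/-- constant of the kernel estimate -/
noncomputable def CK1 (d : ℕ) (Λ : ℝ) : ℝ := 20*(hf d+4)*Λ*16*2^(hf d)

theorem K1_kernel (d : ℕ) (Λ h τ v : ℝ) (hΛ : 1 ≤ Λ) (hh : 0 < h) (hhτ : h ≤ τ) (hv : 0 ≤ v)
    (hvτ : v ≤ τ) (M : Eu d →L[ℝ] Eu d) (hM : ‖M‖ ≤ Λ) (w : Eu d) :
    |(∫ y, phi d h y * dl d (hf d) τ v (w - M y)) - dl d (hf d) (τ+h) v w|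
      ≤ CK1 d Λ * h * v * ‖M - 1‖ * τ^(-(hf d)-2) * Real.exp (-(1/(32*Λ^2)*‖w‖^2/τ)) := by
  have hτ : 0 < τ := by linarith
  set a := hf d with ha
  have ha0 : 0 ≤ a := hf_nonneg d
  rw [← dl_conv d h τ v hh hτ hv w]
  set K := (a+2) * v * τ^(-a-1) with hK
  have hdb : ∀ u : Eu d, |dl d a τ v u| ≤ K := by
    intro u
    refine (dl_bound a τ v ha0 hτ hv hvτ u).trans ?_
    have : Real.exp (-‖u‖^2/(8*τ)) ≤ 1 := by
      apply Real.exp_le_one_iff.2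
      rw [neg_div]; have : 0 ≤ ‖u‖^2/(8*τ) := by positivity
      linarith
    exact mul_le_of_le_one_right (by positivity) this
  have hdm : Measurable (dl d a τ v) := (dl_cont d a τ v).measurable
  have hI : ∀ g : Eu d → Eu d, Measurable g → Integrable (fun y => phi d h y * dl d a τ v (g y)) :=
    fun g hg => phi_mul_integrable d h hh _ (hdm.comp hg) K (fun y => hdb _)
  have sym : ∀ N : Eu d →L[ℝ] Eu d, (∫ y, phi d h y * dl d a τ v (w - N y))
      = (1/2) * ∫ y, phi d h y * (dl d a τ v (w + N y) + dl d a τ v (w - N y)) := by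
    intro N
    have h1 : (∫ y, phi d h y * dl d a τ v (w + N y)) = ∫ y, phi d h y * dl d a τ v (w - N y) := by
      rw [← integral_neg_eq_self]
      congr 1; ext y
      rw [phi_neg, map_neg, sub_eq_add_neg]
    simp_rw [mul_add]
    rw [integral_add (hI _ (by fun_prop)) (hI _ (by fun_prop)), h1]; ring
  have s2 := sym (ContinuousLinearMap.id ℝ (Eu d))
  simp only [ContinuousLinearMap.id_apply] at s2
  rw [sym M, s2, ← mul_sub]
  have hI2 : ∀ N : Eu d →L[ℝ] Eu d, Integrable (fun y => phi d h y * (dl d a τ v (w + N y) + dl d a τ v (w - N y))) := by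
    intro N
    simp_rw [mul_add]
    exact (hI _ (by fun_prop)).add (hI _ (by fun_prop))
  have hI3 := hI2 (ContinuousLinearMap.id ℝ (Eu d))
  simp only [ContinuousLinearMap.id_apply] at hI3
  rw [← integral_sub (hI2 M) hI3, abs_mul, abs_of_pos (by norm_num : (0:ℝ) < 1/2)]
  set D := 40*(a+4) * v * τ^(-a-2) * Real.exp (-(1/(32*Λ^2)*‖w‖^2/τ)) * Λ * ‖M - 1‖ with hD
  have hD0 : 0 ≤ D := by positivity
  have pt : ∀ y : Eu d, ‖phi d h y * (dl d a τ v (w + M y) + dl d a τ v (w - M y))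
      - phi d h y * (dl d a τ v (w + y) + dl d a τ v (w - y))‖
      ≤ D * (cd d * h^(-a) * (16*h)) * Real.exp (-(1/(4*h)) * ‖y‖^2) := by
    intro y
    rw [← mul_sub, norm_mul, Real.norm_eq_abs, Real.norm_eq_abs, abs_of_nonneg (phi_nonneg d h hh y)]
    have hMy : ‖M y‖ ≤ Λ*‖y‖ := (M.le_opNorm y).trans (by gcongr)
    have hyy : ‖y‖ ≤ Λ*‖y‖ := le_mul_of_one_le_left (norm_nonneg _) hΛ
    have hκ1 : 1/(16*Λ^2) ≤ 1/16 := by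
      apply one_div_le_one_div_of_le (by norm_num); nlinarith
    have sd := second_diff a (1/(16*Λ^2)) τ v (Λ*‖y‖) ha0 (by positivity) hκ1 hτ hv hvτ w (M y) y hMy hyy
    have hd : ‖M y - y‖ ≤ ‖M - 1‖ * ‖y‖ := by
      have := (M - 1).le_opNorm y
      simpa using this
    have e1 : Real.exp (-(1/(16*Λ^2)/2*‖w‖^2/τ) + 1/(16*Λ^2)*(Λ*‖y‖)^2/τ)
        = Real.exp (-(1/(32*Λ^2)*‖w‖^2/τ)) * Real.exp (‖y‖^2/(16*τ)) := by
      rw [← Real.exp_add]; congr 1; field_simp; ring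
    have e2 : Real.exp (‖y‖^2/(16*τ)) ≤ Real.exp (‖y‖^2/(16*h)) := by
      apply Real.exp_le_exp.2; gcongr
    set x := ‖y‖^2/(16*h) with hx
    have hy2 : ‖y‖^2 = 16*h*x := by rw [hx]; field_simp
    have hx0 : 0 ≤ x := by positivity
    have e3 : x ≤ Real.exp x := by linarith [Real.add_one_le_exp x]
    have e4 : phi d h y = cd d * h^(-a) * Real.exp (-8*x) := by
      rw [phi_eq]; congr 2; rw [hy2]; field_simp; ring
    have e5 : -(1/(4*h)) * ‖y‖^2 = -4*x := by rw [hy2]; field_simp; norm_num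
    rw [e1] at sd
    have hc := cd_pos d
    rw [e4, e5]
    calc _ ≤ cd d * h^(-a) * Real.exp (-8*x) * (40*(a+4) * v * τ^(-a-2) * (Real.exp (-(1/(32*Λ^2)*‖w‖^2/τ)) * Real.exp x)
          * (Λ*‖y‖) * (‖M-1‖*‖y‖)) := by
          gcongr
          refine sd.trans ?_
          gcongr
      _ = D * (cd d * h^(-a)) * (Real.exp (-8*x) * Real.exp x) * ‖y‖^2 := by rw [hD]; ring
      _ = D * (cd d * h^(-a)) * (Real.exp (-8*x) * Real.exp x) * (16*h*x) := by rw [hy2]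
      _ ≤ D * (cd d * h^(-a)) * (Real.exp (-8*x) * Real.exp x) * (16*h*Real.exp x) := by gcongr
      _ = D * (cd d * h^(-a) * (16*h)) * Real.exp (-6*x) := by
          have : Real.exp (-6*x) = Real.exp (-8*x) * Real.exp x * Real.exp x := by
            rw [← Real.exp_add, ← Real.exp_add]; congr 1; ring
          rw [this]; ring
      _ ≤ _ := by gcongr; linarith
  have := norm_integral_le_of_norm_le ((gauss_integrable d (1/(4*h)) (by positivity)).const_mul _) (ae_of_all _ pt)
  rw [integral_const_mul, gauss_integral d _ (by positivity), Real.norm_eq_abs] at this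
  calc _ ≤ 1/2 * _ := mul_le_mul_of_nonneg_left this (by norm_num)
    _ = _ := by
      rw [show Real.pi/(1/(4*h)) = (2*Real.pi)*(2*h) by field_simp; ring, Real.mul_rpow (by positivity) (by positivity),
        Real.mul_rpow (by norm_num) hh.le]
      have h1 : cd d * (2*Real.pi)^a = 1 := by
        unfold cd; rw [← ha, ← Real.rpow_add (by positivity)]; simp
      have h2 : h^(-a) * h^a = 1 := by rw [← Real.rpow_add hh]; simp
      calc _ = 1/2 * D * (cd d * (2*Real.pi)^a) * (h^(-a) * h^a) * (16*h) * 2^a := by ring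
        _ = _ := by rw [h1, h2, hD]; unfold CK1; rw [← ha]; ring

theorem pi_gauss (d : ℕ) (v : NNReal) (hv : v ≠ 0) :
    Measure.pi (fun _ : Fin d => gaussianReal 0 v)
      = (volume : Measure (Fin d → ℝ)).withDensity (fun x => ENNReal.ofReal (∏ i, gaussianPDFReal 0 v (x i))) := by
  apply Measure.pi_eq
  intro s hs
  rw [withDensity_apply _ (MeasurableSet.univ_pi hs), volume_pi, Measure.restrict_pi_pi,
    ← ofReal_integral_eq_lintegral_ofReal, integral_fintype_prod_eq_prod (fun _ x => gaussianPDFReal 0 v x),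
    ENNReal.ofReal_prod_of_nonneg]
  · refine Finset.prod_congr rfl fun i _ => ?_
    rw [gaussianReal_apply_eq_integral _ hv]
  · intro i _; exact integral_nonneg fun x => gaussianPDFReal_nonneg _ _ _
  · exact Integrable.fintype_prod (f := fun _ x => gaussianPDFReal 0 v x)
      (fun i => (integrable_gaussianPDFReal 0 v).restrict)
  · exact ae_of_all _ fun x => Finset.prod_nonneg fun i _ => gaussianPDFReal_nonneg _ _ _

theorem prod_pdf (d : ℕ) (s : ℝ) (hs : 0 < s) (x : Fin d → ℝ) :
    ∏ i, gaussianPDFReal 0 s.toNNReal (x i) = phi d s (WithLp.toLp 2 x) := by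
  rw [phi_eq, EuclideanSpace.norm_sq_eq]
  simp only [gaussianPDFReal, Finset.prod_mul_distrib, Finset.prod_const, Finset.card_univ, Fintype.card_fin]
  rw [← Real.exp_sum, Real.coe_toNNReal s hs.le]
  congr 1
  · unfold cd hf
    rw [← Real.mul_rpow (by positivity) hs.le, Real.rpow_neg (by positivity), inv_pow,
      Real.sqrt_eq_rpow, ← Real.rpow_natCast, ← Real.rpow_mul (by positivity)]
    congr 2; ring
  · rw [Finset.mul_sum]
    congr 1
    refine Finset.sum_congr rfl fun i _ => ?_
    simp
    ring

theorem gauss_law (d : ℕ) (s : ℝ) (hs : 0 < s) (ψ : Eu d → ℝ) :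
    ∫ x, ψ (WithLp.toLp 2 x) ∂(Measure.pi (fun _ : Fin d => gaussianReal 0 s.toNNReal))
      = ∫ y, phi d s y * ψ y := by
  have hv : s.toNNReal ≠ 0 := by simpa using hs
  rw [pi_gauss d _ hv]
  simp_rw [prod_pdf d s hs]
  rw [integral_withDensity_eq_integral_toReal_smul]
  · rw [← (PiLp.volume_preserving_toLp (Fin d)).integral_comp (MeasurableEquiv.toLp 2 (Fin d → ℝ)).measurableEmbedding]
    congr 1; ext x
    rw [ENNReal.toReal_ofReal (phi_nonneg d s hs _), smul_eq_mul]
  · exact ((phi_cont d s).measurable.comp (MeasurableEquiv.toLp 2 (Fin d → ℝ)).measurable).ennreal_ofReal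
  · exact ae_of_all _ fun x => ENNReal.ofReal_lt_top
end EM

namespace EM

/-! ### Part 4: change of variables and frozen kernels -/

/-- Gaussian majorant. -/
noncomputable def Gk (d : ℕ) (κ s : ℝ) (u : Eu d) : ℝ := s^(-(hf d)) * Real.exp (-(κ/s) * ‖u‖^2)

noncomputable def GI (d : ℕ) (κ : ℝ) : ℝ := (Real.pi/κ)^(hf d)

theorem GI_pos (d : ℕ) (κ : ℝ) (hκ : 0 < κ) : 0 < GI d κ := by unfold GI; positivity

theorem Gk_cont (d : ℕ) (κ s : ℝ) : Continuous (Gk d κ s) := by unfold Gk; fun_prop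

theorem Gk_nonneg (d : ℕ) (κ s : ℝ) (hs : 0 < s) (u : Eu d) : 0 ≤ Gk d κ s u := by unfold Gk; positivity

theorem Gk_integrable (d : ℕ) (κ s : ℝ) (hκ : 0 < κ) (hs : 0 < s) : Integrable (Gk d κ s) :=
  (gauss_integrable d (κ/s) (by positivity)).const_mul _

theorem Gk_integral (d : ℕ) (κ s : ℝ) (hκ : 0 < κ) (hs : 0 < s) : ∫ u, Gk d κ s u = GI d κ := by
  unfold Gk GI
  rw [integral_const_mul, gauss_integral d _ (by positivity),
    show Real.pi/(κ/s) = s*(Real.pi/κ) by field_simp, Real.mul_rpow hs.le (by positivity),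
    ← mul_assoc, ← Real.rpow_add hs]
  simp

theorem Gk_integrable_sub (d : ℕ) (κ s : ℝ) (hκ : 0 < κ) (hs : 0 < s) (x : Eu d) :
    Integrable (fun z => Gk d κ s (z - x)) := (Gk_integrable d κ s hκ hs).comp_sub_right x

theorem Gk_integral_sub (d : ℕ) (κ s : ℝ) (hκ : 0 < κ) (hs : 0 < s) (x : Eu d) :
    ∫ z, Gk d κ s (z - x) = GI d κ := by
  rw [integral_sub_right_eq_self (fun z => Gk d κ s z), Gk_integral d κ s hκ hs]

theorem Gk_anti (d : ℕ) (κ κ' s : ℝ) (hk : κ' ≤ κ) (hs : 0 < s) (u : Eu d) : Gk d κ s u ≤ Gk d κ' s u := by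
  unfold Gk
  refine mul_le_mul_of_nonneg_left (Real.exp_le_exp.2 ?_) (by positivity)
  have : κ'/s ≤ κ/s := by gcongr
  nlinarith [sq_nonneg ‖u‖]

theorem wGk (d : ℕ) (κ s : ℝ) (hκ : 0 < κ) (hs : 0 < s) (u : Eu d) :
    ‖u‖ * Gk d κ s u ≤ Real.sqrt s * (1+2/κ) * Gk d (κ/2) s u := by
  unfold Gk
  set t := ‖u‖/Real.sqrt s with ht
  have hq : 0 < Real.sqrt s := Real.sqrt_pos.2 hs
  have hu : ‖u‖ = Real.sqrt s * t := by rw [ht]; field_simp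
  have ht0 : 0 ≤ t := by positivity
  have ht2 : ‖u‖^2 = s * t^2 := by rw [hu, mul_pow, Real.sq_sqrt hs.le]
  have e1 : -(κ/s)*‖u‖^2 = -(κ/2*t^2) + -(κ/2*t^2) := by rw [ht2]; field_simp; ring
  have e2 : -(κ/2/s)*‖u‖^2 = -(κ/2*t^2) := by rw [ht2]; field_simp
  rw [e1, e2, Real.exp_add]
  have h1 := x_exp (κ/2*t^2)
  set e := Real.exp (-(κ/2*t^2)) with he
  have he0 : 0 < e := Real.exp_pos _
  have he1 : e ≤ 1 := Real.exp_le_one_iff.2 (by have : 0 ≤ κ/2*t^2 := by positivity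
                                                linarith)
  have h2 : t * e ≤ 1 + 2/κ := by
    have h3 : t^2*e ≤ 2/κ := by
      rw [le_div_iff₀ hκ]; nlinarith
    nlinarith [sq_nonneg (t-1)]
  calc _ = Real.sqrt s * (t*e) * (s^(-(hf d)) * e) := by rw [hu]; ring
    _ ≤ _ := by gcongr

theorem w2Gk (d : ℕ) (κ s : ℝ) (hκ : 0 < κ) (hs : 0 < s) (u : Eu d) :
    ‖u‖^2/s * Gk d κ s u ≤ 2/κ * Gk d (κ/2) s u := by
  unfold Gk
  set t := ‖u‖^2/s with ht
  have ht0 : 0 ≤ t := by positivity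
  have e1 : -(κ/s)*‖u‖^2 = -(κ/2*t) + -(κ/2*t) := by rw [ht]; field_simp; ring
  have e2 : -(κ/2/s)*‖u‖^2 = -(κ/2*t) := by rw [ht]; field_simp
  rw [e1, e2, Real.exp_add]
  have h1 := x_exp (κ/2*t)
  set e := Real.exp (-(κ/2*t)) with he
  have he0 : 0 < e := Real.exp_pos _
  have h3 : t*e ≤ 2/κ := by
      rw [le_div_iff₀ hκ]; nlinarith
  calc _ = (t*e) * (s^(-(hf d)) * e) := by ring
    _ ≤ _ := by gcongr

/-- A pair of mutually inverse operators with bounds. -/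
structure GA (d : ℕ) (l C : ℝ) (A Ai : Eu d →L[ℝ] Eu d) : Prop where
  hl : ∀ u, Ai (A u) = u
  hr : ∀ u, A (Ai u) = u
  bA : ‖A‖ ≤ C
  bi : ‖Ai‖ ≤ l
  l1 : 1 ≤ l
  C1 : 1 ≤ C

noncomputable def Jd {d : ℕ} (Ai : Eu d →L[ℝ] Eu d) : ℝ := |LinearMap.det (Ai : Eu d →ₗ[ℝ] Eu d)|

theorem Jd_nonneg {d : ℕ} (Ai : Eu d →L[ℝ] Eu d) : 0 ≤ Jd Ai := abs_nonneg _

theorem GA.lower {d : ℕ} {l C : ℝ} {A Ai : Eu d →L[ℝ] Eu d} (h : GA d l C A Ai) (u : Eu d) :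
    ‖u‖^2 ≤ C^2 * ‖Ai u‖^2 := by
  have h1 : ‖u‖ ≤ C * ‖Ai u‖ := by
    calc ‖u‖ = ‖A (Ai u)‖ := by rw [h.hr]
      _ ≤ ‖A‖ * ‖Ai u‖ := A.le_opNorm _
      _ ≤ _ := by gcongr; exact h.bA
  calc _ ≤ (C * ‖Ai u‖)^2 := pow_le_pow_left₀ (norm_nonneg _) h1 2
    _ = _ := by ring

theorem GA.lower_exp {d : ℕ} {l C : ℝ} {A Ai : Eu d →L[ℝ] Eu d} (h : GA d l C A Ai) (κ s : ℝ)
    (hκ : 0 < κ) (hs : 0 < s) (u : Eu d) :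
    Gk d κ s (Ai u) ≤ Gk d (κ/C^2) s u := by
  unfold Gk
  refine mul_le_mul_of_nonneg_left (Real.exp_le_exp.2 ?_) (by positivity)
  have hC : 0 < C := by linarith [h.C1]
  have h1 := h.lower u
  have h2 : κ/C^2/s*‖u‖^2 ≤ κ/C^2/s*(C^2*‖Ai u‖^2) := by gcongr
  have h3 : κ/C^2/s*(C^2*‖Ai u‖^2) = κ/s*‖Ai u‖^2 := by field_simp
  linarith

theorem GA.det_ne {d : ℕ} {l C : ℝ} {A Ai : Eu d →L[ℝ] Eu d} (h : GA d l C A Ai) :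
    LinearMap.det (Ai : Eu d →ₗ[ℝ] Eu d) ≠ 0 := by
  have : (Ai : Eu d →ₗ[ℝ] Eu d) ∘ₗ (A : Eu d →ₗ[ℝ] Eu d) = LinearMap.id := by
    ext1 u; exact h.hl u
  have h2 := congrArg LinearMap.det this
  rw [LinearMap.det_comp, LinearMap.det_id] at h2
  exact left_ne_zero_of_mul_eq_one h2

theorem GA.cov {d : ℕ} {l C : ℝ} {A Ai : Eu d →L[ℝ] Eu d} (h : GA d l C A Ai) (s : ℝ)
    (g : Eu d → ℝ) (hg : Measurable g) (y : Eu d) :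
    ∫ u, phi d s u * g (y + A u) = ∫ z, Jd Ai * phi d s (Ai (z - y)) * g z := by
  have hd := h.det_ne
  have hm := Measure.map_linearMap_addHaar_eq_smul_addHaar (volume : Measure (Eu d)) hd
  have hF : Measurable (fun u => phi d s u * g (y + A u)) := by
    have := (phi_cont d s).measurable
    fun_prop
  have h1 : ∫ u, phi d s u * g (y + A u) ∂(Measure.map (Ai : Eu d →ₗ[ℝ] Eu d) volume)
      = ∫ z, phi d s (Ai z) * g (y + A (Ai z)) :=
    integral_map (φ := Ai) Ai.continuous.measurable.aemeasurable hF.aestronglyMeasurable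
  rw [hm, integral_smul_measure, ENNReal.toReal_ofReal (abs_nonneg _)] at h1
  simp_rw [h.hr] at h1
  have h2 : ∫ u, phi d s u * g (y + A u) = Jd Ai * ∫ z, phi d s (Ai z) * g (y + z) := by
    rw [← h1, smul_eq_mul, ← mul_assoc, Jd, ← abs_mul, mul_inv_cancel₀ hd]; simp
  rw [h2, ← integral_sub_right_eq_self (fun z => phi d s (Ai z) * g (y + z)) y, ← integral_const_mul]
  congr 1; ext z
  rw [add_sub_cancel, mul_assoc]

theorem phi_le_Gk (d : ℕ) (s : ℝ) (u : Eu d) : phi d s u = cd d * Gk d (1/2) s u := by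
  rw [phi_eq]; unfold Gk
  rw [mul_assoc]; congr 4; field_simp

theorem GA.phi_bound {d : ℕ} {l C : ℝ} {A Ai : Eu d →L[ℝ] Eu d} (h : GA d l C A Ai) (s : ℝ)
    (hs : 0 < s) (u : Eu d) : phi d s (Ai u) ≤ cd d * Gk d (1/2/C^2) s u := by
  rw [phi_le_Gk]
  exact mul_le_mul_of_nonneg_left (h.lower_exp (1/2) s (by norm_num) hs u) (cd_pos d).le

theorem GA.phi_int {d : ℕ} {l C : ℝ} {A Ai : Eu d →L[ℝ] Eu d} (h : GA d l C A Ai) (s : ℝ)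
    (hs : 0 < s) : Integrable (fun u => phi d s (Ai u)) := by
  have hC : 0 < C := by linarith [h.C1]
  refine ((Gk_integrable d (1/2/C^2) s (by positivity) hs).const_mul (cd d)).mono'
    ((phi_cont d s).comp Ai.continuous).aestronglyMeasurable (ae_of_all _ fun u => ?_)
  rw [Real.norm_eq_abs, abs_of_nonneg (phi_nonneg d s hs _)]
  exact h.phi_bound s hs u

theorem GA.J_one {d : ℕ} {l C : ℝ} {A Ai : Eu d →L[ℝ] Eu d} (h : GA d l C A Ai) :
    Jd Ai * ∫ z, phi d 1 (Ai z) = 1 := by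
  have := h.cov 1 (fun _ => 1) measurable_const 0
  simp only [mul_one, sub_zero] at this
  rw [phi_integral d 1 one_pos, integral_const_mul] at this
  exact this.symm

noncomputable def Jb (d : ℕ) (l : ℝ) : ℝ := (l^2)^(hf d)

theorem GA.J_le {d : ℕ} {l C : ℝ} {A Ai : Eu d →L[ℝ] Eu d} (h : GA d l C A Ai) : Jd Ai ≤ Jb d l := by
  have hl : 0 < l := by linarith [h.l1]
  have h1 : (Jb d l)⁻¹ ≤ ∫ z, phi d 1 (Ai z) := by
    have h2 : ∫ z : Eu d, cd d * Real.exp (-(l^2/2)*‖z‖^2) = (Jb d l)⁻¹ := by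
      rw [integral_const_mul, gauss_integral d _ (by positivity)]
      unfold cd Jb
      rw [show Real.pi/(l^2/2) = (2*Real.pi)*(l^2)⁻¹ by field_simp,
        Real.mul_rpow (x := 2*Real.pi) (by positivity) (by positivity), ← mul_assoc, ← Real.rpow_add (by positivity), Real.inv_rpow (by positivity)]
      simp
    rw [← h2]
    refine integral_mono ((gauss_integrable d _ (by positivity)).const_mul _) (h.phi_int 1 one_pos) fun z => ?_
    rw [phi_eq]
    simp only [Real.one_rpow, mul_one]
    refine mul_le_mul_of_nonneg_left (Real.exp_le_exp.2 ?_) (cd_pos d).le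
    have h3 : ‖Ai z‖^2 ≤ (l*‖z‖)^2 :=
      pow_le_pow_left₀ (norm_nonneg _) ((Ai.le_opNorm z).trans (by gcongr; exact h.bi)) 2
    nlinarith
  have h4 := h.J_one
  have h5 : 0 < Jb d l := by unfold Jb; positivity
  have h6 := Jd_nonneg Ai
  have : Jd Ai * (Jb d l)⁻¹ ≤ 1 := by rw [← h4]; gcongr
  rwa [mul_inv_le_iff₀ h5, one_mul] at this

theorem GA.inv_sub {d : ℕ} {l C : ℝ} {A Ai B Bi : Eu d →L[ℝ] Eu d} (h : GA d l C A Ai) (h' : GA d l C B Bi) :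
    ‖Ai - Bi‖ ≤ l^2 * ‖A - B‖ := by
  have e : Ai - Bi = Ai ∘L ((B - A) ∘L Bi) := by
    ext1 u; simp [h'.hr, h.hl]
  have hl := h.l1
  rw [e]
  calc _ ≤ ‖Ai‖ * (‖B-A‖*‖Bi‖) := (ContinuousLinearMap.opNorm_comp_le _ _).trans
        (mul_le_mul_of_nonneg_left (ContinuousLinearMap.opNorm_comp_le _ _) (norm_nonneg _))
    _ ≤ l * (‖B-A‖*l) := by gcongr; exacts [h.bi, h'.bi]
    _ = _ := by rw [norm_sub_rev]; ring

theorem exp_diff (p q m : ℝ) (hp : m ≤ p) (hq : m ≤ q) :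
    |Real.exp (-p) - Real.exp (-q)| ≤ |p - q| * Real.exp (-m) := by
  wlog hpq : p ≤ q generalizing p q
  · rw [abs_sub_comm, abs_sub_comm p q]; exact this q p hq hp (by linarith)
  have h1 : Real.exp (-q) = Real.exp (-p) * Real.exp (p-q) := by rw [← Real.exp_add]; congr 1; ring
  have h2 := Real.add_one_le_exp (p-q)
  have h3 : Real.exp (-p) ≤ Real.exp (-m) := Real.exp_le_exp.2 (by linarith)
  have h4 := Real.exp_pos (-p)
  rw [abs_of_nonneg (by have := Real.exp_le_exp.2 (neg_le_neg hpq); linarith), abs_of_nonpos (by linarith)]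
  calc _ = Real.exp (-p) * (1 - Real.exp (p-q)) := by rw [h1]; ring
    _ ≤ Real.exp (-p) * (-(p-q)) := by gcongr; linarith
    _ ≤ Real.exp (-m) * (-(p-q)) := by gcongr; linarith
    _ = _ := by ring

theorem GA.phi_sub {d : ℕ} {l C : ℝ} {A Ai B Bi : Eu d →L[ℝ] Eu d} (h : GA d l C A Ai) (h' : GA d l C B Bi)
    (s : ℝ) (hs : 0 < s) (u : Eu d) :
    |phi d s (Ai u) - phi d s (Bi u)| ≤ cd d * (4*C^2*l^3) * ‖A-B‖ * Gk d (1/(4*C^2)) s u := by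
  have hC : 0 < C := by linarith [h.C1]
  have hl : 0 < l := by linarith [h.l1]
  have hb : ∀ {D Di : Eu d →L[ℝ] Eu d}, GA d l C D Di → ‖u‖^2/(2*C^2*s) ≤ ‖Di u‖^2/(2*s) := by
    intro D Di hD
    rw [div_le_div_iff₀ (by positivity) (by positivity)]
    have := hD.lower u
    nlinarith
  have h1 := exp_diff _ _ _ (hb h) (hb h')
  have hn : ∀ {D Di : Eu d →L[ℝ] Eu d}, GA d l C D Di → ‖Di u‖ ≤ l*‖u‖ := by
    intro D Di hD
    exact (Di.le_opNorm u).trans (by gcongr; exact hD.bi)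
  have h2 : |‖Ai u‖ - ‖Bi u‖| ≤ l^2*‖A-B‖*‖u‖ := by
    refine (abs_norm_sub_norm_le _ _).trans ?_
    calc _ = ‖(Ai - Bi) u‖ := by simp
      _ ≤ ‖Ai-Bi‖*‖u‖ := (Ai-Bi).le_opNorm u
      _ ≤ _ := by gcongr; exact h.inv_sub h'
  have h3 : |‖Ai u‖^2/(2*s) - ‖Bi u‖^2/(2*s)| ≤ l^3*‖A-B‖*(‖u‖^2/s) := by
    rw [← sub_div, abs_div, abs_of_pos (by positivity : 0 < 2*s),
      show ‖Ai u‖^2 - ‖Bi u‖^2 = (‖Ai u‖ - ‖Bi u‖)*(‖Ai u‖+‖Bi u‖) by ring, abs_mul,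
      abs_of_nonneg (by positivity : 0 ≤ ‖Ai u‖+‖Bi u‖), div_le_iff₀ (by positivity)]
    calc _ ≤ (l^2*‖A-B‖*‖u‖)*(l*‖u‖+l*‖u‖) := by gcongr; exacts [hn h, hn h']
      _ = _ := by field_simp; ring
  have e1 : ∀ w : Eu d, phi d s w = cd d * s^(-(hf d)) * Real.exp (-(‖w‖^2/(2*s))) := by
    intro w; rw [phi_eq]; congr 2; ring
  have h0 : 0 < cd d * s^(-(hf d)) := mul_pos (cd_pos d) (by positivity)
  rw [e1, e1, ← mul_sub, abs_mul, abs_of_pos h0]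
  have h4 := w2Gk d (1/(2*C^2)) s (by positivity) hs u
  rw [show 1/(2*C^2)/2 = 1/(4*C^2) by field_simp; norm_num] at h4
  have e2 : Gk d (1/(2*C^2)) s u = s^(-(hf d)) * Real.exp (-(‖u‖^2/(2*C^2*s))) := by
    unfold Gk; congr 2; field_simp
  have hc := cd_pos d
  calc _ ≤ cd d * s^(-(hf d)) * (l^3*‖A-B‖*(‖u‖^2/s) * Real.exp (-(‖u‖^2/(2*C^2*s)))) := by
        refine mul_le_mul_of_nonneg_left (h1.trans ?_) h0.le
        gcongr
    _ = cd d * l^3*‖A-B‖ * (‖u‖^2/s * Gk d (1/(2*C^2)) s u) := by rw [e2]; ring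
    _ ≤ cd d * l^3*‖A-B‖ * (2/(1/(2*C^2)) * Gk d (1/(4*C^2)) s u) := by gcongr
    _ = _ := by field_simp; ring

noncomputable def CJ (d : ℕ) (l C : ℝ) : ℝ := Jb d l * Jb d l * (cd d * (4*C^2*l^3) * GI d (1/(4*C^2)))

theorem GA.J_sub {d : ℕ} {l C : ℝ} {A Ai B Bi : Eu d →L[ℝ] Eu d} (h : GA d l C A Ai) (h' : GA d l C B Bi) :
    |Jd Ai - Jd Bi| ≤ CJ d l C * ‖A-B‖ := by
  have hC : 0 < C := by linarith [h.C1]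
  have hl : 0 < l := by linarith [h.l1]
  have e : Jd Ai - Jd Bi = Jd Ai * Jd Bi * ∫ z, (phi d 1 (Bi z) - phi d 1 (Ai z)) := by
    rw [integral_sub (h'.phi_int 1 one_pos) (h.phi_int 1 one_pos)]
    have h1 := h.J_one
    have h2 := h'.J_one
    linear_combination -(Jd Ai)*h2 + (Jd Bi)*h1
  have hb := norm_integral_le_of_norm_le (f := fun z => phi d 1 (Bi z) - phi d 1 (Ai z))
    ((Gk_integrable d (1/(4*C^2)) 1 (by positivity) one_pos).const_mul (cd d * (4*C^2*l^3) * ‖B-A‖))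
    (ae_of_all _ fun u => h'.phi_sub h 1 one_pos u)
  rw [integral_const_mul, Gk_integral d _ 1 (by positivity) one_pos, Real.norm_eq_abs] at hb
  have hJ : 0 ≤ Jb d l := by unfold Jb; positivity
  rw [e, abs_mul, abs_mul, abs_of_nonneg (Jd_nonneg _), abs_of_nonneg (Jd_nonneg _)]
  calc _ ≤ Jb d l * Jb d l * _ := mul_le_mul (mul_le_mul h.J_le h'.J_le (Jd_nonneg _) hJ) hb (abs_nonneg _) (by positivity)
    _ = _ := by unfold CJ; rw [norm_sub_rev]; ring

noncomputable def CA (d : ℕ) (l C : ℝ) : ℝ := CJ d l C * cd d + Jb d l * (cd d * (4*C^2*l^3))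

theorem Jb_pos (d : ℕ) (l : ℝ) (hl : 1 ≤ l) : 0 < Jb d l := by unfold Jb; positivity

theorem CJ_nonneg (d : ℕ) (l C : ℝ) (hl : 1 ≤ l) (hC : 1 ≤ C) : 0 ≤ CJ d l C := by
  have := Jb_pos d l hl
  have := cd_pos d
  have := GI_pos d (1/(4*C^2)) (by positivity)
  unfold CJ; positivity

theorem CA_nonneg (d : ℕ) (l C : ℝ) (hl : 1 ≤ l) (hC : 1 ≤ C) : 0 ≤ CA d l C := by
  have := Jb_pos d l hl
  have := cd_pos d
  have := CJ_nonneg d l C hl hC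
  unfold CA; positivity

theorem GA.kernel_sub {d : ℕ} {l C : ℝ} {A Ai B Bi : Eu d →L[ℝ] Eu d} (h : GA d l C A Ai) (h' : GA d l C B Bi)
    (s : ℝ) (hs : 0 < s) (u : Eu d) :
    |Jd Ai * phi d s (Ai u) - Jd Bi * phi d s (Bi u)| ≤ CA d l C * ‖A-B‖ * Gk d (1/(4*C^2)) s u := by
  have hC : 0 < C := by linarith [h.C1]
  have hJ := Jb_pos d l h.l1
  have hc := cd_pos d
  have hG := Gk_nonneg d (1/(4*C^2)) s hs u
  have hCJ := CJ_nonneg d l C h.l1 h.C1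
  have h1 : phi d s (Ai u) ≤ cd d * Gk d (1/(4*C^2)) s u := by
    refine (h.phi_bound s hs u).trans (mul_le_mul_of_nonneg_left (Gk_anti d _ _ s ?_ hs u) hc.le)
    rw [div_div]
    apply one_div_le_one_div_of_le <;> nlinarith [sq_nonneg C, pow_pos hC 2]
  have e : Jd Ai * phi d s (Ai u) - Jd Bi * phi d s (Bi u)
      = (Jd Ai - Jd Bi) * phi d s (Ai u) + Jd Bi * (phi d s (Ai u) - phi d s (Bi u)) := by ring
  rw [e]
  refine (abs_add_le _ _).trans ?_
  rw [abs_mul, abs_mul, abs_of_nonneg (phi_nonneg d s hs _), abs_of_nonneg (Jd_nonneg Bi)]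
  calc _ ≤ (CJ d l C * ‖A-B‖) * (cd d * Gk d (1/(4*C^2)) s u)
        + Jb d l * (cd d * (4*C^2*l^3) * ‖A-B‖ * Gk d (1/(4*C^2)) s u) := by
        refine add_le_add (mul_le_mul (h.J_sub h') h1 (phi_nonneg d s hs _) (by positivity))
          (mul_le_mul h'.J_le (h.phi_sub h' s hs u) (abs_nonneg _) hJ.le)
    _ = _ := by unfold CA; ring

theorem GA.ker_int {d : ℕ} {l C : ℝ} {A Ai : Eu d →L[ℝ] Eu d} (h : GA d l C A Ai)
    (s : ℝ) (hs : 0 < s) (y : Eu d) (f : Eu d → ℝ) (hf : Measurable f) (Cf : ℝ) (hCf : ∀ x, |f x| ≤ Cf) :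
    Integrable (fun z => Jd Ai * phi d s (Ai (z-y)) * f z) :=
  (((h.phi_int s hs).comp_sub_right y).const_mul (Jd Ai)).mul_bdd hf.aestronglyMeasurable (ae_of_all _ hCf)

/-- Total variation comparison of two Gaussian laws. -/
theorem GA.tv {d : ℕ} {l C : ℝ} {A Ai B Bi : Eu d →L[ℝ] Eu d} (h : GA d l C A Ai) (h' : GA d l C B Bi)
    (s : ℝ) (hs : 0 < s) (y : Eu d) (f : Eu d → ℝ) (hf : Measurable f) (Cf : ℝ) (hCf : ∀ x, |f x| ≤ Cf) :
    |(∫ u, phi d s u * f (y + A u)) - ∫ u, phi d s u * f (y + B u)|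
      ≤ CA d l C * GI d (1/(4*C^2)) * ‖A-B‖ * Cf := by
  have hC : 0 < C := by linarith [h.C1]
  rw [h.cov s f hf y, h'.cov s f hf y, ← integral_sub (h.ker_int s hs y f hf Cf hCf) (h'.ker_int s hs y f hf Cf hCf)]
  have hb := norm_integral_le_of_norm_le (f := fun z => Jd Ai * phi d s (Ai (z-y)) * f z - Jd Bi * phi d s (Bi (z-y)) * f z)
    (((Gk_integrable_sub d (1/(4*C^2)) s (by positivity) hs y).const_mul (CA d l C * ‖A-B‖)).mul_const Cf)
    (ae_of_all _ fun u => by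
      rw [← sub_mul, norm_mul]
      exact mul_le_mul (h.kernel_sub h' s hs _) (hCf u) (norm_nonneg _)
        (mul_nonneg (mul_nonneg (CA_nonneg d l C h.l1 h.C1) (norm_nonneg _)) (Gk_nonneg d _ s hs _)))
  rw [integral_mul_const, integral_const_mul, Gk_integral_sub d _ s (by positivity) hs] at hb
  rw [Real.norm_eq_abs] at hb
  refine hb.trans (le_of_eq (by ring))
end EM

namespace EM

/-! ### Part 5: one-step operators -/

structure Sg (d : ℕ) (l C : ℝ) (σ σi : Eu d → (Eu d →L[ℝ] Eu d)) : Prop where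
  ga : ∀ x, GA d l C (σ x) (σi x)
  lip : ∀ x y, ‖σ x - σ y‖ ≤ C * ‖x - y‖

theorem cont_of_lip {X Y : Type*} [SeminormedAddCommGroup X] [SeminormedAddCommGroup Y] (f : X → Y) (K : ℝ)
    (h : ∀ x y, ‖f x - f y‖ ≤ K * ‖x - y‖) : Continuous f := by
  refine (LipschitzWith.of_dist_le_mul (K := K.toNNReal) fun x y => ?_).continuous
  rw [dist_eq_norm, dist_eq_norm]
  refine (h x y).trans ?_
  gcongr
  exact Real.le_coe_toNNReal K

variable {d : ℕ} {l C : ℝ} {σ σi : Eu d → (Eu d →L[ℝ] Eu d)}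

theorem Sg.l1 (h : Sg d l C σ σi) : 1 ≤ l := (h.ga 0).l1
theorem Sg.C1 (h : Sg d l C σ σi) : 1 ≤ C := (h.ga 0).C1

theorem Sg.cont (h : Sg d l C σ σi) : Continuous σ := cont_of_lip σ C h.lip

theorem Sg.conti (h : Sg d l C σ σi) : Continuous σi := by
  refine cont_of_lip σi (l^2*C) fun x y => ?_
  have := (h.ga x).inv_sub (h.ga y)
  refine this.trans ?_
  rw [mul_assoc]
  exact mul_le_mul_of_nonneg_left (h.lip x y) (by positivity)

theorem Sg.contJ (h : Sg d l C σ σi) : Continuous (fun x => Jd (σi x)) := by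
  refine cont_of_lip _ (CJ d l C*C) fun x y => ?_
  refine ((h.ga x).J_sub (h.ga y)).trans ?_
  rw [mul_assoc]
  exact mul_le_mul_of_nonneg_left (h.lip x y) (CJ_nonneg d l C h.l1 h.C1)

noncomputable def Rop (σ : Eu d → (Eu d →L[ℝ] Eu d)) (s : ℝ) (f : Eu d → ℝ) (x : Eu d) : ℝ :=
  ∫ u, phi d s u * f (x + σ x u)

noncomputable def Uop (σi : Eu d → (Eu d →L[ℝ] Eu d)) (s : ℝ) (f : Eu d → ℝ) (x : Eu d) : ℝ :=
  ∫ z, Jd (σi z) * phi d s (σi z (z - x)) * f z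

theorem Sg.Rop_meas (h : Sg d l C σ σi) (s : ℝ) (f : Eu d → ℝ) (hf : Measurable f) :
    Measurable (Rop σ s f) := by
  have hm : Measurable (fun p : Eu d × Eu d => phi d s p.2 * f (p.1 + σ p.1 p.2)) := by
    have h1 : Continuous (fun p : Eu d × Eu d => p.1 + σ p.1 p.2) :=
      continuous_fst.add ((h.cont.comp continuous_fst).clm_apply continuous_snd)
    exact ((phi_cont d s).measurable.comp measurable_snd).mul (hf.comp h1.measurable)
  exact (hm.stronglyMeasurable.integral_prod_right (ν := volume)).measurable

theorem Sg.Rop_bdd (s : ℝ) (hs : 0 < s) (f : Eu d → ℝ) (Cf : ℝ) (hCf : ∀ x, |f x| ≤ Cf) (x : Eu d) :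
    |Rop σ s f x| ≤ Cf := phi_mul_abs d s hs _ Cf fun _ => hCf _

theorem Sg.ker_cont (h : Sg d l C σ σi) (s : ℝ) :
    Continuous (fun p : Eu d × Eu d => Jd (σi p.2) * phi d s (σi p.2 (p.2 - p.1))) :=
  (h.contJ.comp continuous_snd).mul
    ((phi_cont d s).comp ((h.conti.comp continuous_snd).clm_apply (continuous_snd.sub continuous_fst)))

theorem Sg.Uop_meas (h : Sg d l C σ σi) (s : ℝ) (f : Eu d → ℝ) (hf : Measurable f) :
    Measurable (Uop σi s f) := by
  have hm : Measurable (fun p : Eu d × Eu d => Jd (σi p.2) * phi d s (σi p.2 (p.2 - p.1)) * f p.2) :=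
    (h.ker_cont s).measurable.mul (hf.comp measurable_snd)
  exact (hm.stronglyMeasurable.integral_prod_right (ν := volume)).measurable

theorem Sg.ker_bd (h : Sg d l C σ σi) (s : ℝ) (hs : 0 < s) (z u : Eu d) :
    |Jd (σi z) * phi d s (σi z u)| ≤ Jb d l * cd d * Gk d (1/2/C^2) s u := by
  rw [abs_of_nonneg (mul_nonneg (Jd_nonneg _) (phi_nonneg d s hs _)), mul_assoc]
  exact mul_le_mul (h.ga z).J_le ((h.ga z).phi_bound s hs u) (phi_nonneg d s hs _) (Jb_pos d l h.l1).le

theorem Sg.Uop_int (h : Sg d l C σ σi) (s : ℝ) (hs : 0 < s) (f : Eu d → ℝ) (hf : Measurable f)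
    (Cf : ℝ) (hCf : ∀ x, |f x| ≤ Cf) (x : Eu d) :
    Integrable (fun z => Jd (σi z) * phi d s (σi z (z - x)) * f z) := by
  have hC := h.C1
  refine Integrable.mul_bdd ?_ hf.aestronglyMeasurable (ae_of_all _ hCf)
  refine ((Gk_integrable_sub d (1/2/C^2) s (by positivity) hs x).const_mul (Jb d l * cd d)).mono' ?_
    (ae_of_all _ fun z => h.ker_bd s hs z (z-x))
  exact ((h.ker_cont s).comp (continuous_const.prodMk continuous_id)).aestronglyMeasurable

theorem K3 (d : ℕ) (l C : ℝ) : ∃ K, 0 ≤ K ∧ ∀ σ σi, Sg d l C σ σi → ∀ f : Eu d → ℝ, Measurable f →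
    ∀ Cf, (∀ x, |f x| ≤ Cf) → ∀ s, 0 < s → ∀ x, |Rop σ s f x - Uop σi s f x| ≤ K * Real.sqrt s * Cf := by
  by_cases hlC : 1 ≤ l ∧ 1 ≤ C
  swap
  · exact ⟨0, le_rfl, fun σ σi h => absurd ⟨h.l1, h.C1⟩ hlC⟩
  obtain ⟨hl, hC⟩ := hlC
  have hCA := CA_nonneg d l C hl hC
  have hκ : 0 < 1/(4*C^2) := by positivity
  have hGI := GI_pos d (1/(4*C^2)/2) (by positivity)
  refine ⟨CA d l C * C * ((1+2/(1/(4*C^2))) * GI d (1/(4*C^2)/2)), by positivity, ?_⟩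
  intro σ σi h f hf Cf hCf s hs x
  have hCf0 : 0 ≤ Cf := (abs_nonneg _).trans (hCf 0)
  unfold Rop Uop
  rw [(h.ga x).cov s f hf x, ← integral_sub ((h.ga x).ker_int s hs x f hf Cf hCf) (h.Uop_int s hs f hf Cf hCf x)]
  have hb := norm_integral_le_of_norm_le
    (f := fun z => Jd (σi x) * phi d s (σi x (z-x)) * f z - Jd (σi z) * phi d s (σi z (z - x)) * f z)
    (((Gk_integrable_sub d (1/(4*C^2)/2) s (by positivity) hs x).const_mul
      (CA d l C * C * (Real.sqrt s * (1+2/(1/(4*C^2)))))).mul_const Cf)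
    (ae_of_all _ fun z => by
      rw [← sub_mul, norm_mul]
      refine mul_le_mul ?_ (hCf z) (norm_nonneg _) (mul_nonneg (by positivity) (Gk_nonneg d _ s hs _))
      have hG := Gk_nonneg d (1/(4*C^2)) s hs (z-x)
      calc _ ≤ CA d l C * ‖σ x - σ z‖ * Gk d (1/(4*C^2)) s (z-x) := (h.ga x).kernel_sub (h.ga z) s hs _
        _ ≤ CA d l C * (C * ‖z - x‖) * Gk d (1/(4*C^2)) s (z-x) := by
          rw [norm_sub_rev z x]; gcongr; exact h.lip x z
        _ = CA d l C * C * (‖z-x‖ * Gk d (1/(4*C^2)) s (z-x)) := by ring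
        _ ≤ CA d l C * C * (Real.sqrt s * (1+2/(1/(4*C^2))) * Gk d (1/(4*C^2)/2) s (z-x)) :=
          mul_le_mul_of_nonneg_left (wGk d _ s hκ hs _) (by positivity)
        _ = _ := by ring)
  rw [integral_mul_const, integral_const_mul, Gk_integral_sub d _ s (by positivity) hs, Real.norm_eq_abs] at hb
  refine hb.trans (le_of_eq (by ring))

/-- The difference kernel. -/
theorem Sg.g_eq (h : Sg d l C σ σi) (τ v : ℝ) (hτ : 0 < τ) (hv : 0 ≤ v) (f : Eu d → ℝ) (hf : Measurable f)
    (Cf : ℝ) (hCf : ∀ x, |f x| ≤ Cf) (x : Eu d) :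
    Uop σi (τ+v) f x - Uop σi τ f x = ∫ z, (Jd (σi z) * f z * cd d) * dl d (EM.hf d) τ v (σi z (z-x)) := by
  unfold Uop
  rw [← integral_sub (h.Uop_int _ (by linarith) f hf Cf hCf x) (h.Uop_int _ hτ f hf Cf hCf x)]
  congr 1; ext z
  rw [mul_assoc, mul_assoc (Jd (σi z) * f z), ← phi_dl]; ring
end EM

namespace EM

variable {d : ℕ} {l C : ℝ} {σ σi : Eu d → (Eu d →L[ℝ] Eu d)}

theorem Sg.dker_bd (h : Sg d l C σ σi) (τ v : ℝ) (hτ : 0 < τ) (hv : 0 ≤ v) (hvτ : v ≤ τ) (f : Eu d → ℝ)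
    (Cf : ℝ) (hCf : ∀ x, |f x| ≤ Cf) (z u : Eu d) :
    |(Jd (σi z) * f z * cd d) * dl d (EM.hf d) τ v (σi z u)|
      ≤ (Jb d l * Cf * cd d * ((EM.hf d + 2) * (v/τ))) * Gk d (1/8/C^2) τ u := by
  have hJ := Jb_pos d l h.l1
  have hc := cd_pos d
  have hCf0 : 0 ≤ Cf := (abs_nonneg _).trans (hCf 0)
  have ha := hf_nonneg d
  rw [abs_mul, abs_mul, abs_mul, abs_of_nonneg (Jd_nonneg _), abs_of_pos hc, mul_assoc _ _ (Gk d (1/8/C^2) τ u)]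
  have h1 : |dl d (EM.hf d) τ v (σi z u)| ≤ (EM.hf d + 2) * (v/τ) * Gk d (1/8/C^2) τ u := by
    refine (dl_bound _ τ v ha hτ hv hvτ _).trans ?_
    have e : (EM.hf d+2) * v * τ^(-(EM.hf d)-1) * Real.exp (-‖σi z u‖^2/(8*τ))
        = (EM.hf d + 2) * (v/τ) * Gk d (1/8) τ (σi z u) := by
      unfold Gk
      rw [Real.rpow_sub_one hτ.ne', show -‖σi z u‖^2/(8*τ) = -(1/8/τ)*‖σi z u‖^2 by field_simp]
      ring
    rw [e]
    exact mul_le_mul_of_nonneg_left ((h.ga z).lower_exp (1/8) τ (by norm_num) hτ u) (by positivity)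
  refine mul_le_mul (mul_le_mul_of_nonneg_right (mul_le_mul (h.ga z).J_le (hCf z) (abs_nonneg _) hJ.le) hc.le) h1
    (abs_nonneg _) (by positivity)

theorem Sg.dker_meas (h : Sg d l C σ σi) (τ v : ℝ) (f : Eu d → ℝ) (hf : Measurable f) :
    Measurable (fun p : Eu d × Eu d => (Jd (σi p.2) * f p.2 * cd d) * dl d (EM.hf d) τ v (σi p.2 (p.2 - p.1))) := by
  have h1 : Continuous (fun p : Eu d × Eu d => dl d (EM.hf d) τ v (σi p.2 (p.2 - p.1))) :=
    (dl_cont d _ τ v).comp ((h.conti.comp continuous_snd).clm_apply (continuous_snd.sub continuous_fst))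
  exact (((h.contJ.measurable.comp measurable_snd).mul (hf.comp measurable_snd)).mul_const _).mul h1.measurable

theorem Sg.dker_int (h : Sg d l C σ σi) (τ v : ℝ) (hτ : 0 < τ) (hv : 0 ≤ v) (hvτ : v ≤ τ) (f : Eu d → ℝ)
    (hf : Measurable f) (Cf : ℝ) (hCf : ∀ x, |f x| ≤ Cf) (x : Eu d) :
    Integrable (fun z => (Jd (σi z) * f z * cd d) * dl d (EM.hf d) τ v (σi z (z-x))) := by
  have hC := h.C1
  exact ((Gk_integrable_sub d (1/8/C^2) τ (by positivity) hτ x).const_mul _).mono'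
    ((h.dker_meas τ v f hf).comp (measurable_const.prodMk measurable_id)).aestronglyMeasurable
    (ae_of_all _ fun z => h.dker_bd τ v hτ hv hvτ f Cf hCf z (z-x))

theorem K2 (d : ℕ) (l C : ℝ) : ∃ K, 0 ≤ K ∧ ∀ σ σi, Sg d l C σ σi → ∀ f : Eu d → ℝ, Measurable f →
    ∀ Cf, (∀ x, |f x| ≤ Cf) → ∀ τ v, 0 < τ → 0 ≤ v → v ≤ τ → ∀ x,
    |Uop σi (τ+v) f x - Uop σi τ f x| ≤ K * (v/τ) * Cf := by
  by_cases hlC : 1 ≤ l ∧ 1 ≤ C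
  swap
  · exact ⟨0, le_rfl, fun σ σi h => absurd ⟨h.l1, h.C1⟩ hlC⟩
  obtain ⟨hl, hC⟩ := hlC
  have hJ := Jb_pos d l hl
  have hc := cd_pos d
  have ha := hf_nonneg d
  have hGI := GI_pos d (1/8/C^2) (by positivity)
  refine ⟨Jb d l * cd d * (EM.hf d + 2) * GI d (1/8/C^2), by positivity, ?_⟩
  intro σ σi h f hf Cf hCf τ v hτ hv hvτ x
  rw [h.g_eq τ v hτ hv f hf Cf hCf x]
  have hb := norm_integral_le_of_norm_le
    (f := fun z => (Jd (σi z) * f z * cd d) * dl d (EM.hf d) τ v (σi z (z-x)))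
    ((Gk_integrable_sub d (1/8/C^2) τ (by positivity) hτ x).const_mul _)
    (ae_of_all _ fun z => h.dker_bd τ v hτ hv hvτ f Cf hCf z (z-x))
  rw [integral_const_mul, Gk_integral_sub d _ τ (by positivity) hτ, Real.norm_eq_abs] at hb
  refine hb.trans (le_of_eq (by ring))

theorem Sg.fubini (h : Sg d l C σ σi) (t τ v : ℝ) (ht : 0 < t) (hτ : 0 < τ) (hv : 0 ≤ v) (hvτ : v ≤ τ) (f : Eu d → ℝ)
    (hf : Measurable f) (Cf : ℝ) (hCf : ∀ x, |f x| ≤ Cf) (x : Eu d) :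
    Integrable (fun p : Eu d × Eu d => phi d t p.1 *
      ((Jd (σi p.2) * f p.2 * cd d) * dl d (EM.hf d) τ v (σi p.2 (p.2 - (x + σ x p.1))))) (volume.prod volume) := by
  have hC := h.C1
  set K0 := (Jb d l * Cf * cd d * ((EM.hf d + 2) * (v/τ))) with hK0
  have hdom : Integrable (fun p : Eu d × Eu d => phi d t p.1 * (K0 * Gk d (1/8/C^2) τ (p.2 - (x + σ x p.1))))
      (volume.prod volume) := by
    have hc : Continuous (fun p : Eu d × Eu d => phi d t p.1 * (K0 * Gk d (1/8/C^2) τ (p.2 - (x + σ x p.1)))) := by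
      have h1 := phi_cont d t
      have h2 := Gk_cont d (1/8/C^2) τ
      fun_prop
    rw [integrable_prod_iff hc.aestronglyMeasurable]
    refine ⟨ae_of_all _ fun y => ((Gk_integrable_sub d (1/8/C^2) τ (by positivity) hτ (x + σ x y)).const_mul K0).const_mul (phi d t y), ?_⟩
    have : ∀ y : Eu d, ∫ z, ‖phi d t y * (K0 * Gk d (1/8/C^2) τ (z - (x + σ x y)))‖ = phi d t y * (|K0| * GI d (1/8/C^2)) := by
      intro y
      rw [← Gk_integral_sub d (1/8/C^2) τ (by positivity) hτ (x + σ x y), ← integral_const_mul, ← integral_const_mul]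
      congr 1; ext z
      rw [norm_mul, norm_mul, Real.norm_eq_abs, Real.norm_eq_abs, Real.norm_eq_abs, abs_of_nonneg (phi_nonneg d t ht y),
        abs_of_nonneg (Gk_nonneg d _ τ hτ _)]
    simp_rw [this]
    exact (phi_integrable d t ht).mul_const _
  refine hdom.mono' ?_ (ae_of_all _ fun p => ?_)
  · refine Measurable.aestronglyMeasurable ?_
    have h1 := (phi_cont d t).measurable
    refine (h1.comp measurable_fst).mul ?_
    exact (h.dker_meas τ v f hf).comp ((show Measurable (fun p : Eu d × Eu d => x + σ x p.1) by fun_prop).prodMk measurable_snd)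
  · rw [norm_mul, Real.norm_eq_abs, abs_of_nonneg (phi_nonneg d t ht _)]
    exact mul_le_mul_of_nonneg_left (h.dker_bd τ v hτ hv hvτ f Cf hCf _ _) (phi_nonneg d t ht _)

theorem K1 (d : ℕ) (l C : ℝ) : ∃ K, 0 ≤ K ∧ ∀ σ σi, Sg d l C σ σi → ∀ f : Eu d → ℝ, Measurable f →
    ∀ Cf, (∀ x, |f x| ≤ Cf) → ∀ t τ v, 0 < t → t ≤ τ → 0 ≤ v → v ≤ τ → ∀ x,
    |Rop σ t (fun x => Uop σi (τ+v) f x - Uop σi τ f x) x - (Uop σi (τ+t+v) f x - Uop σi (τ+t) f x)|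
      ≤ K * t * v * (Real.sqrt τ/τ^2) * Cf := by
  by_cases hlC : 1 ≤ l ∧ 1 ≤ C
  swap
  · exact ⟨0, le_rfl, fun σ σi h => absurd ⟨h.l1, h.C1⟩ hlC⟩
  obtain ⟨hl, hC⟩ := hlC
  have hJ := Jb_pos d l hl
  have hc := cd_pos d
  have ha := hf_nonneg d
  set Λ := l*C with hΛdef
  have hΛ : 1 ≤ Λ := one_le_mul_of_one_le_of_one_le hl hC
  set κ := 1/(32*Λ^2)/C^2 with hκdef
  have hκ : 0 < κ := by positivity
  have hGI := GI_pos d (κ/2) (by positivity)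
  have hCK : 0 ≤ CK1 d Λ := by unfold CK1; positivity
  refine ⟨Jb d l * cd d * CK1 d Λ * (l*C) * (1+2/κ) * GI d (κ/2), by positivity, ?_⟩
  intro σ σi h f hf Cf hCf t τ v ht htτ hv hvτ x
  have hτ : 0 < τ := by linarith
  have hCf0 : 0 ≤ Cf := (abs_nonneg _).trans (hCf 0)
  have e1 : Rop σ t (fun x => Uop σi (τ+v) f x - Uop σi τ f x) x
      = ∫ z, (Jd (σi z) * f z * cd d) * ∫ y, phi d t y * dl d (EM.hf d) τ v (σi z (z-x) - (σi z ∘L σ x) y) := by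
    unfold Rop
    have : ∀ y, phi d t y * (Uop σi (τ+v) f (x + σ x y) - Uop σi τ f (x + σ x y))
        = ∫ z, phi d t y * ((Jd (σi z) * f z * cd d) * dl d (EM.hf d) τ v (σi z (z - (x + σ x y)))) := by
      intro y
      rw [h.g_eq τ v hτ hv f hf Cf hCf, integral_const_mul]
    simp_rw [this]
    rw [integral_integral_swap (h.fubini t τ v ht hτ hv hvτ f hf Cf hCf x)]
    congr 1; ext z
    rw [← integral_const_mul]
    congr 1; ext y
    rw [show σi z (z - (x + σ x y)) = σi z (z-x) - (σi z ∘L σ x) y by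
      simp only [ContinuousLinearMap.comp_apply, map_sub, map_add]; abel]
    ring
  have hint1 : Integrable (fun z => (Jd (σi z) * f z * cd d) * ∫ y, phi d t y * dl d (EM.hf d) τ v (σi z (z-x) - (σi z ∘L σ x) y)) := by
    have := (h.fubini t τ v ht hτ hv hvτ f hf Cf hCf x).integral_prod_right
    refine this.congr (ae_of_all _ fun z => ?_)
    simp only
    rw [← integral_const_mul]
    congr 1; ext y
    rw [show σi z (z - (x + σ x y)) = σi z (z-x) - (σi z ∘L σ x) y by
      simp only [ContinuousLinearMap.comp_apply, map_sub, map_add]; abel]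
    ring
  rw [e1, h.g_eq (τ+t) v (by linarith) hv f hf Cf hCf x,
    ← integral_sub hint1 (h.dker_int (τ+t) v (by linarith) hv (by linarith) f hf Cf hCf x)]
  have pt : ∀ z, ‖(Jd (σi z) * f z * cd d) * (∫ y, phi d t y * dl d (EM.hf d) τ v (σi z (z-x) - (σi z ∘L σ x) y))
      - (Jd (σi z) * f z * cd d) * dl d (EM.hf d) (τ+t) v (σi z (z-x))‖
      ≤ (Jb d l * Cf * cd d * (CK1 d Λ * t * v * (l*C) * (1/τ^2) * (Real.sqrt τ * (1+2/κ)))) * Gk d (κ/2) τ (z-x) := by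
    intro z
    rw [← mul_sub, norm_mul, norm_mul, norm_mul, Real.norm_eq_abs, Real.norm_eq_abs, Real.norm_eq_abs, Real.norm_eq_abs,
      abs_of_nonneg (Jd_nonneg _), abs_of_pos hc, mul_assoc _ _ (Gk d (κ/2) τ (z-x))]
    have hM : ‖σi z ∘L σ x‖ ≤ Λ := (ContinuousLinearMap.opNorm_comp_le _ _).trans
      (mul_le_mul (h.ga z).bi (h.ga x).bA (norm_nonneg _) (by linarith))
    have hM1 : ‖σi z ∘L σ x - 1‖ ≤ l*C*‖z-x‖ := by
      have : σi z ∘L σ x - 1 = σi z ∘L (σ x - σ z) := by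
        ext1 u; simp [(h.ga z).hl]
      rw [this]
      refine (ContinuousLinearMap.opNorm_comp_le _ _).trans ?_
      rw [mul_assoc]
      refine mul_le_mul (h.ga z).bi ?_ (norm_nonneg _) (by linarith)
      rw [norm_sub_rev z x]; exact h.lip x z
    have hk := K1_kernel d Λ t τ v hΛ ht htτ hv hvτ (σi z ∘L σ x) hM (σi z (z-x))
    have hk2 : CK1 d Λ * t * v * ‖σi z ∘L σ x - 1‖ * τ^(-(EM.hf d)-2) * Real.exp (-(1/(32*Λ^2)*‖σi z (z-x)‖^2/τ))
        ≤ (CK1 d Λ * t * v * (l*C) * (1/τ^2) * (Real.sqrt τ * (1+2/κ))) * Gk d (κ/2) τ (z-x) := by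
      have e2 : τ^(-(EM.hf d)-2) * Real.exp (-(1/(32*Λ^2)*‖σi z (z-x)‖^2/τ))
          = 1/τ^2 * Gk d (1/(32*Λ^2)) τ (σi z (z-x)) := by
        unfold Gk
        rw [show (-(EM.hf d)-2 : ℝ) = -(EM.hf d) - (2:ℕ) by norm_num, Real.rpow_sub_natCast hτ.ne',
          show -(1/(32*Λ^2)*‖σi z (z-x)‖^2/τ) = -(1/(32*Λ^2)/τ)*‖σi z (z-x)‖^2 by ring]
        ring
      have hG := Gk_nonneg d κ τ hτ (z-x)
      calc _ = CK1 d Λ * t * v * ‖σi z ∘L σ x - 1‖ * (1/τ^2 * Gk d (1/(32*Λ^2)) τ (σi z (z-x))) := by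
            rw [← e2]; ring
        _ ≤ CK1 d Λ * t * v * (l*C*‖z-x‖) * (1/τ^2 * Gk d κ τ (z-x)) := by
            refine mul_le_mul (mul_le_mul_of_nonneg_left hM1 (by positivity))
              (mul_le_mul_of_nonneg_left ((h.ga z).lower_exp (1/(32*Λ^2)) τ (by positivity) hτ _) (by positivity))
              (mul_nonneg (by positivity) (Gk_nonneg d _ τ hτ _)) (by positivity)
        _ = CK1 d Λ * t * v * (l*C) * (1/τ^2) * (‖z-x‖ * Gk d κ τ (z-x)) := by ring
        _ ≤ CK1 d Λ * t * v * (l*C) * (1/τ^2) * (Real.sqrt τ * (1+2/κ) * Gk d (κ/2) τ (z-x)) :=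
            mul_le_mul_of_nonneg_left (wGk d κ τ hκ hτ _) (by positivity)
        _ = _ := by ring
    refine mul_le_mul (mul_le_mul_of_nonneg_right (mul_le_mul (h.ga z).J_le (hCf z) (abs_nonneg _) hJ.le) hc.le) (hk.trans hk2)
      (abs_nonneg _) (by positivity)
  have hb := norm_integral_le_of_norm_le ((Gk_integrable_sub d (κ/2) τ (by positivity) hτ x).const_mul _) (ae_of_all _ pt)
  rw [integral_const_mul, Gk_integral_sub d _ τ (by positivity) hτ, Real.norm_eq_abs] at hb
  refine hb.trans (le_of_eq (by ring))

theorem conv_F (d : ℕ) (t v : ℝ) (ht : 0 < t) (hv : 0 < v) (F : Eu d → ℝ) (hF : Measurable F) (Cf : ℝ)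
    (hCf : ∀ x, |F x| ≤ Cf) :
    ∫ y, phi d t y * (∫ u, phi d v u * F (y + u)) = ∫ w, phi d (v+t) w * F w := by
  have h1 : ∀ y, phi d t y * (∫ u, phi d v u * F (y + u)) = ∫ w, phi d t y * (phi d v (w-y) * F w) := by
    intro y
    rw [integral_const_mul, ← integral_sub_right_eq_self (fun u => phi d v u * F (y+u)) y]
    simp_rw [add_sub_cancel]
  have hdom : Integrable (fun p : Eu d × Eu d => phi d t p.1 * phi d v (p.2 - p.1)) (volume.prod volume) := by
    have hc : Continuous (fun p : Eu d × Eu d => phi d t p.1 * phi d v (p.2 - p.1)) := by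
      have h1 := phi_cont d t
      have h2 := phi_cont d v
      fun_prop
    rw [integrable_prod_iff hc.aestronglyMeasurable]
    refine ⟨ae_of_all _ fun y => ((phi_integrable d v hv).comp_sub_right y).const_mul (phi d t y), ?_⟩
    have : ∀ y : Eu d, ∫ z, ‖phi d t y * phi d v (z - y)‖ = phi d t y := by
      intro y
      have : ∀ z, ‖phi d t y * phi d v (z - y)‖ = phi d t y * phi d v (z-y) := fun z =>
        Real.norm_of_nonneg (mul_nonneg (phi_nonneg d t ht _) (phi_nonneg d v hv _))
      simp_rw [this]
      rw [integral_const_mul, integral_sub_right_eq_self (fun z => phi d v z), phi_integral d v hv, mul_one]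
    simp_rw [this]
    exact phi_integrable d t ht
  have hI : Integrable (fun p : Eu d × Eu d => phi d t p.1 * (phi d v (p.2 - p.1) * F p.2)) (volume.prod volume) := by
    have := hdom.mul_bdd (g := fun p => F p.2) (hF.comp measurable_snd).aestronglyMeasurable (ae_of_all _ fun p => hCf p.2)
    simpa only [mul_assoc] using this
  simp_rw [h1]
  rw [integral_integral_swap hI]
  congr 1; ext w
  rw [← phi_conv d t v ht hv w, ← integral_mul_const]
  congr 1; ext y; ring

theorem K0 (d : ℕ) (l C : ℝ) : ∃ K, 0 ≤ K ∧ ∀ σ σi, Sg d l C σ σi → ∀ f : Eu d → ℝ, Measurable f →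
    ∀ Cf, (∀ x, |f x| ≤ Cf) → ∀ t v, 0 < t → 0 < v → ∀ x,
    |Rop σ t (Rop σ v f) x - Rop σ (v+t) f x| ≤ K * Real.sqrt t * Cf := by
  by_cases hlC : 1 ≤ l ∧ 1 ≤ C
  swap
  · exact ⟨0, le_rfl, fun σ σi h => absurd ⟨h.l1, h.C1⟩ hlC⟩
  obtain ⟨hl, hC⟩ := hlC
  have hc := cd_pos d
  have hCA := CA_nonneg d l C hl hC
  have hGI := GI_pos d (1/(4*C^2)) (by positivity)
  have hGI2 := GI_pos d (1/2/2) (by positivity)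
  set T := CA d l C * GI d (1/(4*C^2)) with hT
  have hT0 : 0 ≤ T := by positivity
  refine ⟨T * (C*C) * (cd d * (1+2/(1/2)) * GI d (1/2/2)), by positivity, ?_⟩
  intro σ σi h f hf Cf hCf t v ht hv x
  have hCf0 : 0 ≤ Cf := (abs_nonneg _).trans (hCf 0)
  have e1 : Rop σ (v+t) f x = ∫ y, phi d t y * (∫ u, phi d v u * f (x + σ x y + σ x u)) := by
    unfold Rop
    have hFm : Measurable (fun w => f (x + σ x w)) := by fun_prop
    rw [← conv_F d t v ht hv (fun w => f (x + σ x w)) hFm Cf (fun _ => hCf _)]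
    simp_rw [map_add, add_assoc]
  have hm2 : Measurable (fun y => ∫ u, phi d v u * f (x + σ x y + σ x u)) := by
    have hm : Measurable (fun p : Eu d × Eu d => phi d v p.2 * f (x + σ x p.1 + σ x p.2)) := by
      have := (phi_cont d v).measurable
      fun_prop
    exact (hm.stronglyMeasurable.integral_prod_right (ν := volume)).measurable
  have i1 : Integrable (fun y => phi d t y * Rop σ v f (x + σ x y)) :=
    phi_mul_integrable d t ht _ ((h.Rop_meas v f hf).comp (by fun_prop)) Cf (fun y => Sg.Rop_bdd v hv f Cf hCf _)
  have i2 : Integrable (fun y => phi d t y * (∫ u, phi d v u * f (x + σ x y + σ x u))) :=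
    phi_mul_integrable d t ht _ hm2 Cf (fun y => phi_mul_abs d v hv _ Cf fun _ => hCf _)
  rw [e1, show Rop σ t (Rop σ v f) x = ∫ y, phi d t y * Rop σ v f (x + σ x y) from rfl, ← integral_sub i1 i2]
  have pt : ∀ y, ‖phi d t y * Rop σ v f (x + σ x y) - phi d t y * (∫ u, phi d v u * f (x + σ x y + σ x u))‖
      ≤ (T * (C*C) * Cf * (cd d * (Real.sqrt t * (1+2/(1/2))))) * Gk d (1/2/2) t y := by
    intro y
    rw [← mul_sub, norm_mul, Real.norm_eq_abs, Real.norm_eq_abs, abs_of_nonneg (phi_nonneg d t ht y)]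
    have h1 := (h.ga (x + σ x y)).tv (h.ga x) v hv (x + σ x y) f hf Cf hCf
    have h2 : ‖σ (x + σ x y) - σ x‖ ≤ C*C*‖y‖ := by
      refine (h.lip _ _).trans ?_
      rw [add_sub_cancel_left, mul_assoc]
      refine mul_le_mul_of_nonneg_left ?_ (by linarith)
      exact ((σ x).le_opNorm y).trans (mul_le_mul_of_nonneg_right (h.ga x).bA (norm_nonneg _))
    have h3 := wGk d (1/2) t (by norm_num) ht y
    have hp := phi_nonneg d t ht y
    calc _ ≤ phi d t y * (T * (C*C*‖y‖) * Cf) := by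
          refine mul_le_mul_of_nonneg_left (h1.trans ?_) hp
          gcongr
      _ = T * (C*C) * Cf * (cd d * (‖y‖ * Gk d (1/2) t y)) := by rw [phi_le_Gk]; ring
      _ ≤ T * (C*C) * Cf * (cd d * (Real.sqrt t * (1+2/(1/2)) * Gk d (1/2/2) t y)) := by gcongr
      _ = _ := by ring
  have hb := norm_integral_le_of_norm_le ((Gk_integrable d (1/2/2) t (by positivity) ht).const_mul _) (ae_of_all _ pt)
  rw [integral_const_mul, Gk_integral d _ t (by positivity) ht, Real.norm_eq_abs] at hb
  refine hb.trans (le_of_eq (by ring))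
end EM

namespace EM

/-! ### Part 7: Markov property and telescoping -/

theorem markov {Ω : Type} (m : MeasurableSpace Ω) {m0 : MeasurableSpace Ω} (hm : m ≤ m0) (P : Measure Ω) [IsProbabilityMeasure P]
    {d : ℕ} {l C : ℝ} {σ σi : Eu d → (Eu d →L[ℝ] Eu d)} (h : Sg d l C σ σi)
    (X D : Ω → Eu d) (hX : Measurable[m] X) (hD : Measurable D) (δ : ℝ) (hδ : 0 < δ)
    (hind : Indep (MeasurableSpace.comap (fun ω => fun i => D ω i) inferInstance) m P)
    (hlaw : Measure.map (fun ω => fun i => D ω i) P = Measure.pi (fun _ : Fin d => gaussianReal 0 (Real.toNNReal δ)))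
    (Z : Ω → ℝ) (hZ : Measurable[m] Z) (KZ : ℝ) (hKZ : ∀ ω, |Z ω| ≤ KZ) (ψ : Eu d → ℝ) (hψ : Measurable ψ)
    (K : ℝ) (hK : ∀ x, |ψ x| ≤ K) :
    ∫ ω, Z ω * ψ (X ω + σ (X ω) (D ω)) ∂P = ∫ ω, Z ω * Rop σ δ ψ (X ω) ∂P := by
  set W : Ω → (Fin d → ℝ) := fun ω => fun i => D ω i with hW
  have hWm : Measurable W := by fun_prop
  set V : Ω → ℝ × Eu d := fun ω => (Z ω, X ω) with hV
  have hVm' : Measurable[m] V := hZ.prodMk hX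
  have hVm : Measurable V := hVm'.mono hm le_rfl
  have hZm : Measurable Z := hZ.mono hm le_rfl
  have hXm : Measurable X := hX.mono hm le_rfl
  have hVW : IndepFun V W P := by
    rw [IndepFun_iff_Indep]
    exact (indep_of_indep_of_le_right hind hVm'.comap_le).symm
  have hmap := (indepFun_iff_map_prod_eq_prod_map_map hVm.aemeasurable hWm.aemeasurable).1 hVW
  have hto : Measurable (fun w : Fin d → ℝ => (WithLp.toLp 2 w : Eu d)) := (MeasurableEquiv.toLp 2 (Fin d → ℝ)).measurable
  set H : (ℝ × Eu d) × (Fin d → ℝ) → ℝ := fun p => p.1.1 * ψ (p.1.2 + σ p.1.2 (WithLp.toLp 2 p.2)) with hH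
  have hc : Continuous (fun p : Eu d × Eu d => p.1 + σ p.1 p.2) :=
      continuous_fst.add ((h.cont.comp continuous_fst).clm_apply continuous_snd)
  have hHm : Measurable H := by
    refine (measurable_fst.comp measurable_fst).mul (hψ.comp ?_)
    exact hc.measurable.comp ((measurable_snd.comp measurable_fst).prodMk (hto.comp measurable_snd))
  have hVWm : Measurable (fun ω => (V ω, W ω)) := hVm.prodMk hWm
  have e0 : ∀ ω, H (V ω, W ω) = Z ω * ψ (X ω + σ (X ω) (D ω)) := fun ω => rfl
  have hI : Integrable (fun ω => H (V ω, W ω)) P := by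
    refine Integrable.mono' (integrable_const (KZ*K)) (hHm.comp hVWm).aestronglyMeasurable (ae_of_all _ fun ω => ?_)
    rw [e0, norm_mul]
    exact mul_le_mul (hKZ ω) (hK _) (norm_nonneg _) ((abs_nonneg _).trans (hKZ ω))
  have hI2 : Integrable H ((P.map V).prod (P.map W)) := by
    rw [← hmap, integrable_map_measure hHm.aestronglyMeasurable hVWm.aemeasurable]; exact hI
  simp_rw [← e0]
  have : IsProbabilityMeasure (P.map V) := Measure.isProbabilityMeasure_map hVm.aemeasurable
  have : IsProbabilityMeasure (P.map W) := Measure.isProbabilityMeasure_map hWm.aemeasurable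
  rw [← integral_map hVWm.aemeasurable hHm.aestronglyMeasurable, hmap, integral_prod _ hI2]
  have e1 : ∀ p : ℝ × Eu d, ∫ w, H (p, w) ∂(P.map W) = p.1 * Rop σ δ ψ p.2 := by
    intro p
    rw [hlaw]
    simp only [hH]
    rw [integral_const_mul, gauss_law d δ hδ (fun u => ψ (p.2 + σ p.2 u))]
    rfl
  simp_rw [e1]
  rw [integral_map hVm.aemeasurable]
  exact (measurable_fst.mul ((h.Rop_meas δ ψ hψ).comp measurable_snd)).aestronglyMeasurable

structure Chain {Ω : Type} [m0 : MeasurableSpace Ω] (P : Measure Ω) (ℱ : ℝ → MeasurableSpace Ω) {d : ℕ}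
    (σ : Eu d → (Eu d →L[ℝ] Eu d)) (n : ℕ) (X : ℝ → Ω → Eu d) : Prop where
  n1 : 1 ≤ n
  mono : Monotone ℱ
  le : ∀ t, ℱ t ≤ m0
  meas : ∀ t, 0 ≤ t → t ≤ 1 → Measurable[ℱ t] (X t)
  step : ∀ k : ℕ, k < n → ∀ v, 0 < v → v ≤ 1/(n:ℝ) → ∀ Z : Ω → ℝ, Measurable[ℱ ((k:ℝ)/n)] Z →
    ∀ KZ, (∀ ω, |Z ω| ≤ KZ) → ∀ ψ : Eu d → ℝ, Measurable ψ → ∀ K, (∀ x, |ψ x| ≤ K) →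
    ∫ ω, Z ω * ψ (X ((k:ℝ)/n + v) ω) ∂P = ∫ ω, Z ω * Rop σ v ψ (X ((k:ℝ)/n) ω) ∂P

theorem int_diff {Ω : Type} {m0 : MeasurableSpace Ω} (P : Measure Ω) [IsProbabilityMeasure P]
    (Z u w : Ω → ℝ) (hZ : Measurable Z) (hu : Measurable u) (hw : Measurable w) (KZ Ku Kw e : ℝ)
    (h1 : ∀ ω, |Z ω| ≤ KZ) (h2 : ∀ ω, |u ω| ≤ Ku) (h3 : ∀ ω, |w ω| ≤ Kw) (he : ∀ ω, |u ω - w ω| ≤ e) :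
    |(∫ ω, Z ω * u ω ∂P) - ∫ ω, Z ω * w ω ∂P| ≤ e * ∫ ω, |Z ω| ∂P := by
  have iZ : Integrable Z P := Integrable.mono' (integrable_const KZ) hZ.aestronglyMeasurable (ae_of_all _ h1)
  rw [← integral_sub (iZ.mul_bdd hu.aestronglyMeasurable (ae_of_all _ h2))
    (iZ.mul_bdd hw.aestronglyMeasurable (ae_of_all _ h3)), ← integral_const_mul, ← Real.norm_eq_abs]
  refine norm_integral_le_of_norm_le (iZ.abs.const_mul e) (ae_of_all _ fun ω => ?_)
  rw [← mul_sub, norm_mul, mul_comm]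
  exact mul_le_mul_of_nonneg_right (he ω) (abs_nonneg _)

theorem c_sum : ∃ S : ℝ, 0 ≤ S ∧ ∀ m : ℕ, ∑ j ∈ Finset.range m, Real.sqrt j / (j:ℝ)^2 ≤ S := by
  have hs : Summable (fun j : ℕ => Real.sqrt j / (j:ℝ)^2) := by
    refine (Real.summable_nat_rpow.2 (by norm_num : (-(3/2):ℝ) < -1)).congr fun j => ?_
    rcases Nat.eq_zero_or_pos j with rfl | hj
    · simp
    · have : (0:ℝ) < j := by exact_mod_cast hj
      rw [Real.sqrt_eq_rpow, ← Real.rpow_natCast (j:ℝ) 2, ← Real.rpow_sub this]; norm_num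
  exact ⟨_, tsum_nonneg fun j => by positivity, fun m => hs.sum_le_tsum _ (fun j _ => by positivity)⟩

theorem cond_exists (d : ℕ) (l C : ℝ) : ∃ K, 0 ≤ K ∧ ∀ {Ω : Type} [m0 : MeasurableSpace Ω] (P : Measure Ω)
    [IsProbabilityMeasure P] (ℱ : ℝ → MeasurableSpace Ω)
    (σ σi : Eu d → (Eu d →L[ℝ] Eu d)) (n : ℕ) (X : ℝ → Ω → Eu d), Sg d l C σ σi → Chain P ℱ σ n X →
    ∀ (i k : ℕ), i < k → k < n → ∀ v, 0 < v → v ≤ 1/(n:ℝ) → ∀ Z : Ω → ℝ, Measurable[ℱ ((i:ℝ)/n)] Z →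
    ∀ KZ, (∀ ω, |Z ω| ≤ KZ) → ∀ f : Eu d → ℝ, Measurable f → ∀ Cf, (∀ x, |f x| ≤ Cf) →
    |(∫ ω, Z ω * f (X ((k:ℝ)/n + v) ω) ∂P) - ∫ ω, Z ω * f (X ((k:ℝ)/n) ω) ∂P|
      ≤ K * (1/((k:ℝ)-i) + Real.sqrt (1/(n:ℝ))) * Cf * ∫ ω, |Z ω| ∂P := by
  obtain ⟨k0, k0n, H0⟩ := K0 d l C
  obtain ⟨k1, k1n, H1⟩ := K1 d l C
  obtain ⟨k2, k2n, H2⟩ := K2 d l C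
  obtain ⟨k3, k3n, H3⟩ := K3 d l C
  obtain ⟨S, hS, HS⟩ := c_sum
  refine ⟨k0 + 3*k3 + k1*S + k2, by positivity, ?_⟩
  intro Ω m0 P _ ℱ σ σi n X hσ hX i k hik hkn v hv hvn Z hZ KZ hKZ f hf Cf hCf
  have hCf0 : 0 ≤ Cf := (abs_nonneg _).trans (hCf 0)
  have hn : (0:ℝ) < n := by exact_mod_cast hX.n1
  set h := 1/(n:ℝ) with hh
  have hh0 : 0 < h := by positivity
  set E := ∫ ω, |Z ω| ∂P with hE
  have hE0 : 0 ≤ E := integral_nonneg fun _ => abs_nonneg _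
  have hZm : Measurable Z := hZ.mono (hX.le _) le_rfl
  have gridm : ∀ j : ℕ, j ≤ n → Measurable (X ((j:ℝ)/n)) := by
    intro j hj
    refine (hX.meas _ (by positivity) ?_).mono (hX.le _) le_rfl
    rw [div_le_one hn]; exact_mod_cast hj
  have Zj : ∀ j : ℕ, i ≤ j → Measurable[ℱ ((j:ℝ)/n)] Z := fun j hj => hZ.mono (hX.mono (by gcongr)) le_rfl
  have gstep : ∀ j : ℕ, i ≤ j → j < n → ∀ ψ : Eu d → ℝ, Measurable ψ → ∀ K, (∀ x, |ψ x| ≤ K) →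
      ∫ ω, Z ω * ψ (X (((j+1:ℕ):ℝ)/n) ω) ∂P = ∫ ω, Z ω * Rop σ h ψ (X ((j:ℝ)/n) ω) ∂P := by
    intro j hij hj ψ hψ K hK
    have := hX.step j hj h hh0 le_rfl Z (Zj j hij) KZ hKZ ψ hψ K hK
    rwa [show (j:ℝ)/n + h = ((j+1:ℕ):ℝ)/n by rw [hh]; push_cast; ring] at this
  set g : ℝ → Eu d → ℝ := fun τ x => Uop σi (τ+v) f x - Uop σi τ f x with hg
  have gm : ∀ τ, Measurable (g τ) := fun τ => (hσ.Uop_meas _ f hf).sub (hσ.Uop_meas _ f hf)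
  have gb : ∀ τ, h ≤ τ → ∀ x, |g τ x| ≤ k2*(v/τ)*Cf := fun τ hτ x =>
    H2 σ σi hσ f hf Cf hCf τ v (by linarith) hv.le (by linarith) x
  obtain ⟨k', rfl⟩ : ∃ k', k = k'+1 := ⟨k-1, by omega⟩
  -- start
  have st1 : ∫ ω, Z ω * f (X (((k'+1:ℕ):ℝ)/n + v) ω) ∂P = ∫ ω, Z ω * Rop σ h (Rop σ v f) (X ((k':ℝ)/n) ω) ∂P := by
    rw [hX.step (k'+1) hkn v hv hvn Z (Zj _ hik.le) KZ hKZ f hf Cf hCf]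
    exact gstep k' (by omega) (by omega) (Rop σ v f) (hσ.Rop_meas v f hf) Cf (fun x => Sg.Rop_bdd v hv f Cf hCf x)
  have st2 := gstep k' (by omega) (by omega) f hf Cf hCf
  have hXk := gridm k' (by omega)
  have iZ : Integrable Z P := Integrable.mono' (integrable_const KZ) hZm.aestronglyMeasurable (ae_of_all _ hKZ)
  have hRR : ∀ x, |Rop σ h (Rop σ v f) x| ≤ Cf := fun x => Sg.Rop_bdd h hh0 _ Cf (fun x => Sg.Rop_bdd v hv f Cf hCf x) x
  have hR : ∀ x, |Rop σ h f x| ≤ Cf := fun x => Sg.Rop_bdd h hh0 f Cf hCf x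
  have mRR := hσ.Rop_meas h _ (hσ.Rop_meas v f hf)
  have mR := hσ.Rop_meas h f hf
  have sq2 : Real.sqrt (v+h) ≤ 2*Real.sqrt h := by
    rw [show 2*Real.sqrt h = Real.sqrt (4*h) by
      rw [Real.sqrt_mul (by norm_num), show (4:ℝ) = 2^2 by norm_num, Real.sqrt_sq (by norm_num)]]
    exact Real.sqrt_le_sqrt (by linarith)
  have st3 : |((∫ ω, Z ω * f (X (((k'+1:ℕ):ℝ)/n + v) ω) ∂P) - ∫ ω, Z ω * f (X (((k'+1:ℕ):ℝ)/n) ω) ∂P)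
      - ∫ ω, Z ω * g h (X ((k':ℝ)/n) ω) ∂P| ≤ (k0+3*k3)*Real.sqrt h*Cf * E := by
    have i1 : Integrable (fun ω => Z ω * Rop σ h (Rop σ v f) (X ((k':ℝ)/n) ω)) P :=
      iZ.mul_bdd (mRR.comp hXk).aestronglyMeasurable (ae_of_all _ fun ω => hRR _)
    have i2 : Integrable (fun ω => Z ω * Rop σ h f (X ((k':ℝ)/n) ω)) P :=
      iZ.mul_bdd (mR.comp hXk).aestronglyMeasurable (ae_of_all _ fun ω => hR _)
    rw [st1, st2, ← integral_sub i1 i2]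
    simp_rw [← mul_sub]
    refine int_diff P Z (fun ω => Rop σ h (Rop σ v f) (X ((k':ℝ)/n) ω) - Rop σ h f (X ((k':ℝ)/n) ω)) _ hZm ((mRR.comp hXk).sub (mR.comp hXk)) ((gm h).comp hXk) KZ (Cf+Cf) (k2*(v/h)*Cf) _ hKZ
      (fun ω => (abs_sub _ _).trans (add_le_add (hRR _) (hR _))) (fun ω => gb h le_rfl _) fun ω => ?_
    set x := X ((k':ℝ)/n) ω
    have a0 := H0 σ σi hσ f hf Cf hCf h v hh0 hv x
    have a1 := H3 σ σi hσ f hf Cf hCf (v+h) (by linarith) x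
    have a2 := H3 σ σi hσ f hf Cf hCf h hh0 x
    have a3 : k3*Real.sqrt (v+h)*Cf ≤ k3*(2*Real.sqrt h)*Cf := by gcongr
    have e : Rop σ h (Rop σ v f) x - Rop σ h f x - g h x
      = (Rop σ h (Rop σ v f) x - Rop σ (v+h) f x) + (Rop σ (v+h) f x - Uop σi (v+h) f x) - (Rop σ h f x - Uop σi h f x) := by
      simp only [hg]; rw [add_comm h v]; ring
    change |Rop σ h (Rop σ v f) x - Rop σ h f x - g h x| ≤ _
    rw [e]
    have b1 := abs_sub ((Rop σ h (Rop σ v f) x - Rop σ (v+h) f x) + (Rop σ (v+h) f x - Uop σi (v+h) f x)) (Rop σ h f x - Uop σi h f x)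
    have b2 := abs_add_le (Rop σ h (Rop σ v f) x - Rop σ (v+h) f x) (Rop σ (v+h) f x - Uop σi (v+h) f x)
    nlinarith
  -- telescoping
  have tel : ∀ m : ℕ, 1 ≤ m → i + m ≤ k'+1 → |∫ ω, Z ω * g h (X ((k':ℝ)/n) ω) ∂P|
      ≤ |∫ ω, Z ω * g (m*h) (X (((k'+1-m:ℕ):ℝ)/n) ω) ∂P|
        + k1*Real.sqrt h*Cf*(∑ j ∈ Finset.range m, Real.sqrt j / (j:ℝ)^2) * E := by
    intro m hm1
    induction m, hm1 using Nat.le_induction with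
    | base => intro _; simp
    | succ m hm ih =>
      intro hm2
      have ih' := ih (by omega)
      refine ih'.trans ?_
      rw [Finset.sum_range_succ]
      have hm0 : (1:ℝ) ≤ m := by exact_mod_cast hm
      have hτ : h ≤ m*h := by nlinarith
      set q := k'+1-(m+1) with hq
      have hq1 : k'+1-m = q+1 := by omega
      rw [hq1, gstep q (by omega) (by omega) (g (m*h)) (gm _) _ (gb _ hτ)]
      have hXq := gridm q (by omega)
      have hτ' : h ≤ ((m+1:ℕ):ℝ)*h := by push_cast; nlinarith
      have := int_diff P Z _ _ hZm ((hσ.Rop_meas h _ (gm (m*h))).comp hXq) ((gm (((m+1:ℕ):ℝ)*h)).comp hXq) KZ _ _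
        (k1*Real.sqrt h*Cf*(Real.sqrt m/(m:ℝ)^2)) hKZ
        (fun ω => Sg.Rop_bdd h hh0 _ _ (gb _ hτ) _) (fun ω => gb _ hτ' _) (fun ω => by
          have := H1 σ σi hσ f hf Cf hCf h (m*h) v hh0 hτ hv.le (by linarith) (X ((q:ℝ)/n) ω)
          have e : ((m+1:ℕ):ℝ)*h = m*h + h := by push_cast; ring
          simp only [Function.comp, hg, e]
          refine this.trans ?_
          have e2 : Real.sqrt (m*h) / (m*h)^2 = Real.sqrt m * Real.sqrt h / (m^2*h^2) := by
            rw [Real.sqrt_mul (by positivity), mul_pow]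
          rw [e2]
          calc _ ≤ k1*h*h*(Real.sqrt m * Real.sqrt h / (m^2*h^2))*Cf := by gcongr
            _ = _ := by field_simp)
      have h3 := abs_sub_abs_le_abs_sub (∫ ω, Z ω * Rop σ h (g (m*h)) (X ((q:ℝ)/n) ω) ∂P) (∫ ω, Z ω * g (((m+1:ℕ):ℝ)*h) (X ((q:ℝ)/n) ω) ∂P)
      simp only [Function.comp] at this
      nlinarith
  have fin := tel (k'+1-i) (by omega) (by omega)
  set m := k'+1-i with hm
  have hmr : (m:ℝ) = ((k'+1:ℕ):ℝ) - i := by rw [hm, Nat.cast_sub (by omega)]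
  have hm0 : (1:ℝ) ≤ m := by exact_mod_cast (by omega : 1 ≤ m)
  have last : |∫ ω, Z ω * g (m*h) (X (((k'+1-m:ℕ):ℝ)/n) ω) ∂P| ≤ k2*(1/m)*Cf * E := by
    have hXq := gridm (k'+1-m) (by omega)
    have hτ : h ≤ m*h := by nlinarith
    have hb : ∀ x, |g (m*h) x| ≤ k2*(1/m)*Cf := by
      intro x
      refine (gb _ hτ x).trans ?_
      have : v/(m*h) ≤ 1/m := by
        rw [div_le_div_iff₀ (by positivity) (by positivity)]; nlinarith
      gcongr
    have := int_diff P Z _ (fun _ => 0) hZm ((gm (m*h)).comp hXq) measurable_const KZ _ 0 (k2*(1/m)*Cf) hKZ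
      (fun ω => hb _) (fun ω => by simp) (fun ω => by simpa using hb _)
    simpa using this
  have hsum := HS m
  rw [← hmr]
  have hsq := Real.sqrt_nonneg h
  have t1 : k1*Real.sqrt h*Cf*(∑ j ∈ Finset.range m, Real.sqrt j / (j:ℝ)^2) * E ≤ k1*Real.sqrt h*Cf*S*E := by gcongr
  have t2 := abs_sub_abs_le_abs_sub ((∫ ω, Z ω * f (X (((k'+1:ℕ):ℝ)/n + v) ω) ∂P) - ∫ ω, Z ω * f (X (((k'+1:ℕ):ℝ)/n) ω) ∂P) (∫ ω, Z ω * g h (X ((k':ℝ)/n) ω) ∂P)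
  have hm' : 0 < 1/(m:ℝ) := by positivity
  have r1 : 0 ≤ (k0 + 3*k3 + k1*S)*(1/(m:ℝ))*(Cf*E) := by positivity
  have r2 : 0 ≤ k2*Real.sqrt h*(Cf*E) := by positivity
  calc _ ≤ (k0+3*k3)*Real.sqrt h*Cf * E + (k2*(1/m)*Cf * E + k1*Real.sqrt h*Cf*S*E) := by linarith
    _ ≤ _ := by linarith
end EM

namespace EM

/-! ### Part 8: the coefficient field and the chain -/

theorem sg_of {d : ℕ} {lam Cσ : ℝ} (hlam : 0 < lam) (hCσ : 0 ≤ Cσ) (σ : Eu d → (Eu d →L[ℝ] Eu d))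
    (hσ : ContDiff ℝ 2 σ) (hb : ∀ k : ℕ, k ≤ 2 → ∀ x, ‖iteratedFDeriv ℝ k σ x‖ ≤ Cσ)
    (he : ∀ x v, lam * ‖v‖ ^ 2 ≤ ‖(ContinuousLinearMap.adjoint (σ x)) v‖ ^ 2) :
    ∃ σi, Sg d (max 1 (Real.sqrt lam)⁻¹) (max 1 Cσ) σ σi := by
  have hs : 0 < Real.sqrt lam := Real.sqrt_pos.2 hlam
  have he' : ∀ x v, Real.sqrt lam * ‖v‖ ≤ ‖(ContinuousLinearMap.adjoint (σ x)) v‖ := by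
    intro x v
    refine le_of_sq_le_sq ?_ (norm_nonneg _)
    rw [mul_pow, Real.sq_sqrt hlam.le]; exact he x v
  have hA : ∀ x, ∃ Ai : Eu d →L[ℝ] Eu d, (∀ u, Ai (σ x u) = u) ∧ (∀ u, σ x (Ai u) = u) ∧ ‖Ai‖ ≤ (Real.sqrt lam)⁻¹ := by
    intro x
    set T := ContinuousLinearMap.adjoint (σ x) with hT
    have inj : Function.Injective (T : Eu d →ₗ[ℝ] Eu d) := by
      rw [injective_iff_map_eq_zero]
      intro v hv
      have := he' x v
      have hv' : T v = 0 := hv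
      rw [← hT, hv', norm_zero] at this
      have : ‖v‖ ≤ 0 := by by_contra hc; push Not at hc; nlinarith [mul_pos hs hc]
      exact norm_le_zero_iff.1 this
    have eT := LinearEquiv.ofInjectiveEndo (T : Eu d →ₗ[ℝ] Eu d) inj
    set E := (LinearEquiv.ofInjectiveEndo (T : Eu d →ₗ[ℝ] Eu d) inj).toContinuousLinearEquiv with hE
    have hET : ∀ v, E v = T v := fun v => rfl
    set S : Eu d →L[ℝ] Eu d := (E.symm : Eu d →L[ℝ] Eu d) with hS
    have h1 : ∀ v, S (T v) = v := fun v => by rw [← hET]; exact E.symm_apply_apply v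
    have h2 : ∀ v, T (S v) = v := fun v => by rw [← hET]; exact E.apply_symm_apply v
    have hSn : ‖S‖ ≤ (Real.sqrt lam)⁻¹ := by
      refine ContinuousLinearMap.opNorm_le_bound _ (by positivity) fun v => ?_
      have := he' x (S v)
      rw [← hT, h2] at this
      rw [inv_mul_eq_div, le_div_iff₀ hs, mul_comm]; exact this
    have hTa : ContinuousLinearMap.adjoint T = σ x := by rw [hT, ContinuousLinearMap.adjoint_adjoint]
    refine ⟨ContinuousLinearMap.adjoint S, fun u => ?_, fun u => ?_, ?_⟩
    · refine ext_inner_left ℝ fun v => ?_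
      rw [ContinuousLinearMap.adjoint_inner_right, ← hTa, ContinuousLinearMap.adjoint_inner_right, h2]
    · refine ext_inner_left ℝ fun v => ?_
      rw [← hTa, ContinuousLinearMap.adjoint_inner_right, ContinuousLinearMap.adjoint_inner_right, h1]
    · rwa [LinearIsometryEquiv.norm_map]
  choose σi h1 h2 h3 using hA
  refine ⟨σi, ⟨fun x => ⟨h1 x, h2 x, ?_, ?_, le_max_left _ _, le_max_left _ _⟩, ?_⟩⟩
  · have := hb 0 (by norm_num) x
    rw [norm_iteratedFDeriv_zero] at this
    exact this.trans (le_max_right _ _)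
  · exact (h3 x).trans (le_max_right _ _)
  · intro x y
    have hd : ∀ z, ‖fderiv ℝ σ z‖ ≤ max 1 Cσ := fun z => by
      have := hb 1 (by norm_num) z
      rw [norm_iteratedFDeriv_one] at this
      exact this.trans (le_max_right _ _)
    exact Convex.norm_image_sub_le_of_norm_fderiv_le (s := univ)
      (fun z _ => (hσ.differentiable (by norm_num)) z) (fun z _ => hd z) convex_univ (mem_univ y) (mem_univ x)

theorem kappa_cell (n : ℕ) (hn : 1 ≤ n) (k : ℕ) (v : ℝ) (h0 : 0 ≤ v) (h1 : v < 1/(n:ℝ)) :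
    kappa n ((k:ℝ)/n + v) = (k:ℝ)/n := by
  have hn0 : (0:ℝ) < n := by exact_mod_cast hn
  unfold kappa
  have : ⌊(n:ℝ)*((k:ℝ)/n + v)⌋ = (k:ℤ) := by
    rw [Int.floor_eq_iff]
    have e : (n:ℝ)*((k:ℝ)/n + v) = k + n*v := by field_simp
    rw [lt_div_iff₀ hn0] at h1
    rw [e]; push_cast
    constructor <;> nlinarith
  rw [this]; simp

theorem chain_of {Ω : Type} [m0 : MeasurableSpace Ω] (P : Measure Ω) [IsProbabilityMeasure P]
    (ℱ : ℝ → MeasurableSpace Ω) (hmono : Monotone ℱ) (hle : ∀ t, ℱ t ≤ m0) {d : ℕ}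
    (B : ℝ → Ω → Eu d) (hB : IsBrownianMotion P ℱ B) {l C : ℝ}
    {σ σi : Eu d → (Eu d →L[ℝ] Eu d)} (h : Sg d l C σ σi) (y : Eu d) (n : ℕ) (hn : 1 ≤ n)
    (Xb : ℝ → Ω → Eu d) (hX0 : ∀ ω, Xb 0 ω = y)
    (hXg : ∀ j : ℕ, 1 ≤ j → j ≤ n → ∀ ω,
        Xb ((j : ℝ)/n) ω
          = Xb (((j : ℝ) - 1)/n) ω
            + (σ (Xb (((j : ℝ) - 1)/n) ω)) (B ((j : ℝ)/n) ω - B (((j : ℝ) - 1)/n) ω))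
    (hXt : ∀ t : ℝ, 0 ≤ t → t ≤ 1 → ∀ ω,
        Xb t ω = Xb (kappa n t) ω
          + (σ (Xb (kappa n t) ω)) (B t ω - B (kappa n t) ω)) :
    Chain P ℱ σ n Xb ∧ ∀ ω, ∀ k : ℕ, k < n → ∀ v, 0 ≤ v → v ≤ 1/(n:ℝ) →
      Xb ((k:ℝ)/n + v) ω = Xb ((k:ℝ)/n) ω + σ (Xb ((k:ℝ)/n) ω) (B ((k:ℝ)/n+v) ω - B ((k:ℝ)/n) ω) := by
  have hn0 : (0:ℝ) < n := by exact_mod_cast hn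
  have hc : Continuous (fun p : Eu d × Eu d => p.1 + σ p.1 p.2) :=
      continuous_fst.add ((h.cont.comp continuous_fst).clm_apply continuous_snd)
  have ub : ∀ k : ℕ, k < n → ∀ v, v ≤ 1/(n:ℝ) → (k:ℝ)/n + v ≤ 1 := by
    intro k hk v hv
    have : (k:ℝ)/n + 1/n ≤ 1 := by
      rw [← add_div, div_le_one hn0]; exact_mod_cast hk
    linarith
  have key : ∀ ω, ∀ k : ℕ, k < n → ∀ v, 0 ≤ v → v ≤ 1/(n:ℝ) →
      Xb ((k:ℝ)/n + v) ω = Xb ((k:ℝ)/n) ω + σ (Xb ((k:ℝ)/n) ω) (B ((k:ℝ)/n+v) ω - B ((k:ℝ)/n) ω) := by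
    intro ω k hk v hv hv1
    rcases hv1.lt_or_eq with hlt | rfl
    · have := hXt ((k:ℝ)/n+v) (by positivity) (ub k hk v hv1) ω
      rwa [kappa_cell n hn k v hv hlt] at this
    · have := hXg (k+1) (by omega) (by omega) ω
      rwa [show (((k+1:ℕ):ℝ) - 1)/n = (k:ℝ)/n by push_cast; ring,
        show ((k+1:ℕ):ℝ)/n = (k:ℝ)/n + 1/n by push_cast; ring] at this
  have stepm : ∀ k : ℕ, k < n → Measurable[ℱ ((k:ℝ)/n)] (Xb ((k:ℝ)/n)) → ∀ v, 0 ≤ v → v ≤ 1/(n:ℝ) →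
      Measurable[ℱ ((k:ℝ)/n+v)] (Xb ((k:ℝ)/n + v)) := by
    intro k hk hm v hv hv1
    have hle1 : (k:ℝ)/n ≤ (k:ℝ)/n + v := by linarith
    have a1 : Measurable[ℱ ((k:ℝ)/n+v)] (Xb ((k:ℝ)/n)) := hm.mono (hmono hle1) le_rfl
    have a2 : Measurable[ℱ ((k:ℝ)/n+v)] (B ((k:ℝ)/n)) :=
      (hB.adapted _ (by positivity) (hle1.trans (ub k hk v hv1))).mono (hmono hle1) le_rfl
    have a3 : Measurable[ℱ ((k:ℝ)/n+v)] (B ((k:ℝ)/n+v)) := hB.adapted _ (by positivity) (ub k hk v hv1)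
    have e : Xb ((k:ℝ)/n + v) = (fun p : Eu d × Eu d => p.1 + σ p.1 p.2) ∘ fun ω => (Xb ((k:ℝ)/n) ω, B ((k:ℝ)/n+v) ω - B ((k:ℝ)/n) ω) :=
      funext fun ω => key ω k hk v hv hv1
    rw [e]
    exact hc.measurable.comp (a1.prodMk (a3.sub a2))
  have gridm : ∀ k : ℕ, k ≤ n → Measurable[ℱ ((k:ℝ)/n)] (Xb ((k:ℝ)/n)) := by
    intro k
    induction k with
    | zero =>
      intro _
      have : Xb (((0:ℕ):ℝ)/n) = fun _ => y := by funext ω; simp [hX0]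
      rw [this]; exact measurable_const
    | succ k ih =>
      intro hk
      have := stepm k (by omega) (ih (by omega)) (1/n) (by positivity) le_rfl
      rwa [show (k:ℝ)/n + 1/n = ((k+1:ℕ):ℝ)/n by push_cast; ring] at this
  refine ⟨⟨hn, hmono, hle, ?_, ?_⟩, key⟩
  · intro t ht0 ht1
    rcases ht1.lt_or_eq with hlt | rfl
    · have hk : ⌊(n:ℝ)*t⌋₊ < n := by
        rw [Nat.floor_lt (by positivity)]; nlinarith
      have f1 := Nat.floor_le (show 0 ≤ (n:ℝ)*t by positivity)
      have f2 := (Nat.lt_floor_add_one ((n:ℝ)*t)).le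
      set k := ⌊(n:ℝ)*t⌋₊
      have := stepm k hk (gridm k hk.le) (t - (k:ℝ)/n) (by rw [sub_nonneg, div_le_iff₀ hn0]; linarith)
        (by rw [sub_le_iff_le_add, ← add_div, le_div_iff₀ hn0]; linarith)
      rwa [add_sub_cancel] at this
    · have := gridm n le_rfl
      rwa [div_self hn0.ne'] at this
  · intro k hk v hv hv1 Z hZ KZ hKZ ψ hψ K hK
    have hle1 : (k:ℝ)/n ≤ (k:ℝ)/n + v := by linarith
    have hk0 : (0:ℝ) ≤ (k:ℝ)/n := by positivity
    simp_rw [key _ k hk v hv.le hv1]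
    refine markov (ℱ ((k:ℝ)/n)) (hle _) P h (Xb ((k:ℝ)/n)) (fun ω => B ((k:ℝ)/n+v) ω - B ((k:ℝ)/n) ω) (gridm k hk.le) ?_ v hv ?_ ?_ Z hZ KZ hKZ ψ hψ K hK
    · exact ((hB.adapted _ (by positivity) (ub k hk v hv1)).mono (hle _) le_rfl).sub
        ((hB.adapted _ hk0 (hle1.trans (ub k hk v hv1))).mono (hle _) le_rfl)
    · exact hB.indep _ _ hk0 hle1 (ub k hk v hv1)
    · have := hB.law _ _ hk0 hle1 (ub k hk v hv1)
      rwa [add_sub_cancel_left] at this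
end EM

namespace EM

/-! ### Part 9: the block system -/

theorem joint_aux {Ω : Type} [m : MeasurableSpace Ω] {d : ℕ} (u : ℝ → Ω → Eu d) (hc : ∀ ω, Continuous fun r => u r ω)
    (hm : ∀ r, Measurable (u r)) (x : Ω → Eu d) (hx : Measurable x) (f : Eu d → ℝ) (hf : Measurable f) :
    Measurable (fun p : Ω × ℝ => f (u p.2 p.1) - f (x p.1)) := by
  have h1 : Measurable (Function.uncurry u) := measurable_uncurry_of_continuous_of_measurable hc hm
  have h2 : Measurable (fun p : Ω × ℝ => u p.2 p.1) := h1.comp measurable_swap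
  exact (hf.comp h2).sub (hf.comp (hx.comp measurable_fst))

theorem meas_aux {Ω : Type} [m : MeasurableSpace Ω] {d : ℕ} (u : ℝ → Ω → Eu d) (hc : ∀ ω, Continuous fun r => u r ω)
    (hm : ∀ r, Measurable (u r)) (x : Ω → Eu d) (hx : Measurable x) (f : Eu d → ℝ) (hf : Measurable f) (a b : ℝ)
    (hab : a ≤ b) :
    Measurable (fun ω => ∫ r in a..b, (f (u r ω) - f (x ω))) := by
  simp_rw [intervalIntegral.integral_of_le hab]
  have h := (joint_aux u hc hm x hx f hf).stronglyMeasurable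
  exact (h.integral_prod_right (ν := volume.restrict (Ioc a b))).measurable

theorem sum_sqrt (c : ℝ) (i l : ℕ) (hil : i ≤ l) (τ : ℕ → ℝ)
    (h : ∀ k, i ≤ k → k < l → τ k ≤ c * (Real.sqrt (((k-i:ℕ):ℝ)+1) - Real.sqrt ((k-i:ℕ):ℝ))) :
    ∑ k ∈ Finset.Ico i l, τ k ≤ c * Real.sqrt ((l-i:ℕ):ℝ) := by
  calc _ ≤ ∑ k ∈ Finset.Ico i l, c * (Real.sqrt (((k-i:ℕ):ℝ)+1) - Real.sqrt ((k-i:ℕ):ℝ)) := by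
        refine Finset.sum_le_sum fun k hk => ?_
        rw [Finset.mem_Ico] at hk
        exact h k hk.1 hk.2
    _ = c * ∑ j ∈ Finset.range (l-i), (Real.sqrt (((j+1:ℕ):ℝ)) - Real.sqrt (j:ℝ)) := by
        rw [Finset.sum_Ico_eq_sum_range, Finset.mul_sum]
        refine Finset.sum_congr rfl fun j _ => ?_
        rw [Nat.add_sub_cancel_left]; push_cast; rfl
    _ = _ := by rw [Finset.sum_range_sub (fun j : ℕ => Real.sqrt (j:ℝ))]; simp

theorem tau_bound (K : ℝ) (hK : 0 ≤ K) (m n : ℕ) (hm : 1 ≤ m) (hmn : m ≤ n) :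
    K * (1/(m:ℝ) + Real.sqrt (1/(n:ℝ))) / 2 ≤ 4*(1+K) * (Real.sqrt ((m:ℝ)+1) - Real.sqrt (m:ℝ)) := by
  have hm0 : (1:ℝ) ≤ m := by exact_mod_cast hm
  have hmn' : (m:ℝ) ≤ n := by exact_mod_cast hmn
  have hs1 : 1 ≤ Real.sqrt m := by rw [Real.one_le_sqrt]; exact hm0
  have h1 : 1/(m:ℝ) ≤ 1/Real.sqrt m := by
    apply one_div_le_one_div_of_le (by positivity)
    rw [Real.sqrt_le_left (by positivity)]; nlinarith
  have h2 : Real.sqrt (1/(n:ℝ)) ≤ 1/Real.sqrt m := by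
    rw [Real.sqrt_div (by norm_num), Real.sqrt_one]
    apply one_div_le_one_div_of_le (by positivity)
    exact Real.sqrt_le_sqrt hmn'
  have hp : Real.sqrt ((m:ℝ)+1) ≤ 2*Real.sqrt m := by
    rw [Real.sqrt_le_left (by positivity), mul_pow, Real.sq_sqrt (by positivity)]; linarith
  have e1 := Real.sq_sqrt (show (0:ℝ) ≤ m by positivity)
  have e2 := Real.sq_sqrt (show (0:ℝ) ≤ (m:ℝ)+1 by positivity)
  have h3 : 1/Real.sqrt m ≤ 3*(Real.sqrt ((m:ℝ)+1) - Real.sqrt (m:ℝ)) := by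
    rw [div_le_iff₀ (by positivity)]
    set a := Real.sqrt m
    set b := Real.sqrt ((m:ℝ)+1)
    have : (b-a)*(b+a) = 1 := by nlinarith
    have hba : 0 ≤ b - a := by
      by_contra hc; push Not at hc
      have : 0 ≤ b := Real.sqrt_nonneg _
      nlinarith
    nlinarith
  have h4 : 0 ≤ 1/Real.sqrt m := by positivity
  set D := Real.sqrt ((m:ℝ)+1) - Real.sqrt (m:ℝ)
  have : K * (1/(m:ℝ) + Real.sqrt (1/(n:ℝ))) ≤ K*(6*D) := mul_le_mul_of_nonneg_left (by linarith) hK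
  nlinarith

/-- Interpolated chain with clamped time. -/
noncomputable def Xc {Ω : Type} {d : ℕ} (n : ℕ) (X : ℝ → Ω → Eu d) (k : ℕ) (r : ℝ) (ω : Ω) : Eu d :=
  X ((k:ℝ)/n + max 0 (min (r - (k:ℝ)/n) (1/(n:ℝ)))) ω

theorem msys_exists (d : ℕ) (l C : ℝ) : ∃ A, 0 ≤ A ∧ ∀ {Ω : Type} [m0 : MeasurableSpace Ω] (P : Measure Ω)
    [IsProbabilityMeasure P] (ℱ : ℝ → MeasurableSpace Ω)
    (σ σi : Eu d → (Eu d →L[ℝ] Eu d)) (n : ℕ) (X : ℝ → Ω → Eu d), Sg d l C σ σi → Chain P ℱ σ n X →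
    (∀ k : ℕ, k < n → ∀ ω, ContinuousOn (fun v => X ((k:ℝ)/n + v) ω) (Icc 0 (1/(n:ℝ)))) →
    ∀ f : Eu d → ℝ, Measurable f → ∀ Cf, 0 < Cf → (∀ x, |f x| ≤ Cf) →
    ∀ p : ℕ → ℝ, (∀ k, p k ≤ p (k+1)) → (∀ k, p (k+1) - p k ≤ 1/(n:ℝ)) →
    (∀ k, p k = p (k+1) ∨ ((k:ℝ)/n ≤ p k ∧ p (k+1) ≤ (k:ℝ)/n + 1/n)) →
    MSys P (fun k => ℱ ((k:ℝ)/n))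
      (fun k ω => (n/(2*Cf)) * ∫ r in p k..p (k+1), (f (Xc n X k r ω) - f (X ((k:ℝ)/n) ω))) A n := by
  obtain ⟨K, hK, HK⟩ := cond_exists d l C
  refine ⟨4*(1+K), by positivity, ?_⟩
  intro Ω m0 P _ ℱ σ σi n X hσ hX hcont f hf Cf hCf hfb p pm pn pc
  have hn : (0:ℝ) < n := by exact_mod_cast hX.n1
  have clamp1 : ∀ x : ℝ, max 0 (min x (1/(n:ℝ))) ∈ Icc (0:ℝ) (1/(n:ℝ)) := fun x =>
    ⟨le_max_left _ _, max_le (by positivity) (min_le_right _ _)⟩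
  have ub : ∀ k : ℕ, k < n → ∀ v, v ≤ 1/(n:ℝ) → (k:ℝ)/n + v ≤ 1 := by
    intro k hk v hv
    have : (k:ℝ)/n + 1/n ≤ 1 := by
      rw [← add_div, div_le_one hn]; exact_mod_cast hk
    linarith
  have cc : ∀ k : ℕ, k < n → ∀ ω, Continuous fun r => Xc n X k r ω := by
    intro k hk ω
    exact (hcont k hk ω).comp_continuous (f := fun r => max 0 (min (r - (k:ℝ)/n) (1/(n:ℝ)))) (by fun_prop) (fun r => clamp1 _)
  have cm : ∀ k : ℕ, k < n → ∀ r, Measurable[ℱ (((k+1:ℕ):ℝ)/n)] (Xc n X k r) := by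
    intro k hk r
    have := clamp1 (r - (k:ℝ)/n)
    refine (hX.meas _ (add_nonneg (by positivity) this.1) (ub k hk _ this.2)).mono (hX.mono ?_) le_rfl
    have := this.2
    push_cast
    rw [add_div]; linarith
  have gm : ∀ k : ℕ, k < n → Measurable[ℱ ((k:ℝ)/n)] (X ((k:ℝ)/n)) := fun k hk =>
    hX.meas _ (by positivity) (by simpa using ub k hk 0 (by positivity))
  have wb : ∀ k r ω, |f (Xc n X k r ω) - f (X ((k:ℝ)/n) ω)| ≤ 2*Cf := fun k r ω =>
    (abs_sub _ _).trans (by linarith [hfb (Xc n X k r ω), hfb (X ((k:ℝ)/n) ω)])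
  have Gm : Monotone (fun k : ℕ => ℱ ((k:ℝ)/n)) := fun a b hab => hX.mono (by gcongr)
  have Ym : ∀ k, k < n → Measurable[ℱ (((k+1:ℕ):ℝ)/n)] (fun ω => ((n:ℝ)/(2*Cf)) * ∫ r in p k..p (k+1), (f (Xc n X k r ω) - f (X ((k:ℝ)/n) ω))) := by
    intro k hk
    have := @meas_aux Ω (ℱ (((k+1:ℕ):ℝ)/n)) d (Xc n X k) (cc k hk) (cm k hk) (X ((k:ℝ)/n)) ((gm k hk).mono (Gm (Nat.le_succ k)) le_rfl) f hf _ _ (pm k)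
    exact this.const_mul _
  have Yb : ∀ k ω, |((n:ℝ)/(2*Cf)) * ∫ r in p k..p (k+1), (f (Xc n X k r ω) - f (X ((k:ℝ)/n) ω))| ≤ 1 := by
    intro k ω
    have h1 := intervalIntegral.norm_integral_le_of_norm_le_const (a := p k) (b := p (k+1)) (C := 2*Cf) (f := fun r => f (Xc n X k r ω) - f (X ((k:ℝ)/n) ω)) (fun r _ => wb k r ω)
    rw [Real.norm_eq_abs, abs_of_nonneg (sub_nonneg.2 (pm k))] at h1
    rw [abs_mul, abs_of_pos (by positivity)]
    calc _ ≤ (n:ℝ)/(2*Cf) * (2*Cf*(1/n)) := by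
          refine mul_le_mul_of_nonneg_left (h1.trans ?_) (by positivity)
          exact mul_le_mul_of_nonneg_left (pn k) (by positivity)
      _ = 1 := by field_simp
  refine ⟨Gm, fun k => hX.le _, Ym, Yb, ?_⟩
  intro i L hiL hLn Z hZ hZb
  obtain ⟨KZ, hKZ⟩ := hZb
  have hZm : Measurable Z := hZ.mono (hX.le _) le_rfl
  have iZ : Integrable Z P := int_of_bdd P hZm ⟨KZ, hKZ⟩
  set E := ∫ ω, |Z ω| ∂P with hE
  have hE0 : 0 ≤ E := integral_nonneg fun _ => abs_nonneg _
  set Y : ℕ → Ω → ℝ := fun k ω => ((n:ℝ)/(2*Cf)) * ∫ r in p k..p (k+1), (f (Xc n X k r ω) - f (X ((k:ℝ)/n) ω)) with hY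
  have iY : ∀ k, k < n → Integrable (fun ω => Z ω * Y k ω) P := fun k hk =>
    iZ.mul_bdd ((Ym k hk).mono (hX.le _) le_rfl).aestronglyMeasurable (ae_of_all _ fun ω => Yb k ω)
  -- single term
  have tm : ∀ k, i ≤ k → k < L → |∫ ω, Z ω * Y k ω ∂P| ≤ (4*(1+K) * (Real.sqrt (((k-i:ℕ):ℝ)+1) - Real.sqrt ((k-i:ℕ):ℝ))) * E := by
    intro k hik hkL
    have hkn : k < n := by omega
    rcases hik.eq_or_lt with rfl | hlt
    · have : |∫ ω, Z ω * Y i ω ∂P| ≤ E := by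
        rw [← Real.norm_eq_abs]
        refine norm_integral_le_of_norm_le iZ.abs (ae_of_all _ fun ω => ?_)
        rw [norm_mul]
        calc _ ≤ |Z ω| * 1 := mul_le_mul_of_nonneg_left (Yb i ω) (abs_nonneg _)
          _ = _ := mul_one _
      refine this.trans ?_
      simp only [Nat.sub_self, Nat.cast_zero, zero_add, Real.sqrt_one, Real.sqrt_zero, sub_zero]
      nlinarith [mul_nonneg hK hE0]
    · set m := k - i with hm
      have hmr : (m:ℝ) = (k:ℝ) - i := by rw [hm, Nat.cast_sub hik]
      refine le_trans ?_ (mul_le_mul_of_nonneg_right (tau_bound K hK m n (by omega) (by omega)) hE0)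
      set c := K * (1/(m:ℝ) + Real.sqrt (1/(n:ℝ))) with hc
      have hc0 : 0 ≤ c := by positivity
      rcases pc k with hp | ⟨hp1, hp2⟩
      · have : ∀ ω, Y k ω = 0 := fun ω => by simp [hY, hp]
        simp only [this, mul_zero, integral_zero, abs_zero]; positivity
      · have e1 : ∀ ω, Z ω * Y k ω = ((n:ℝ)/(2*Cf)) * ∫ r in Ioc (p k) (p (k+1)), Z ω * (f (Xc n X k r ω) - f (X ((k:ℝ)/n) ω)) := by
          intro ω
          simp only [hY]
          rw [intervalIntegral.integral_of_le (pm k), integral_const_mul]; ring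
        simp_rw [e1]
        have cm' : ∀ r, Measurable (Xc n X k r) := fun r => (cm k hkn r).mono (hX.le _) le_rfl
        have gm' : Measurable (X ((k:ℝ)/n)) := (gm k hkn).mono (hX.le _) le_rfl
        have jm := joint_aux (Xc n X k) (cc k hkn) cm' (X ((k:ℝ)/n)) gm' f hf
        have jm2 : Measurable (fun q : Ω × ℝ => Z q.1 * (f (Xc n X k q.2 q.1) - f (X ((k:ℝ)/n) q.1))) :=
          (hZm.comp measurable_fst).mul jm
        have jI : Integrable (Function.uncurry fun (ω : Ω) (r : ℝ) => Z ω * (f (Xc n X k r ω) - f (X ((k:ℝ)/n) ω))) (P.prod (volume.restrict (Ioc (p k) (p (k+1))))) := by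
          refine Integrable.of_bound jm2.aestronglyMeasurable (KZ*(2*Cf)) (ae_of_all _ fun q => ?_)
          rw [Function.uncurry, norm_mul]
          exact mul_le_mul (hKZ _) (wb _ _ _) (norm_nonneg _) ((abs_nonneg _).trans (hKZ q.1))
        rw [integral_const_mul, integral_integral_swap jI, abs_mul, abs_of_pos (by positivity)]
        have inner : ∀ r ∈ Ioc (p k) (p (k+1)), ‖∫ ω, Z ω * (f (Xc n X k r ω) - f (X ((k:ℝ)/n) ω)) ∂P‖ ≤ c*Cf*E := by
          intro r hr
          have hv0 : 0 < r - (k:ℝ)/n := by linarith [hr.1]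
          have hv1 : r - (k:ℝ)/n ≤ 1/n := by linarith [hr.2]
          have hcl : max 0 (min (r - (k:ℝ)/n) (1/(n:ℝ))) = r - (k:ℝ)/n := by
            rw [min_eq_left hv1, max_eq_right hv0.le]
          have hX' : ∀ ω, Xc n X k r ω = X ((k:ℝ)/n + (r - (k:ℝ)/n)) ω := fun ω => by rw [Xc, hcl]
          have := HK P ℱ σ σi n X hσ hX i k hlt hkn _ hv0 hv1 Z hZ KZ hKZ f hf Cf hfb
          rw [← hmr] at this
          simp_rw [← hX'] at this
          have i1 : Integrable (fun ω => Z ω * f (Xc n X k r ω)) P :=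
            iZ.mul_bdd (hf.comp (cm' r)).aestronglyMeasurable (ae_of_all _ fun ω => hfb _)
          have i2 : Integrable (fun ω => Z ω * f (X ((k:ℝ)/n) ω)) P :=
            iZ.mul_bdd (hf.comp gm').aestronglyMeasurable (ae_of_all _ fun ω => hfb _)
          rw [← integral_sub i1 i2] at this
          simp_rw [← mul_sub] at this
          exact this
        have h2 := norm_setIntegral_le_of_norm_le_const (μ := volume) (s := Ioc (p k) (p (k+1))) (by simp) inner
        rw [measureReal_def, Real.volume_Ioc, ENNReal.toReal_ofReal (sub_nonneg.2 (pm k))] at h2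
        calc _ ≤ (n:ℝ)/(2*Cf) * (c*Cf*E*(1/n)) := by
              refine mul_le_mul_of_nonneg_left (h2.trans ?_) (by positivity)
              exact mul_le_mul_of_nonneg_left (pn k) (by positivity)
          _ = c/2*E := by field_simp
  simp_rw [Finset.mul_sum]
  rw [integral_finset_sum _ (fun k hk => iY k (by rw [Finset.mem_Ico] at hk; omega))]
  refine (Finset.abs_sum_le_sum_abs _ _).trans ?_
  refine (Finset.sum_le_sum (fun k hk => tm k (Finset.mem_Ico.1 hk).1 (Finset.mem_Ico.1 hk).2)).trans ?_
  rw [← Finset.sum_mul]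
  refine mul_le_mul_of_nonneg_right ?_ hE0
  exact sum_sqrt (4*(1+K)) i L hiL _ (fun k _ _ => le_rfl)
end EM

namespace EM

/-! ### Part 10: moments and the final estimate -/

theorem lp_triv {Ω : Type} [MeasurableSpace Ω] (P : Measure Ω) [IsProbabilityMeasure P] (p : ℝ) (hp : 0 < p)
    (S : Ω → ℝ) (M : ℝ) (hM : 0 ≤ M) (h : ∀ ω, |S ω| ≤ M) : lpNorm P p S ≤ M := by
  unfold _root_.lpNorm
  have h1 : ∫ ω, ‖S ω‖ ^ p ∂P ≤ M ^ p := by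
    calc _ ≤ ∫ _, M ^ p ∂P := integral_mono_of_nonneg (ae_of_all _ fun ω => by positivity) (integrable_const _)
          (ae_of_all _ fun ω => Real.rpow_le_rpow (norm_nonneg _) (h ω) hp.le)
      _ = _ := by simp
  calc _ ≤ (M^p)^(1/p) := Real.rpow_le_rpow (integral_nonneg fun ω => by positivity) h1 (by positivity)
    _ = M := by rw [← Real.rpow_mul hM, mul_one_div_cancel hp.ne', Real.rpow_one]

theorem lp_moment {Ω : Type} [MeasurableSpace Ω] (P : Measure Ω) [IsProbabilityMeasure P] (p : ℝ) (hp : 0 < p)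
    (q : ℕ) (hq : p ≤ 2*q)
    (S : Ω → ℝ) (hS : Measurable S) (hb : ∃ b, ∀ ω, |S ω| ≤ b) (c M : ℝ) (hc : 0 ≤ c) (hM : 0 < M)
    (h : ∫ ω, (S ω)^(2*q) ∂P ≤ M^(2*q)) : lpNorm P p (fun ω => c * S ω) ≤ 2^(1/p) * (c * M) := by
  unfold _root_.lpNorm
  obtain ⟨b, hb⟩ := hb
  have i1 : Integrable (fun ω => (S ω)^(2*q)) P :=
    int_of_bdd P (hS.pow_const _) ⟨b^(2*q), fun ω => by rw [abs_pow]; exact pow_le_pow_left₀ (abs_nonneg _) (hb ω) _⟩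
  have hx : ∀ x : ℝ, 0 ≤ x → x^p ≤ 1 + x^(2*q) := by
    intro x hx
    rcases le_total x 1 with h1 | h1
    · have := Real.rpow_le_one hx h1 hp.le
      have : 0 ≤ x^(2*q) := by positivity
      linarith
    · have := Real.rpow_le_rpow_of_exponent_le h1 hq
      rw [show (2*(q:ℝ)) = ((2*q:ℕ):ℝ) by push_cast; rfl, Real.rpow_natCast] at this
      linarith
  have hpt : ∀ ω, ‖c * S ω‖^p ≤ (c*M)^p * (1 + (S ω)^(2*q)/M^(2*q)) := by
    intro ω
    have e : ‖c * S ω‖ = (c*M) * (|S ω|/M) := by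
      rw [norm_mul, Real.norm_eq_abs, Real.norm_eq_abs, abs_of_nonneg hc]; field_simp
    rw [e, Real.mul_rpow (by positivity) (by positivity)]
    refine mul_le_mul_of_nonneg_left ((hx _ (by positivity)).trans (le_of_eq ?_)) (by positivity)
    rw [div_pow, Even.pow_abs (even_two_mul q)]
  have h1 : ∫ ω, ‖c * S ω‖ ^ p ∂P ≤ 2 * (c*M) ^ p := by
    calc _ ≤ ∫ ω, (c*M)^p * (1 + (S ω)^(2*q)/M^(2*q)) ∂P := integral_mono_of_nonneg (ae_of_all _ fun ω => by positivity)
            (((integrable_const 1).add (i1.div_const _)).const_mul _) (ae_of_all _ hpt)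
      _ = (c*M)^p * (1 + (∫ ω, (S ω)^(2*q) ∂P) / M^(2*q)) := by
          rw [integral_const_mul, integral_add (integrable_const 1) (i1.div_const _), integral_div]; simp
      _ ≤ (c*M)^p * (1+1) := by
          have : (∫ ω, (S ω)^(2*q) ∂P) / M^(2*q) ≤ 1 := by rw [div_le_one (by positivity)]; exact h
          gcongr
      _ = _ := by ring
  calc _ ≤ (2*(c*M)^p)^(1/p) := Real.rpow_le_rpow (integral_nonneg fun ω => by positivity) h1 (by positivity)
    _ = _ := by
      rw [Real.mul_rpow (by norm_num) (by positivity), ← Real.rpow_mul (by positivity), mul_one_div_cancel hp.ne', Real.rpow_one]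

theorem pp_props (s t x h : ℝ) (hst : s ≤ t) (hh : 0 < h) :
    max s (min t x) ≤ max s (min t (x+h)) ∧ max s (min t (x+h)) - max s (min t x) ≤ h ∧
    (max s (min t x) = max s (min t (x+h)) ∨ (x ≤ max s (min t x) ∧ max s (min t (x+h)) ≤ x+h)) := by
  refine ⟨max_le_max le_rfl (min_le_min le_rfl (by linarith)), ?_, ?_⟩
  · rw [sub_le_iff_le_add]
    refine max_le (by linarith [le_max_left s (min t x)]) ?_
    have : min t (x+h) ≤ h + min t x := by
      rcases le_total t x with h1 | h1
      · rw [min_eq_left h1]; linarith [min_le_left t (x+h)]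
      · rw [min_eq_right h1]; linarith [min_le_right t (x+h)]
    linarith [le_max_right s (min t x)]
  · by_cases h1 : x + h ≤ s
    · left
      rw [max_eq_left ((min_le_right _ _).trans h1), max_eq_left ((min_le_right _ _).trans (by linarith))]
    · by_cases h2 : t ≤ x
      · left; rw [min_eq_left h2, min_eq_left (by linarith)]
      · right
        push Not at h1 h2
        exact ⟨by rw [min_eq_right h2.le]; exact le_max_right _ _, max_le h1.le (min_le_right _ _)⟩

theorem exists_L (K : ℕ) (hK : 1 ≤ K) : ∃ L, K ≤ 2^L ∧ 2^L ≤ 2*K := by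
  rcases hK.eq_or_lt with rfl | h
  · exact ⟨0, by norm_num⟩
  · refine ⟨Nat.clog 2 K, Nat.le_pow_clog (by norm_num) K, ?_⟩
    have := Nat.pow_pred_clog_lt_self (b := 2) (by norm_num) h
    have hc := Nat.clog_pos (b := 2) (by norm_num) h
    obtain ⟨c, hc'⟩ : ∃ c, Nat.clog 2 K = c+1 := ⟨Nat.clog 2 K - 1, by omega⟩
    rw [hc'] at this ⊢
    simp only [Nat.pred_eq_sub_one, Nat.add_sub_cancel] at this
    rw [pow_succ]; omega

/-- The integral over one cell. -/
theorem cell_int {Ω : Type} {d : ℕ} (n : ℕ) (hn : 1 ≤ n) (X : ℝ → Ω → Eu d) (f : Eu d → ℝ) (hf : Measurable f) (Cf : ℝ)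
    (hfb : ∀ x, |f x| ≤ Cf) (k : ℕ) (ω : Ω) (hc : ContinuousOn (fun v => X ((k:ℝ)/n + v) ω) (Icc 0 (1/(n:ℝ)))) (a b : ℝ)
    (hab : a ≤ b) (h : a = b ∨ ((k:ℝ)/n ≤ a ∧ b ≤ (k:ℝ)/n + 1/n)) :
    IntervalIntegrable (fun r => f (X r ω) - f (X (kappa n r) ω)) volume a b ∧
    ∫ r in a..b, (f (X r ω) - f (X (kappa n r) ω)) = ∫ r in a..b, (f (Xc n X k r ω) - f (X ((k:ℝ)/n) ω)) := by
  rcases h with rfl | ⟨h1, h2⟩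
  · simp
  have hn0 : (0:ℝ) < n := by exact_mod_cast hn
  have cc : Continuous fun r => Xc n X k r ω :=
    hc.comp_continuous (f := fun r => max 0 (min (r - (k:ℝ)/n) (1/(n:ℝ)))) (by fun_prop) (fun r =>
      ⟨le_max_left _ _, max_le (by positivity) (min_le_right _ _)⟩)
  have hae : ∀ᵐ r ∂volume, r ∈ uIoc a b → f (Xc n X k r ω) - f (X ((k:ℝ)/n) ω) = f (X r ω) - f (X (kappa n r) ω) := by
    filter_upwards [Measure.ae_ne volume b] with r hr hrI
    rw [uIoc_of_le hab] at hrI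
    have hlt : r < b := lt_of_le_of_ne hrI.2 hr
    have hv0 : 0 < r - (k:ℝ)/n := by linarith [hrI.1]
    have hv1 : r - (k:ℝ)/n < 1/n := by linarith
    have e1 : kappa n r = (k:ℝ)/n := by
      have := kappa_cell n hn k (r - (k:ℝ)/n) hv0.le hv1
      rwa [add_sub_cancel] at this
    have e2 : Xc n X k r ω = X r ω := by
      rw [Xc, min_eq_left hv1.le, max_eq_right hv0.le, add_sub_cancel]
    rw [e1, e2]
  have ii : IntervalIntegrable (fun r => f (Xc n X k r ω) - f (X ((k:ℝ)/n) ω)) volume a b := by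
    rw [intervalIntegrable_iff]
    refine Measure.integrableOn_of_bounded (M := 2*Cf) (by simp [uIoc_of_le hab]) ((hf.comp cc.measurable).sub_const _).aestronglyMeasurable (ae_of_all _ fun r => ?_)
    exact (abs_sub _ _).trans (by linarith [hfb (Xc n X k r ω), hfb (X ((k:ℝ)/n) ω)])
  refine ⟨ii.congr_ae ?_, (intervalIntegral.integral_congr_ae hae).symm⟩
  exact (ae_restrict_iff' measurableSet_uIoc).2 hae

theorem final_bound (d : ℕ) (l C ε p : ℝ) (hε : 0 < ε) (hε1 : ε < 1/2) (hp : 0 < p) : ∃ N, 0 < N ∧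
    ∀ {Ω : Type} [m0 : MeasurableSpace Ω] (P : Measure Ω)
    [IsProbabilityMeasure P] (ℱ : ℝ → MeasurableSpace Ω)
    (σ σi : Eu d → (Eu d →L[ℝ] Eu d)) (n : ℕ) (X : ℝ → Ω → Eu d), Sg d l C σ σi → Chain P ℱ σ n X →
    (∀ k : ℕ, k < n → ∀ ω, ContinuousOn (fun v => X ((k:ℝ)/n + v) ω) (Icc 0 (1/(n:ℝ)))) →
    ∀ f : Eu d → ℝ, Measurable f → ∀ Cf, 0 ≤ Cf → (∀ x, |f x| ≤ Cf) → ∀ s t : ℝ, 0 ≤ s → s ≤ t → t ≤ 1 →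
    lpNorm P p (fun ω => ∫ r in s..t, (f (X r ω) - f (X (kappa n r) ω)))
          ≤ N * Cf * (n : ℝ) ^ (-(1 : ℝ)/2 + 2*ε) * (t - s) ^ ((1 : ℝ)/2 + ε) := by
  obtain ⟨A, hA, HA⟩ := msys_exists d l C
  obtain ⟨q, hq⟩ : ∃ q : ℕ, p ≤ 2*q := by
    obtain ⟨q, hq⟩ := exists_nat_ge p
    exact ⟨q, by linarith⟩
  have hq1 : 1 ≤ q := by
    rcases Nat.eq_zero_or_pos q with rfl | h
    · norm_num at hq; linarith
    · exact h
  set ρ : ℝ := 2^(1+2*ε) with hρ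
  have hρ2 : 2 < ρ := by
    calc (2:ℝ) = 2^(1:ℝ) := (Real.rpow_one 2).symm
      _ < ρ := Real.rpow_lt_rpow_of_exponent_lt (by norm_num) (by linarith)
  obtain ⟨D, hD, HD⟩ := mbound_exists ρ A hρ2 hA q
  set D' := max 1 D with hD'
  have hD1 : 1 ≤ D' := le_max_left _ _
  set N := 2 + 2^(1/p) * 2 * D' * 6^(1/2+ε) with hN
  refine ⟨N, by positivity, ?_⟩
  intro Ω m0 P _ ℱ σ σi n X hσ hX hcont f hf Cf hCf hfb s t hs hst ht
  have hn : (1:ℝ) ≤ n := by exact_mod_cast hX.n1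
  have hn0 : (0:ℝ) < n := by linarith
  have hts : 0 ≤ t - s := by linarith
  have Fb : ∀ ω r, |f (X r ω) - f (X (kappa n r) ω)| ≤ 2*Cf := fun ω r =>
    (abs_sub _ _).trans (by linarith [hfb (X r ω), hfb (X (kappa n r) ω)])
  have triv : lpNorm P p (fun ω => ∫ r in s..t, (f (X r ω) - f (X (kappa n r) ω))) ≤ 2*Cf*(t-s) := by
    refine lp_triv P p hp _ _ (by positivity) fun ω => ?_
    have := intervalIntegral.norm_integral_le_of_norm_le_const (a := s) (b := t) (C := 2*Cf)
      (f := fun r => f (X r ω) - f (X (kappa n r) ω)) (fun r _ => Fb ω r)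
    rwa [abs_of_nonneg hts] at this
  rcases hCf.eq_or_lt with h0 | hCf0
  · rw [← h0] at triv ⊢
    simpa using triv
  have hexp : (n:ℝ)^(-(1:ℝ)/2+ε) ≤ (n:ℝ)^(-(1:ℝ)/2+2*ε) := Real.rpow_le_rpow_of_exponent_le hn (by linarith)
  have hN2 : 2 ≤ N := by rw [hN]; have : 0 ≤ (2:ℝ)^(1/p) * 2 * D' * 6^(1/2+ε) := by positivity
                         linarith
  have hN3 : 2^(1/p) * 2 * D' * 6^(1/2+ε) ≤ N := by rw [hN]; linarith
  by_cases hcase : n*(t-s) < 1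
  · refine triv.trans ?_
    rcases hts.eq_or_lt with h0 | hpos
    · rw [← h0]; simp only [mul_zero]; positivity
    have e1 : (t-s) = (t-s)^((1:ℝ)/2-ε) * (t-s)^((1:ℝ)/2+ε) := by
      rw [← Real.rpow_add hpos, show (1:ℝ)/2-ε + (1/2+ε) = 1 by ring, Real.rpow_one]
    have e2 : (t-s)^((1:ℝ)/2-ε) ≤ (n:ℝ)^(-(1:ℝ)/2+ε) := by
      rw [show -(1:ℝ)/2+ε = -((1:ℝ)/2-ε) by ring, Real.rpow_neg hn0.le, ← Real.inv_rpow hn0.le]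
      refine Real.rpow_le_rpow hts ?_ (by linarith)
      rw [inv_eq_one_div, le_div_iff₀ hn0]; linarith
    calc 2*Cf*(t-s) = 2*Cf*(t-s)^((1:ℝ)/2-ε) * (t-s)^((1:ℝ)/2+ε) := by rw [mul_assoc (2*Cf), ← e1]
      _ ≤ N*Cf*(n:ℝ)^(-(1:ℝ)/2+2*ε) * (t-s)^((1:ℝ)/2+ε) := by
        have := e2.trans hexp
        gcongr
  push Not at hcase
  have hpos : 0 < t - s := by
    by_contra hc
    have : t - s = 0 := le_antisymm (not_lt.1 hc) hts
    rw [this] at hcase; norm_num at hcase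
  set pp : ℕ → ℝ := fun k => max s (min t ((k:ℝ)/n)) with hpp
  have ek : ∀ k : ℕ, ((k+1:ℕ):ℝ)/n = (k:ℝ)/n + 1/n := fun k => by push_cast; ring
  have hpr : ∀ k : ℕ, pp k ≤ pp (k+1) ∧ pp (k+1) - pp k ≤ 1/(n:ℝ) ∧
    (pp k = pp (k+1) ∨ ((k:ℝ)/n ≤ pp k ∧ pp (k+1) ≤ (k:ℝ)/n + 1/n)) := by
    intro k
    have := pp_props s t ((k:ℝ)/n) (1/n) hst (by positivity)
    simp only [hpp]
    rwa [ek]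
  have sys := HA P ℱ σ σi n X hσ hX hcont f hf Cf hCf0 hfb pp (fun k => (hpr k).1) (fun k => (hpr k).2.1) (fun k => (hpr k).2.2)
  set Y : ℕ → Ω → ℝ := fun k ω => ((n:ℝ)/(2*Cf)) * ∫ r in pp k..pp (k+1), (f (Xc n X k r ω) - f (X ((k:ℝ)/n) ω)) with hY
  set a := ⌊(n:ℝ)*s⌋₊ with ha
  set b := ⌈(n:ℝ)*t⌉₊ with hb
  have ha1 : (a:ℝ) ≤ n*s := Nat.floor_le (by positivity)
  have ha2 : (n:ℝ)*s < a+1 := Nat.lt_floor_add_one _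
  have hb1 : (n:ℝ)*t ≤ b := Nat.le_ceil _
  have hb2 : (b:ℝ) < n*t+1 := Nat.ceil_lt_add_one (by have : 0 ≤ t := by linarith
                                                      positivity)
  have hbn : b ≤ n := Nat.ceil_le.2 (by nlinarith)
  have hablt : a < b := by
    have : (a:ℝ) < b := by nlinarith
    exact_mod_cast this
  have ppa : pp a = s := by
    simp only [hpp]
    refine max_eq_left ((min_le_right _ _).trans ?_)
    rw [div_le_iff₀ hn0]; linarith
  have ppb : pp b = t := by
    simp only [hpp]
    rw [min_eq_left (by rw [le_div_iff₀ hn0]; linarith), max_eq_right hst]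
  have cell := fun (ω : Ω) (k : ℕ) (hk : k < n) => cell_int n hX.n1 X f hf Cf hfb k ω (hcont k hk ω) (pp k) (pp (k+1)) (hpr k).1 (hpr k).2.2
  have eI : (fun ω => ∫ r in s..t, (f (X r ω) - f (X (kappa n r) ω))) = fun ω => (2*Cf/n) * ∑ k ∈ Finset.Ico a b, Y k ω := by
    funext ω
    have := intervalIntegral.sum_integral_adjacent_intervals_Ico (f := fun r => f (X r ω) - f (X (kappa n r) ω)) (μ := volume) (a := pp) hablt.le
      (fun k hk => (cell ω k (by have := hk.2; omega)).1)
    rw [ppa, ppb] at this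
    rw [← this, Finset.mul_sum]
    refine Finset.sum_congr rfl fun k hk => ?_
    rw [(cell ω k (by have := (Finset.mem_Ico.1 hk).2; omega)).2]
    simp only [hY]
    rw [← mul_assoc, show 2*Cf/n * (n/(2*Cf)) = 1 by field_simp, one_mul]
  rw [eI]
  obtain ⟨L, hL1, hL2⟩ := exists_L (b-a) (by omega)
  have mom := HD Ω P inferInstance _ _ n sys L a b hablt.le hbn hL1 (fun _ => 1) measurable_const ⟨1, by simp⟩ (by simp)
  simp only [one_mul, integral_const, probReal_univ, smul_eq_mul, mul_one] at mom
  set T : ℝ := (2:ℝ)^L with hT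
  have hT0 : 0 < T := by positivity
  set M := D' * T^((1:ℝ)/2+ε) with hM
  have hM0 : 0 < M := by positivity
  have hρL : (ρ^L)^q = (T^((1:ℝ)/2+ε))^(2*q) := by
    rw [pow_mul]
    congr 1
    rw [hρ, hT, ← Real.rpow_natCast (2^(1+2*ε)) L, ← Real.rpow_mul (by norm_num), ← Real.rpow_natCast (2:ℝ) L, ← Real.rpow_mul (by norm_num),
      ← Real.rpow_natCast _ 2, ← Real.rpow_mul (by norm_num)]
    congr 1; push_cast; ring
  have mom2 : ∫ ω, (∑ k ∈ Finset.Ico a b, Y k ω)^(2*q) ∂P ≤ M^(2*q) := by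
    refine mom.trans ?_
    rw [hρL, hM, mul_pow]
    refine mul_le_mul_of_nonneg_right ?_ (by positivity)
    calc D ≤ D' := le_max_right _ _
      _ ≤ D'^(2*q) := le_self_pow₀ hD1 (by omega)
  have Sm : Measurable (fun ω => ∑ k ∈ Finset.Ico a b, Y k ω) :=
    Finset.measurable_fun_sum _ fun k hk => (sys.meas k (by have := (Finset.mem_Ico.1 hk).2; omega)).mono (sys.le _) le_rfl
  have Sb : ∃ c, ∀ ω, |∑ k ∈ Finset.Ico a b, Y k ω| ≤ c :=
    ⟨∑ k ∈ Finset.Ico a b, 1, fun ω => (Finset.abs_sum_le_sum_abs _ _).trans (Finset.sum_le_sum fun k _ => sys.bd k ω)⟩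
  refine (lp_moment P p hp q hq _ Sm Sb (2*Cf/n) M (by positivity) hM0 mom2).trans ?_
  have hT6 : T ≤ 6*(n*(t-s)) := by
    have h1 : T ≤ 2*((b-a:ℕ):ℝ) := by rw [hT]; exact_mod_cast hL2
    rw [Nat.cast_sub hablt.le] at h1
    nlinarith
  have hTe : T^((1:ℝ)/2+ε) ≤ 6^((1:ℝ)/2+ε) * ((n:ℝ)^((1:ℝ)/2+ε) * (t-s)^((1:ℝ)/2+ε)) := by
    rw [← Real.mul_rpow hn0.le hts, ← Real.mul_rpow (by norm_num) (by positivity)]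
    exact Real.rpow_le_rpow hT0.le hT6 (by linarith)
  have hnn : (n:ℝ)^((1:ℝ)/2+ε) / n = (n:ℝ)^(-(1:ℝ)/2+ε) := by
    rw [← Real.rpow_sub_one hn0.ne']; congr 1; ring
  calc 2^(1/p) * (2*Cf/n*M) ≤ 2^(1/p) * (2*Cf/n*(D' * (6^((1:ℝ)/2+ε) * ((n:ℝ)^((1:ℝ)/2+ε) * (t-s)^((1:ℝ)/2+ε))))) := by
        rw [hM]; gcongr
    _ = (2^(1/p) * 2 * D' * 6^(1/2+ε)) * Cf * ((n:ℝ)^((1:ℝ)/2+ε)/n) * (t-s)^((1:ℝ)/2+ε) := by ring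
    _ ≤ N * Cf * (n : ℝ) ^ (-(1 : ℝ)/2 + 2*ε) * (t - s) ^ ((1 : ℝ)/2 + ε) := by
        rw [hnn]; gcongr
end EM

/-- **Lemma 5.1: quadrature bound for the drift-free Euler–Maruyama scheme.**
Let `σ : ℝ^d → ℝ^{d×d}` (as a field of linear maps) be `C²` with
`‖σ‖_{C²} ≤ Cσ` and uniformly elliptic, `σσᵀ ⪰ λ I` (equivalently
`λ‖v‖² ≤ ‖σ(x)ᵀ v‖²` for all `x, v`).  Let `X̄` be the drift-free
Euler–Maruyama scheme started at `y` (characterized by `X̄_0 = y`, the grid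
recursion, and the interpolation identity `X̄_t = X̄_{κ_n(t)} +
σ(X̄_{κ_n(t)})(B_t - B_{κ_n(t)})`).  Then for `f` of class `C^α` (with
admissible norm value `Cf`), `α ∈ (0,1)`, `ε₁ ∈ (0,1/2)`, `p > 0`,
`‖∫_s^t (f(X̄_r) - f(X̄_{κ_n(r)})) dr‖_{L_p}
   ≤ N Cf n^{-1/2+2ε₁} |t-s|^{1/2+ε₁}`, `N = N(α,p,d,ε₁,λ,‖σ‖_{C²})`. -/
theorem stmt_15 (d : ℕ) (hd : 1 ≤ d) (α ε₁ p lam Cσ : ℝ)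
    (hα0 : 0 < α) (hα1 : α < 1) (hε₁0 : 0 < ε₁) (hε₁1 : ε₁ < 1/2)
    (hp : 0 < p) (hlam : 0 < lam) (hCσ : 0 ≤ Cσ) :
    ∃ N : ℝ, 0 < N ∧
      ∀ (Ω : Type) [m0 : MeasurableSpace Ω] (P : Measure Ω), IsProbabilityMeasure P →
      ∀ ℱ : ℝ → MeasurableSpace Ω, Monotone ℱ → (∀ t, ℱ t ≤ m0) →
      ∀ B : ℝ → Ω → EuclideanSpace ℝ (Fin d), IsBrownianMotion P ℱ B →
      ∀ σ : EuclideanSpace ℝ (Fin d) →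
            (EuclideanSpace ℝ (Fin d) →L[ℝ] EuclideanSpace ℝ (Fin d)),
      ContDiff ℝ 2 σ →
      (∀ k : ℕ, k ≤ 2 → ∀ x, ‖iteratedFDeriv ℝ k σ x‖ ≤ Cσ) →
      (∀ x v, lam * ‖v‖ ^ 2 ≤ ‖(ContinuousLinearMap.adjoint (σ x)) v‖ ^ 2) →
      ∀ (y : EuclideanSpace ℝ (Fin d)) (n : ℕ), 1 ≤ n →
      ∀ Xb : ℝ → Ω → EuclideanSpace ℝ (Fin d),
      (∀ ω, Xb 0 ω = y) →
      (∀ j : ℕ, 1 ≤ j → j ≤ n → ∀ ω,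
        Xb ((j : ℝ)/n) ω
          = Xb (((j : ℝ) - 1)/n) ω
            + (σ (Xb (((j : ℝ) - 1)/n) ω)) (B ((j : ℝ)/n) ω - B (((j : ℝ) - 1)/n) ω)) →
      (∀ t : ℝ, 0 ≤ t → t ≤ 1 → ∀ ω,
        Xb t ω = Xb (kappa n t) ω
          + (σ (Xb (kappa n t) ω)) (B t ω - B (kappa n t) ω)) →
      ∀ (f : EuclideanSpace ℝ (Fin d) → ℝ) (Cf : ℝ), Measurable f → 0 ≤ Cf →
      (∀ x, |f x| ≤ Cf) →
      (∀ x y', |f x - f y'| ≤ Cf * ‖x - y'‖ ^ α) →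
      ∀ s t : ℝ, 0 ≤ s → s ≤ t → t ≤ 1 →
        lpNorm P p (fun ω => ∫ r in s..t, (f (Xb r ω) - f (Xb (kappa n r) ω)))
          ≤ N * Cf * (n : ℝ) ^ (-(1 : ℝ)/2 + 2*ε₁) * (t - s) ^ ((1 : ℝ)/2 + ε₁) := by
  obtain ⟨N, hN, H⟩ := EM.final_bound d (max 1 (Real.sqrt lam)⁻¹) (max 1 Cσ) ε₁ p hε₁0 hε₁1 hp
  refine ⟨N, hN, ?_⟩
  intro Ω m0 P hP ℱ hmono hle B hB σ hσ hb he y n hn Xb hX0 hXg hXt f Cf hf hCf hfb _ s t hs hst ht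
  obtain ⟨σi, hS⟩ := EM.sg_of hlam hCσ σ hσ hb he
  obtain ⟨hch, key⟩ := EM.chain_of P ℱ hmono hle B hB hS y n hn Xb hX0 hXg hXt
  refine H P ℱ σ σi n Xb hS hch ?_ f hf Cf hCf hfb s t hs hst ht
  intro k hk ω
  have hn0 : (0:ℝ) < n := by exact_mod_cast hn
  have h1 : ContinuousOn (fun v => B ((k:ℝ)/n + v) ω) (Icc 0 (1/(n:ℝ))) := by
    refine (hB.contPaths ω).comp (by fun_prop) fun v hv => ?_
    have h2 : (k:ℝ)/n + 1/n ≤ 1 := by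
      rw [← add_div, div_le_one hn0]; exact_mod_cast hk
    have h3 : (0:ℝ) ≤ (k:ℝ)/n := by positivity
    exact ⟨by linarith [hv.1], by linarith [hv.2]⟩
  have h2 : ContinuousOn (fun v => Xb ((k:ℝ)/n) ω + σ (Xb ((k:ℝ)/n) ω) (B ((k:ℝ)/n+v) ω - B ((k:ℝ)/n) ω)) (Icc 0 (1/(n:ℝ))) :=
    continuousOn_const.add ((σ (Xb ((k:ℝ)/n) ω)).continuous.comp_continuousOn (h1.sub continuousOn_const))
  exact h2.congr fun v hv => key ω k hk v hv.1 hv.2
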